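/- Let α > 0, s > 1/2, and let u₀ ∈ H^s₊(S¹) be such that K_{u₀} has finite rank and Σ_K(u₀) = {σ} is a single point whose eigenspace F_{u₀}(σ) has dimension equal to rank K_{u₀}. Let u be the solution of the α-Szegő equation with u(0) = u₀. Then there exists C_α > 0 such that ‖u(t)‖_{H^s} grows exponentially, i.e. c·e^{C_α(2s−1)|t|} ≤ ‖u(t)‖_{H^s} ≤ C·e^{C_α(2s−1)|t|} for large |t| (for some 0 < c ≤ C), if and only if L_1(u₀) := (K_{u₀}²(u₀) | u₀) − α (K_{u₀}²(1) | 1) = 0. -/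

import Mathlib

open Complex Filter
open scoped ComplexConjugate Topology ENNReal

noncomputable section

/-- ℓ²(ℕ, ℂ): the sequence model of the Hardy space L²₊(S¹), identifying a function
with its sequence of nonnegative Fourier coefficients. -/
abbrev Hardy : Type := lp (fun _ : ℕ => ℂ) 2

/-- A coefficient sequence belongs to L²₊. -/
def MemL2 (u : ℕ → ℂ) : Prop := Memℓp u 2

/-- A coefficient sequence belongs to the Sobolev space H^s₊. -/
def MemHs (s : ℝ) (u : ℕ → ℂ) : Prop :=
  Summable fun n : ℕ => ((1 : ℝ) + (n : ℝ) ^ 2) ^ s * ‖u n‖ ^ 2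

/-- The squared H^s norm of a coefficient sequence. -/
def hsNormSq (s : ℝ) (u : ℕ → ℂ) : ℝ :=
  ∑' n : ℕ, ((1 : ℝ) + (n : ℝ) ^ 2) ^ s * ‖u n‖ ^ 2

/-- The L² inner product (f|g), ℂ-linear in the first argument. -/
def hinner (f g : ℕ → ℂ) : ℂ := ∑' n : ℕ, f n * conj (g n)

/-- The squared L² norm. -/
def l2normSq (f : ℕ → ℂ) : ℝ := ∑' n : ℕ, ‖f n‖ ^ 2

/-- Coefficients of the constant function 1. -/
def oneSeq : ℕ → ℂ := fun n => if n = 0 then 1 else 0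

/-- The Hankel operator H_u(h) = Π(u ⬝ conj h) in Fourier coefficients. -/
def hankel (u h : ℕ → ℂ) : ℕ → ℂ := fun k => ∑' ℓ : ℕ, u (k + ℓ) * conj (h ℓ)

/-- The shifted Hankel operator K_u = T_z^* ∘ H_u in Fourier coefficients. -/
def khankel (u h : ℕ → ℂ) : ℕ → ℂ := fun k => ∑' ℓ : ℕ, u (k + 1 + ℓ) * conj (h ℓ)

/-- H_u². -/
def hu2 (u h : ℕ → ℂ) : ℕ → ℂ := hankel u (hankel u h)

/-- K_u². -/
def ku2 (u h : ℕ → ℂ) : ℕ → ℂ := khankel u (khankel u h)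

/-- The m-th Fourier coefficient of |u|², m ∈ ℤ. -/
def absSqCoeff (u : ℕ → ℂ) (m : ℤ) : ℂ :=
  ∑' q : ℕ × ℕ, if ((q.1 : ℤ) - (q.2 : ℤ) = m) then u q.1 * conj (u q.2) else 0

/-- The Toeplitz operator T_{|u|²} in Fourier coefficients. -/
def toeplitzAbsSq (u h : ℕ → ℂ) : ℕ → ℂ :=
  fun k => ∑' ℓ : ℕ, absSqCoeff u ((k : ℤ) - (ℓ : ℤ)) * h ℓ

/-- Fourier coefficients of Π(|u|²u). -/
def cubic (u : ℕ → ℂ) : ℕ → ℂ := fun n =>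
  ∑' q : ℕ × ℕ × ℕ, if q.1 + q.2.2 = q.2.1 + n then u q.1 * conj (u q.2.1) * u q.2.2 else 0

/-- `u : ℝ → (ℕ → ℂ)` solves the α-Szegő equation i ∂ₜ u = Π(|u|²u) + α(u|1),
written coefficientwise on nonnegative Fourier modes. -/
def SolvesSzego (α : ℝ) (u : ℝ → ℕ → ℂ) : Prop :=
  ∀ n t, HasDerivAt (fun τ => u τ n)
    (-Complex.I * (cubic (u t) n + (α : ℂ) * u t 0 * oneSeq n)) t

/-- `u` is a smooth curve valued in H^s₊. -/
def SmoothHsCurve (s : ℝ) (u : ℝ → ℕ → ℂ) : Prop :=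
  (∀ t, MemHs s (u t)) ∧ ∀ n, ContDiff ℝ (⊤ : ℕ∞) fun t => u t n

/-- `u` is a continuous curve valued in H^s₊. -/
def ContHsCurve (s : ℝ) (u : ℝ → ℕ → ℂ) : Prop :=
  (∀ t, MemHs s (u t)) ∧
    ∀ t₀ : ℝ, Tendsto (fun t => hsNormSq s (fun n => u t n - u t₀ n)) (𝓝 t₀) (𝓝 0)

/-- E_u(τ) = ker(H_u² − τ² I) as a subset of ℓ². -/
def Espace (u : ℕ → ℂ) (τ : ℝ) : Set (ℕ → ℂ) :=
  {h | MemL2 h ∧ hu2 u h = ((τ : ℂ) ^ 2) • h}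

/-- F_u(τ) = ker(K_u² − τ² I) as a subset of ℓ². -/
def Fspace (u : ℕ → ℂ) (τ : ℝ) : Set (ℕ → ℂ) :=
  {h | MemL2 h ∧ ku2 u h = ((τ : ℂ) ^ 2) • h}

/-- Σ_H(u): τ > 0 such that E_u(τ) is not orthogonal to u. -/
def SigmaH (u : ℕ → ℂ) : Set ℝ :=
  {τ : ℝ | 0 < τ ∧ ∃ v ∈ Espace u τ, hinner u v ≠ 0}

/-- Σ_K(u): τ ≥ 0 such that F_u(τ) is not orthogonal to u. -/
def SigmaK (u : ℕ → ℂ) : Set ℝ :=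
  {τ : ℝ | 0 ≤ τ ∧ ∃ v ∈ Fspace u τ, hinner u v ≠ 0}

/-- `p` is the orthogonal projection of `w` on the subspace `V` of ℓ². -/
def IsOrthProj (V : Set (ℕ → ℂ)) (w p : ℕ → ℂ) : Prop :=
  p ∈ V ∧ ∀ v ∈ V, hinner (w - p) v = 0

/-- The rank of the shifted Hankel operator K_u. -/
def kuRank (u : ℕ → ℂ) : Cardinal :=
  Module.rank ℂ (Submodule.span ℂ (khankel u '' {h | MemL2 h}))

/-- The rank of the Hankel operator H_u. -/
def huRank (u : ℕ → ℂ) : Cardinal :=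
  Module.rank ℂ (Submodule.span ℂ (hankel u '' {h | MemL2 h}))

/-- ℒ(N) : rank K_u = N. -/
def InLN (N : ℕ) (u : ℕ → ℂ) : Prop := MemL2 u ∧ kuRank u = N

/-- The constant function 1 as an element of ℓ². -/
def oneH : Hardy := lp.single 2 0 1

theorem summable_and_tsum_le_of_ofReal {ι : Type*} {f : ι → ℝ} (hf : ∀ i, 0 ≤ f i) {C : ℝ}
    (hC : 0 ≤ C) (h : ∑' i, ENNReal.ofReal (f i) ≤ ENNReal.ofReal C) :
    Summable f ∧ ∑' i, f i ≤ C := by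
  have key : ∀ s : Finset ι, ∑ i ∈ s, f i ≤ C := by
    intro s
    have h1 : ENNReal.ofReal (∑ i ∈ s, f i) ≤ ENNReal.ofReal C := by
      rw [ENNReal.ofReal_sum_of_nonneg fun i _ => hf i]
      exact (ENNReal.sum_le_tsum s).trans h
    exact (ENNReal.ofReal_le_ofReal_iff hC).1 h1
  have hs : Summable f := summable_of_sum_le hf key
  exact ⟨hs, hs.tsum_le_of_sum_le key⟩

/-- The resonance condition of the cubic term; `p = (n, n₁, n₂, n₃)`. -/
abbrev Res (p : ℕ × ℕ × ℕ × ℕ) : Prop := p.2.1 + p.2.2.2 = p.2.2.1 + p.1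

/-- Exchange of the two sides of the resonance condition. -/
def resFlip : (ℕ × ℕ × ℕ × ℕ) ≃ (ℕ × ℕ × ℕ × ℕ) where
  toFun p := (p.2.1, p.1, p.2.2.2, p.2.2.1)
  invFun p := (p.2.1, p.1, p.2.2.2, p.2.2.1)
  left_inv _ := rfl
  right_inv _ := rfl

/-- Exchange of the two conjugated frequencies. -/
def resSwapConj : (ℕ × ℕ × ℕ × ℕ) ≃ (ℕ × ℕ × ℕ × ℕ) where
  toFun p := (p.2.2.1, p.2.1, p.1, p.2.2.2)
  invFun p := (p.2.2.1, p.2.1, p.1, p.2.2.2)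
  left_inv _ := rfl
  right_inv _ := rfl

/-- Exchange of the two unconjugated frequencies. -/
def resSwap : (ℕ × ℕ × ℕ × ℕ) ≃ (ℕ × ℕ × ℕ × ℕ) where
  toFun p := (p.1, p.2.2.2, p.2.2.1, p.2.1)
  invFun p := (p.1, p.2.2.2, p.2.2.1, p.2.1)
  left_inv _ := rfl
  right_inv _ := rfl

theorem res_resFlip (p : ℕ × ℕ × ℕ × ℕ) : Res (resFlip p) ↔ Res p := by
  simp only [Res, resFlip, Equiv.coe_fn_mk]; omega

theorem res_resSwapConj (p : ℕ × ℕ × ℕ × ℕ) : Res (resSwapConj p) ↔ Res p := by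
  simp only [Res, resSwapConj, Equiv.coe_fn_mk]; omega

theorem res_resSwap (p : ℕ × ℕ × ℕ × ℕ) : Res (resSwap p) ↔ Res p := by
  simp only [Res, resSwap, Equiv.coe_fn_mk]; omega

theorem tsum_res_le (x y z : ℕ → ℝ≥0∞) :
    ∑' p : ℕ × ℕ × ℕ × ℕ, (if Res p then x p.2.1 * y p.2.2.1 * z p.2.2.2 else 0)
      ≤ (∑' n, x n) * (∑' n, y n) * ∑' n, z n := by
  rw [ENNReal.tsum_prod', ENNReal.tsum_comm]
  calc ∑' q : ℕ × ℕ × ℕ, ∑' n : ℕ, (if Res (n, q) then x q.1 * y q.2.1 * z q.2.2 else 0)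
      ≤ ∑' q : ℕ × ℕ × ℕ, x q.1 * y q.2.1 * z q.2.2 := by
        refine ENNReal.tsum_le_tsum fun q => ?_
        rw [tsum_eq_single (q.1 + q.2.2 - q.2.1)]
        · split_ifs <;> simp
        · intro n hn
          rw [if_neg]
          simp only [Res]
          omega
    _ = (∑' n, x n) * (∑' n, y n) * ∑' n, z n := by
        rw [ENNReal.tsum_prod']
        simp_rw [ENNReal.tsum_prod', ENNReal.tsum_mul_left, ENNReal.tsum_mul_right]
        simp_rw [ENNReal.tsum_mul_left, ENNReal.tsum_mul_right]

theorem tsum_res_weight_le (a w : ℕ → ℝ≥0∞)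
    (hw : ∀ n i j, n ≤ i + j → w n ≤ w i + w j) :
    ∑' p : ℕ × ℕ × ℕ × ℕ, (if Res p then
        w p.1 ^ 2 * (a p.1 * (a p.2.1 * a p.2.2.1 * a p.2.2.2)) else 0)
      ≤ 2 * ((∑' n, w n ^ 2 * a n ^ 2) * (∑' n, a n) * ∑' n, a n) := by
  set S := (∑' n, w n ^ 2 * a n ^ 2) * (∑' n, a n) * ∑' n, a n with hS
  have amgm : ∀ x y : ℝ≥0∞, 2 * (x * y) ≤ x ^ 2 + y ^ 2 := by
    intro x y
    rcases eq_or_ne x ⊤ with rfl | hx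
    · simp
    rcases eq_or_ne y ⊤ with rfl | hy
    · simp
    lift x to NNReal using hx
    lift y to NNReal using hy
    norm_cast
    have := two_mul_le_add_sq (x : ℝ) y
    rw [← NNReal.coe_le_coe]
    push_cast
    linarith
  have h1 : ∑' p : ℕ × ℕ × ℕ × ℕ, (if Res p then
      (w p.2.1 ^ 2 * a p.2.1 ^ 2) * a p.2.2.1 * a p.2.2.2 else 0) ≤ S :=
    tsum_res_le (fun n => w n ^ 2 * a n ^ 2) a a
  have h2 : ∑' p : ℕ × ℕ × ℕ × ℕ, (if Res p then
      (w p.1 ^ 2 * a p.1 ^ 2) * a p.2.2.1 * a p.2.2.2 else 0) ≤ S := by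
    rw [← resFlip.tsum_eq]
    refine le_of_eq_of_le (tsum_congr fun p => ?_) h1
    simp only [res_resFlip]
    simp only [resFlip, Equiv.coe_fn_mk]
    split_ifs <;> ring
  have h3 : 2 * ∑' p : ℕ × ℕ × ℕ × ℕ, (if Res p then
      (w p.1 * a p.1) * (w p.2.1 * a p.2.1) * (a p.2.2.1 * a p.2.2.2) else 0) ≤ 2 * S := by
    rw [two_mul S, ← ENNReal.tsum_mul_left]
    refine le_trans ?_ (add_le_add h2 h1)
    rw [← ENNReal.tsum_add]
    refine ENNReal.tsum_le_tsum fun p => ?_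
    split_ifs
    · calc _ = (2 * ((w p.1 * a p.1) * (w p.2.1 * a p.2.1))) * (a p.2.2.1 * a p.2.2.2) := by ring
        _ ≤ ((w p.1 * a p.1) ^ 2 + (w p.2.1 * a p.2.1) ^ 2) * (a p.2.2.1 * a p.2.2.2) := by
          gcongr; exact amgm _ _
        _ = _ := by ring
    · simp
  have h4 : ∑' p : ℕ × ℕ × ℕ × ℕ, (if Res p then
      (w p.1 * a p.1) * (w p.2.2.2 * a p.2.2.2) * (a p.2.2.1 * a p.2.1) else 0) =
      ∑' p : ℕ × ℕ × ℕ × ℕ, (if Res p then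
      (w p.1 * a p.1) * (w p.2.1 * a p.2.1) * (a p.2.2.1 * a p.2.2.2) else 0) := by
    rw [← resSwap.tsum_eq]
    refine tsum_congr fun p => ?_
    simp only [res_resSwap]
    simp only [resSwap, Equiv.coe_fn_mk]
  refine le_trans ?_ h3
  conv_rhs => rw [two_mul]
  nth_rewrite 2 [← h4]
  rw [← ENNReal.tsum_add]
  refine ENNReal.tsum_le_tsum fun p => ?_
  split_ifs with hp
  · have : w p.1 ≤ w p.2.1 + w p.2.2.2 := hw _ _ _ (by simp only [Res] at hp; omega)
    calc _ = w p.1 * (w p.1 * (a p.1 * (a p.2.1 * a p.2.2.1 * a p.2.2.2))) := by ring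
      _ ≤ (w p.2.1 + w p.2.2.2) * (w p.1 * (a p.1 * (a p.2.1 * a p.2.2.1 * a p.2.2.2))) := by
        gcongr
      _ = _ := by ring
  · simp

theorem summable_res_and_tsum_le {x y z : ℕ → ℝ} (hx : ∀ n, 0 ≤ x n) (hy : ∀ n, 0 ≤ y n)
    (hz : ∀ n, 0 ≤ z n) (sx : Summable x) (sy : Summable y) (sz : Summable z) :
    Summable (fun p : ℕ × ℕ × ℕ × ℕ => if Res p then x p.2.1 * y p.2.2.1 * z p.2.2.2 else 0) ∧
    ∑' p : ℕ × ℕ × ℕ × ℕ, (if Res p then x p.2.1 * y p.2.2.1 * z p.2.2.2 else 0)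
      ≤ (∑' n, x n) * (∑' n, y n) * ∑' n, z n := by
  have hX : 0 ≤ ∑' n, x n := tsum_nonneg hx
  have hY : 0 ≤ ∑' n, y n := tsum_nonneg hy
  have hZ : 0 ≤ ∑' n, z n := tsum_nonneg hz
  refine summable_and_tsum_le_of_ofReal (fun p => ?_) (by positivity) ?_
  · have := hx p.2.1; have := hy p.2.2.1; have := hz p.2.2.2
    split_ifs <;> positivity
  · rw [ENNReal.ofReal_mul (by positivity), ENNReal.ofReal_mul (by positivity),
      ENNReal.ofReal_tsum_of_nonneg hx sx, ENNReal.ofReal_tsum_of_nonneg hy sy,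
      ENNReal.ofReal_tsum_of_nonneg hz sz]
    refine le_of_eq_of_le (tsum_congr fun p => ?_) (tsum_res_le _ _ _)
    have := hx p.2.1; have := hy p.2.2.1
    split_ifs
    · rw [ENNReal.ofReal_mul (by positivity), ENNReal.ofReal_mul (by positivity)]
    · simp

theorem summable_res_weight_and_tsum_le {a w : ℕ → ℝ} (ha : ∀ n, 0 ≤ a n) (hw0 : ∀ n, 0 ≤ w n)
    (hw : ∀ n i j, n ≤ i + j → w n ≤ w i + w j) (sa : Summable a)
    (sb : Summable fun n => w n ^ 2 * a n ^ 2) :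
    Summable (fun p : ℕ × ℕ × ℕ × ℕ => if Res p then
        w p.1 ^ 2 * (a p.1 * (a p.2.1 * a p.2.2.1 * a p.2.2.2)) else 0) ∧
    ∑' p : ℕ × ℕ × ℕ × ℕ, (if Res p then
        w p.1 ^ 2 * (a p.1 * (a p.2.1 * a p.2.2.1 * a p.2.2.2)) else 0)
      ≤ 2 * ((∑' n, w n ^ 2 * a n ^ 2) * (∑' n, a n) * ∑' n, a n) := by
  have hA : 0 ≤ ∑' n, a n := tsum_nonneg ha
  have hb : ∀ n, 0 ≤ w n ^ 2 * a n ^ 2 := fun n => by positivity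
  have hB : 0 ≤ ∑' n, w n ^ 2 * a n ^ 2 := tsum_nonneg hb
  refine summable_and_tsum_le_of_ofReal (fun p => ?_) (by positivity) ?_
  · have := ha p.1; have := ha p.2.1; have := ha p.2.2.1; have := ha p.2.2.2
    split_ifs <;> positivity
  · rw [ENNReal.ofReal_mul (by positivity), ENNReal.ofReal_mul (by positivity),
      ENNReal.ofReal_mul (by positivity),
      ENNReal.ofReal_tsum_of_nonneg hb sb, ENNReal.ofReal_tsum_of_nonneg ha sa,
      ENNReal.ofReal_ofNat]
    have h := tsum_res_weight_le (fun n => ENNReal.ofReal (a n)) (fun n => ENNReal.ofReal (w n))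
      (fun n i j hn => by
        rw [← ENNReal.ofReal_add (hw0 i) (hw0 j)]
        exact ENNReal.ofReal_le_ofReal (hw n i j hn))
    have hsq : ∀ n, ENNReal.ofReal (w n ^ 2 * a n ^ 2) =
        ENNReal.ofReal (w n) ^ 2 * ENNReal.ofReal (a n) ^ 2 := fun n => by
      have := hw0 n
      rw [ENNReal.ofReal_mul (by positivity), ENNReal.ofReal_pow (hw0 n), ENNReal.ofReal_pow (ha n)]
    simp_rw [hsq]
    refine le_of_eq_of_le (tsum_congr fun p => ?_) h
    have := ha p.1; have := ha p.2.1; have := ha p.2.2.1; have := hw0 p.1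
    split_ifs
    · rw [ENNReal.ofReal_mul (by positivity), ENNReal.ofReal_mul (by positivity),
        ENNReal.ofReal_mul (by positivity), ENNReal.ofReal_mul (by positivity),
        ENNReal.ofReal_pow (by positivity)]
    · simp

theorem summable_cubic_term {u : ℕ → ℂ} (su : Summable fun n => ‖u n‖) (n : ℕ) :
    Summable fun q : ℕ × ℕ × ℕ =>
      if q.1 + q.2.2 = q.2.1 + n then u q.1 * conj (u q.2.1) * u q.2.2 else 0 := by
  have h := (summable_res_and_tsum_le (fun n => norm_nonneg (u n)) (fun n => norm_nonneg (u n))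
    (fun n => norm_nonneg (u n)) su su su).1.prod_factor n
  refine Summable.of_norm (h.congr fun q => ?_)
  simp only [Res]
  split_ifs <;> simp

/-- The quartic resonant term. -/
def quartic (u : ℕ → ℂ) (p : ℕ × ℕ × ℕ × ℕ) : ℂ :=
  if Res p then u p.2.1 * conj (u p.2.2.1) * u p.2.2.2 * conj (u p.1) else 0

theorem norm_quartic (u : ℕ → ℂ) (p : ℕ × ℕ × ℕ × ℕ) : ‖quartic u p‖ =
    if Res p then ‖u p.1‖ * (‖u p.2.1‖ * ‖u p.2.2.1‖ * ‖u p.2.2.2‖) else 0 := by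
  unfold quartic
  split_ifs
  · simp; ring
  · simp

theorem cubic_mul_conj (u : ℕ → ℂ) (n : ℕ) :
    cubic u n * conj (u n) = ∑' q : ℕ × ℕ × ℕ, quartic u (n, q) := by
  rw [cubic, ← tsum_mul_right]
  refine tsum_congr fun q => ?_
  simp only [quartic, Res, ite_mul, zero_mul]

theorem summable_quartic_fiber {u : ℕ → ℂ} (su : Summable fun n => ‖u n‖) (n : ℕ) :
    Summable fun q : ℕ × ℕ × ℕ => ‖quartic u (n, q)‖ := by
  have h := ((summable_cubic_term su n).mul_right (conj (u n))).norm
  refine h.congr fun q => ?_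
  simp only [quartic, Res, ite_mul, zero_mul]

section Weighted

variable {u : ℕ → ℂ} {w : ℕ → ℝ}

theorem summable_weight_quartic (hw0 : ∀ n, 0 ≤ w n)
    (hw : ∀ n i j, n ≤ i + j → w n ≤ w i + w j) (su : Summable fun n => ‖u n‖)
    (sb : Summable fun n => w n ^ 2 * ‖u n‖ ^ 2) :
    Summable (fun p => w p.1 ^ 2 * ‖quartic u p‖) ∧
    ∑' p, w p.1 ^ 2 * ‖quartic u p‖ ≤
      2 * ((∑' n, w n ^ 2 * ‖u n‖ ^ 2) * (∑' n, ‖u n‖) * ∑' n, ‖u n‖) := by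
  have h := summable_res_weight_and_tsum_le (fun n => norm_nonneg (u n)) hw0 hw su sb
  have e : ∀ p, w p.1 ^ 2 * ‖quartic u p‖ = if Res p then
        w p.1 ^ 2 * (‖u p.1‖ * (‖u p.2.1‖ * ‖u p.2.2.1‖ * ‖u p.2.2.2‖)) else 0 := fun p => by
    rw [norm_quartic, mul_ite, mul_zero]
  simp_rw [e]
  exact h

theorem sum_weight_cubic_le (hw0 : ∀ n, 0 ≤ w n)
    (hw : ∀ n i j, n ≤ i + j → w n ≤ w i + w j) (su : Summable fun n => ‖u n‖)
    (sb : Summable fun n => w n ^ 2 * ‖u n‖ ^ 2) (s : Finset ℕ) :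
    ∑ n ∈ s, w n ^ 2 * ‖cubic u n * conj (u n)‖ ≤
      2 * ((∑' n, w n ^ 2 * ‖u n‖ ^ 2) * (∑' n, ‖u n‖) * ∑' n, ‖u n‖) := by
  obtain ⟨h1, h2⟩ := summable_weight_quartic hw0 hw su sb
  refine le_trans ?_ h2
  rw [h1.tsum_prod]
  refine le_trans (Finset.sum_le_sum fun n _ => ?_)
    (h1.prod.sum_le_tsum s fun n _ => tsum_nonneg fun q => by positivity)
  show _ ≤ ∑' q, w n ^ 2 * ‖quartic u (n, q)‖
  rw [cubic_mul_conj, tsum_mul_left]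
  exact mul_le_mul_of_nonneg_left (norm_tsum_le_tsum_norm (summable_quartic_fiber su n))
    (by positivity)

end Weighted

theorem quartic_resSwapConj (u : ℕ → ℂ) (p : ℕ × ℕ × ℕ × ℕ) :
    quartic u (resSwapConj p) = quartic u p := by
  unfold quartic
  simp only [res_resSwapConj]
  simp only [resSwapConj, Equiv.coe_fn_mk]
  split_ifs <;> ring

theorem quartic_resSwap (u : ℕ → ℂ) (p : ℕ × ℕ × ℕ × ℕ) :
    quartic u (resSwap p) = quartic u p := by
  unfold quartic
  simp only [res_resSwap]
  simp only [resSwap, Equiv.coe_fn_mk]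
  split_ifs <;> ring

theorem quartic_resFlip (u : ℕ → ℂ) (p : ℕ × ℕ × ℕ × ℕ) :
    quartic u (resFlip p) = conj (quartic u p) := by
  unfold quartic
  simp only [res_resFlip]
  simp only [resFlip, Equiv.coe_fn_mk]
  split_ifs
  · simp only [map_mul, conj_conj]; ring
  · simp

/-- Conservation of mass and momentum at the level of the nonlinearity. -/
theorem hasSum_weight_im_cubic {u : ℕ → ℂ} {c : ℝ} (hc : 0 ≤ c) (su : Summable fun n => ‖u n‖)
    (sb : Summable fun n : ℕ => ((n : ℝ) + c) * ‖u n‖ ^ 2) :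
    HasSum (fun n : ℕ => ((n : ℝ) + c) * (cubic u n * conj (u n)).im) 0 := by
  set w : ℕ → ℝ := fun n => √((n : ℝ) + c) with hwdef
  have hsq : ∀ n, w n ^ 2 = (n : ℝ) + c := fun n => Real.sq_sqrt (by positivity)
  have hw : ∀ n i j : ℕ, n ≤ i + j → w n ≤ w i + w j := by
    intro n i j hn
    have h0 : (n : ℝ) ≤ i + j := by exact_mod_cast hn
    refine Real.sqrt_le_iff.2 ⟨by positivity, ?_⟩
    have := hsq i; have := hsq j
    have : 0 ≤ w i * w j := by positivity
    nlinarith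
  have h1 : Summable fun p : ℕ × ℕ × ℕ × ℕ => ((p.1 : ℝ) + c) * ‖quartic u p‖ :=
    ((summable_weight_quartic (w := w) (fun n => Real.sqrt_nonneg _) hw su
      (sb.congr fun n => by rw [hsq])).1).congr fun p => by rw [hsq]
  set Q : ℕ × ℕ × ℕ × ℕ → ℝ := fun p => (quartic u p).im with hQ
  have hbound : ∀ p, ‖((p.1 : ℝ) + c) * Q p‖ ≤ ((p.1 : ℝ) + c) * ‖quartic u p‖ := fun p => by
    rw [norm_mul, Real.norm_of_nonneg (by positivity)]
    exact mul_le_mul_of_nonneg_left (Complex.abs_im_le_norm _) (by positivity)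
  have sA : Summable fun p : ℕ × ℕ × ℕ × ℕ => ((p.1 : ℝ) + c) * Q p :=
    Summable.of_norm_bounded h1 hbound
  have key : ∑' p : ℕ × ℕ × ℕ × ℕ, ((p.1 : ℝ) + c) * Q p = 0 := by
    have sB : Summable fun p : ℕ × ℕ × ℕ × ℕ => ((p.2.2.1 : ℝ) + c) * Q p := by
      refine (resSwapConj.summable_iff.2 sA).congr fun p => ?_
      simp only [Function.comp, hQ, quartic_resSwapConj]
      simp only [resSwapConj, Equiv.coe_fn_mk]
    have eB : ∑' p : ℕ × ℕ × ℕ × ℕ, ((p.2.2.1 : ℝ) + c) * Q p =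
        ∑' p : ℕ × ℕ × ℕ × ℕ, ((p.1 : ℝ) + c) * Q p := by
      rw [← resSwapConj.tsum_eq]
      refine tsum_congr fun p => ?_
      simp only [hQ, quartic_resSwapConj]
      simp only [resSwapConj, Equiv.coe_fn_mk]
    have sC : Summable fun p : ℕ × ℕ × ℕ × ℕ => ((p.2.1 : ℝ) + c) * Q p := by
      refine (resFlip.summable_iff.2 sA).neg.congr fun p => ?_
      simp only [Function.comp, hQ, quartic_resFlip, conj_im]
      simp only [resFlip, Equiv.coe_fn_mk]
      ring
    have eC : ∑' p : ℕ × ℕ × ℕ × ℕ, ((p.2.1 : ℝ) + c) * Q p =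
        -∑' p : ℕ × ℕ × ℕ × ℕ, ((p.1 : ℝ) + c) * Q p := by
      rw [← resFlip.tsum_eq, ← tsum_neg]
      refine tsum_congr fun p => ?_
      simp only [hQ, quartic_resFlip, conj_im]
      simp only [resFlip, Equiv.coe_fn_mk]
      ring
    have sD : Summable fun p : ℕ × ℕ × ℕ × ℕ => ((p.2.2.2 : ℝ) + c) * Q p := by
      refine (resSwap.summable_iff.2 sC).congr fun p => ?_
      simp only [Function.comp, hQ, quartic_resSwap]
      simp only [resSwap, Equiv.coe_fn_mk]
    have eD : ∑' p : ℕ × ℕ × ℕ × ℕ, ((p.2.2.2 : ℝ) + c) * Q p =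
        ∑' p : ℕ × ℕ × ℕ × ℕ, ((p.2.1 : ℝ) + c) * Q p := by
      rw [← resSwap.tsum_eq]
      refine tsum_congr fun p => ?_
      simp only [hQ, quartic_resSwap]
      simp only [resSwap, Equiv.coe_fn_mk]
    have e : ∑' p : ℕ × ℕ × ℕ × ℕ, (((p.1 : ℝ) + c) * Q p + ((p.2.2.1 : ℝ) + c) * Q p) =
        ∑' p : ℕ × ℕ × ℕ × ℕ, (((p.2.1 : ℝ) + c) * Q p + ((p.2.2.2 : ℝ) + c) * Q p) := by
      refine tsum_congr fun p => ?_
      by_cases hp : Res p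
      · have : (p.2.1 : ℝ) + p.2.2.2 = p.2.2.1 + p.1 := by exact_mod_cast hp
        linear_combination (-Q p) * this
      · have : Q p = 0 := by simp [hQ, quartic, hp]
        simp [this]
    rw [sA.tsum_add sB, sC.tsum_add sD, eD, eB, eC] at e
    linarith
  have hs := sA.hasSum
  rw [key] at hs
  refine hs.prod_fiberwise fun n => ?_
  rw [cubic_mul_conj]
  have := (summable_quartic_fiber su n).of_norm.hasSum
  exact (Complex.hasSum_im this).mul_left _

theorem sum_cubic_sub_le {u v : ℕ → ℂ} {M : ℝ} (su : Summable fun n => ‖u n‖)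
    (sv : Summable fun n => ‖v n‖) (hu : ∑' n, ‖u n‖ ≤ M) (hv : ∑' n, ‖v n‖ ≤ M)
    (s : Finset ℕ) :
    ∑ n ∈ s, ‖cubic u n - cubic v n‖ ≤ 3 * M ^ 2 * ∑' n, ‖u n - v n‖ := by
  have sd : Summable fun n => ‖u n - v n‖ :=
    Summable.of_nonneg_of_le (fun _ => norm_nonneg _) (fun n => norm_sub_le _ _) (su.add sv)
  have n0 : ∀ f : ℕ → ℂ, ∀ n, 0 ≤ ‖f n‖ := fun f n => norm_nonneg _
  obtain ⟨s1, h1⟩ := summable_res_and_tsum_le (n0 (fun n => u n - v n)) (n0 u) (n0 u) sd su su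
  obtain ⟨s2, h2⟩ := summable_res_and_tsum_le (n0 v) (n0 (fun n => u n - v n)) (n0 u) sv sd su
  obtain ⟨s3, h3⟩ := summable_res_and_tsum_le (n0 v) (n0 v) (n0 (fun n => u n - v n)) sv sv sd
  set D := ∑' n, ‖u n - v n‖ with hD
  have D0 : 0 ≤ D := tsum_nonneg fun n => norm_nonneg _
  have hU : 0 ≤ ∑' n, ‖u n‖ := tsum_nonneg (n0 u)
  have hV : 0 ≤ ∑' n, ‖v n‖ := tsum_nonneg (n0 v)
  have hM := hU.trans hu
  have b1 : D * (∑' n, ‖u n‖) * (∑' n, ‖u n‖) ≤ D * M * M := by gcongr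
  have b2 : (∑' n, ‖v n‖) * D * (∑' n, ‖u n‖) ≤ M * D * M := by gcongr
  have b3 : (∑' n, ‖v n‖) * (∑' n, ‖v n‖) * D ≤ M * M * D := by gcongr
  have s123 := (s1.add s2).add s3
  have hle : ∑ n ∈ s, ‖cubic u n - cubic v n‖ ≤ _ :=
    le_trans (Finset.sum_le_sum fun n _ => ?_)
      (s123.prod.sum_le_tsum s fun n _ => tsum_nonneg fun q => by
        dsimp only
        split_ifs <;> positivity)
  · rw [← s123.tsum_prod, (s1.add s2).tsum_add s3, s1.tsum_add s2] at hle
    nlinarith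
  · rw [cubic, cubic, ← (summable_cubic_term su n).tsum_sub (summable_cubic_term sv n)]
    refine tsum_of_norm_bounded (s123.prod_factor n).hasSum fun q => ?_
    simp only [Res]
    split_ifs with hq
    · calc ‖u q.1 * conj (u q.2.1) * u q.2.2 - v q.1 * conj (v q.2.1) * v q.2.2‖
          = ‖(u q.1 - v q.1) * conj (u q.2.1) * u q.2.2
            + v q.1 * conj (u q.2.1 - v q.2.1) * u q.2.2
            + v q.1 * conj (v q.2.1) * (u q.2.2 - v q.2.2)‖ := by
              congr 1; rw [map_sub]; ring
        _ ≤ _ := by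
              refine (norm_add₃_le).trans (le_of_eq ?_)
              simp only [norm_mul, RCLike.norm_conj]
    · simp

/-- The polynomial weight `(1 + n)^r`. -/
def wgt (r : ℝ) (n : ℕ) : ℝ := (1 + (n : ℝ)) ^ r

theorem wgt_nonneg (r : ℝ) (n : ℕ) : 0 ≤ wgt r n := by unfold wgt; positivity

theorem wgt_sq (r : ℝ) (n : ℕ) : wgt r n ^ 2 = (1 + (n : ℝ)) ^ (2 * r) := by
  unfold wgt
  rw [← Real.rpow_natCast, ← Real.rpow_mul (by positivity), mul_comm]; norm_num

theorem wgt_le_add {r : ℝ} (h0 : 0 ≤ r) (h1 : r ≤ 1) (n i j : ℕ) (h : n ≤ i + j) :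
    wgt r n ≤ wgt r i + wgt r j := by
  have hn : (n : ℝ) ≤ i + j := by exact_mod_cast h
  refine le_trans ?_ (Real.rpow_add_le_add_rpow (by positivity) (by positivity) h0 h1)
  exact Real.rpow_le_rpow (by positivity) (by linarith) h0

/-- The weighted norm squared. -/
def wnormSq (r : ℝ) (u : ℕ → ℂ) : ℝ := ∑' n, wgt r n ^ 2 * ‖u n‖ ^ 2

/-- The `H^{1/2}` norm squared. -/
def hhalf (u : ℕ → ℂ) : ℝ := ∑' n : ℕ, ((n : ℝ) + 1) * ‖u n‖ ^ 2

theorem wnormSq_nonneg (r : ℝ) (u : ℕ → ℂ) : 0 ≤ wnormSq r u :=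
  tsum_nonneg fun n => by positivity

theorem hhalf_nonneg (u : ℕ → ℂ) : 0 ≤ hhalf u :=
  tsum_nonneg fun n => by positivity

theorem MemHs.summable_wgt {s r : ℝ} {u : ℕ → ℂ} (h : MemHs s u) (hr0 : 0 ≤ r) (hr : r ≤ s) :
    Summable fun n => wgt r n ^ 2 * ‖u n‖ ^ 2 := by
  refine Summable.of_nonneg_of_le (fun n => by positivity) (fun n => ?_)
    (h.mul_left ((2 : ℝ) ^ r))
  rw [← mul_assoc]
  gcongr
  have h2 : (1 + (n : ℝ)) ^ 2 ≤ 2 * (1 + (n : ℝ) ^ 2) := by nlinarith [sq_nonneg ((n : ℝ) - 1)]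
  calc wgt r n ^ 2 = ((1 + (n : ℝ)) ^ 2) ^ r := by
        rw [wgt_sq, Real.rpow_mul (by positivity)]; norm_num
    _ ≤ (2 * (1 + (n : ℝ) ^ 2)) ^ r := Real.rpow_le_rpow (by positivity) h2 hr0
    _ = 2 ^ r * (1 + (n : ℝ) ^ 2) ^ r := Real.mul_rpow (by positivity) (by positivity)
    _ ≤ _ := by
      gcongr
      nlinarith [sq_nonneg (n : ℝ)]

section Wgt

variable {r : ℝ} {u : ℕ → ℂ}

theorem summable_hhalf (hr : 1 / 2 < r) (h : Summable fun n => wgt r n ^ 2 * ‖u n‖ ^ 2) :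
    Summable fun n : ℕ => ((n : ℝ) + 1) * ‖u n‖ ^ 2 := by
  refine Summable.of_nonneg_of_le (fun n => by positivity) (fun n => ?_) h
  gcongr
  rw [wgt_sq, add_comm]
  have : (1 + (n : ℝ)) ^ (1 : ℝ) ≤ (1 + (n : ℝ)) ^ (2 * r) :=
    Real.rpow_le_rpow_of_exponent_le (by linarith [n.cast_nonneg (α := ℝ)]) (by linarith)
  simpa using this

theorem sum_inv_weight_le {δ X : ℝ} (hδ : 0 < δ) (hX : 0 < X) (N : ℕ) :
    ∑ n ∈ Finset.range N, ((1 + (n : ℝ)) + (1 + (n : ℝ)) ^ (1 + δ) / X)⁻¹ ≤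
      1 + Real.log (1 + X) / δ := by
  set f : ℝ → ℝ := fun x => (x + x ^ (1 + δ) / X)⁻¹ with hf
  have hpos : ∀ x : ℝ, 0 < x → 0 < x + x ^ (1 + δ) / X := fun x hx => by positivity
  set F : ℝ → ℝ := fun x => -(Real.log (1 + X * x ^ (-δ)) / δ) with hF
  have hderiv : ∀ x : ℝ, 0 < x → HasDerivAt F (f x) x := by
    intro x hx
    have h1 : HasDerivAt (fun x : ℝ => 1 + X * x ^ (-δ)) (X * (-δ * x ^ (-δ - 1))) x := by
      have := (Real.hasDerivAt_rpow_const (x := x) (p := -δ) (Or.inl hx.ne')).const_mul X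
      exact this.const_add 1
    have h2 : (1 + X * x ^ (-δ)) ≠ 0 := by positivity
    have h3 := ((h1.log h2).div_const δ).neg
    refine h3.congr_deriv ?_
    have e1 : x ^ (-δ - 1) = (x ^ (1 + δ))⁻¹ := by
      rw [← Real.rpow_neg hx.le]; congr 1; ring
    have e2 : x ^ (1 + δ) = x * x ^ δ := by rw [Real.rpow_add hx, Real.rpow_one]
    rw [hf]
    simp only
    rw [e1, e2, Real.rpow_neg hx.le]
    have : 0 < x ^ δ := by positivity
    field_simp
    ring
  have hanti : AntitoneOn f (Set.Icc 1 (1 + (N : ℝ))) := by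
    intro x hx y hy hxy
    have : 0 < x := by linarith [hx.1]
    refine inv_anti₀ (hpos x this) ?_
    gcongr
  have hintg : ∫ x in (1 : ℝ)..(1 + N), f x = F (1 + N) - F 1 := by
    refine intervalIntegral.integral_eq_sub_of_hasDerivAt (fun x hx => hderiv x ?_) ?_
    · rw [Set.uIcc_of_le (by simp)] at hx
      linarith [hx.1]
    · refine AntitoneOn.intervalIntegrable ?_
      rwa [Set.uIcc_of_le (by simp)]
  have hsum := hanti.sum_le_integral
  rw [hintg] at hsum
  have hFN : F (1 + N) ≤ 0 := by
    have : 0 ≤ Real.log (1 + X * (1 + (N : ℝ)) ^ (-δ)) :=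
      Real.log_nonneg (by have : 0 ≤ X * (1 + (N : ℝ)) ^ (-δ) := by positivity
                          linarith)
    simp only [hF, Left.neg_nonpos_iff]
    positivity
  have hF1 : F 1 = -(Real.log (1 + X) / δ) := by simp [hF]
  have h1 : f 1 ≤ 1 := by
    simp only [hf, Real.one_rpow]
    exact inv_le_one_of_one_le₀ (by have : 0 < 1 / X := by positivity
                                    linarith)
  calc ∑ n ∈ Finset.range N, ((1 + (n : ℝ)) + (1 + (n : ℝ)) ^ (1 + δ) / X)⁻¹
      ≤ ∑ n ∈ Finset.range (N + 1), f (1 + (n : ℝ)) := by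
        refine Finset.sum_le_sum_of_subset_of_nonneg (Finset.range_mono (by omega)) ?_
        intro n _ _
        exact inv_nonneg.2 (hpos _ (by positivity)).le
    _ = (∑ n ∈ Finset.range N, f (1 + ((n + 1 : ℕ) : ℝ))) + f 1 := by
        rw [Finset.sum_range_succ']; simp
    _ ≤ _ := by linarith

/-- Logarithmic (Brezis–Gallouët type) estimate of the Wiener norm. -/
theorem summable_norm_and_sq_le (hr : 1 / 2 < r) (hr1 : r ≤ 1)
    (h : Summable fun n => wgt r n ^ 2 * ‖u n‖ ^ 2) :
    Summable (fun n => ‖u n‖) ∧ (∑' n, ‖u n‖) ^ 2 ≤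
      2 / (2 * r - 1) * (1 + hhalf u) * (1 + Real.log (1 + wnormSq r u)) := by
  set δ := 2 * r - 1 with hδ
  have hδ0 : 0 < δ := by linarith
  have hQ := wnormSq_nonneg r u
  have hH := hhalf_nonneg u
  have hl : 0 ≤ Real.log (1 + wnormSq r u) := Real.log_nonneg (by linarith)
  set X := 1 + wnormSq r u with hX
  have hX0 : 0 < X := by linarith
  set B := 2 / δ * (1 + hhalf u) * (1 + Real.log X) with hB
  have hB0 : 0 ≤ B := by positivity
  have key : ∀ N, ∑ n ∈ Finset.range N, ‖u n‖ ≤ √B := by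
    intro N
    refine Real.le_sqrt_of_sq_le ?_
    set m : ℕ → ℝ := fun n => (1 + (n : ℝ)) + (1 + (n : ℝ)) ^ (1 + δ) / X with hm
    have hm0 : ∀ n, 0 < m n := fun n => by positivity
    refine (Finset.sum_sq_le_sum_mul_sum_of_sq_le_mul (Finset.range N) (r := fun n => ‖u n‖)
      (f := fun n => (m n)⁻¹) (g := fun n => m n * ‖u n‖ ^ 2) (fun n _ => (inv_pos.2 (hm0 n)).le)
      (fun n _ => by have := hm0 n; positivity) (fun n _ => ?_)).trans ?_
    · rw [inv_mul_cancel_left₀ (hm0 n).ne']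
    · have e1 := sum_inv_weight_le hδ0 hX0 N
      have e2 : ∑ n ∈ Finset.range N, m n * ‖u n‖ ^ 2 ≤ 1 + hhalf u := by
        have : ∀ n, m n * ‖u n‖ ^ 2 = ((n : ℝ) + 1) * ‖u n‖ ^ 2
            + (wgt r n ^ 2 * ‖u n‖ ^ 2) / X := fun n => by
          rw [wgt_sq, hm, hδ, show (1 : ℝ) + (2 * r - 1) = 2 * r by ring]; ring
        simp_rw [this, Finset.sum_add_distrib, ← Finset.sum_div]
        have e3 := (summable_hhalf hr h).sum_le_tsum (Finset.range N) fun n _ => by positivity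
        have e4 := h.sum_le_tsum (Finset.range N) fun n _ => by positivity
        have e5 : (∑ n ∈ Finset.range N, wgt r n ^ 2 * ‖u n‖ ^ 2) / X ≤ 1 := by
          rw [div_le_one hX0]
          change _ ≤ wnormSq r u at e4
          linarith
        change _ ≤ hhalf u at e3
        linarith
      have e6 : Real.log (1 + X) ≤ 1 + Real.log X := by
        have : Real.log (1 + X) ≤ Real.log (2 * X) :=
          Real.log_le_log (by linarith) (by linarith)
        rw [Real.log_mul (by norm_num) hX0.ne'] at this
        linarith [Real.log_two_lt_d9]
      have e7 : 1 + Real.log (1 + X) / δ ≤ 2 / δ * (1 + Real.log X) := by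
        have : 1 + Real.log (1 + X) / δ ≤ (1 + Real.log X) / δ + (1 + Real.log X) / δ := by
          gcongr
          rw [le_div_iff₀ hδ0]
          nlinarith
        calc _ ≤ _ := this
          _ = _ := by ring
      calc _ ≤ (2 / δ * (1 + Real.log X)) * (1 + hhalf u) := by
            refine mul_le_mul (e1.trans e7) e2 (Finset.sum_nonneg fun n _ => ?_) (by positivity)
            have := hm0 n; positivity
        _ = B := by rw [hB]; ring
  have hs : Summable fun n => ‖u n‖ := summable_of_sum_range_le (fun _ => norm_nonneg _) key
  refine ⟨hs, ?_⟩
  have h1 : ∑' n, ‖u n‖ ≤ √B := Real.tsum_le_of_sum_range_le (fun _ => norm_nonneg _) key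
  have h0 : 0 ≤ ∑' n, ‖u n‖ := tsum_nonneg fun _ => norm_nonneg _
  calc _ ≤ (√B) ^ 2 := by gcongr
    _ = B := Real.sq_sqrt hB0

end Wgt

theorem SolvesSzego.hasDerivAt_normSq {α : ℝ} {u : ℝ → ℕ → ℂ} (h : SolvesSzego α u) (n : ℕ)
    (t : ℝ) : HasDerivAt (fun τ => ‖u τ n‖ ^ 2) (2 * (cubic (u t) n * conj (u t n)).im) t := by
  refine (h n t).norm_sq.congr_deriv ?_
  rw [Complex.inner]
  congr 1
  by_cases hn : n = 0
  · subst hn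
    simp [oneSeq]
    ring
  · simp [oneSeq, hn]

theorem cubic_conj (u : ℕ → ℂ) (n : ℕ) : cubic (fun k => conj (u k)) n = conj (cubic u n) := by
  unfold cubic
  rw [Complex.conj_tsum]
  refine tsum_congr fun q => ?_
  split_ifs <;> simp

/-- Time reversal symmetry. -/
def timeRev (u : ℝ → ℕ → ℂ) : ℝ → ℕ → ℂ := fun t n => conj (u (-t) n)

theorem SolvesSzego.timeRev {α : ℝ} {u : ℝ → ℕ → ℂ} (h : SolvesSzego α u) :
    SolvesSzego α (timeRev u) := by
  intro n t
  have h1 := (h n (-t)).scomp t (hasDerivAt_neg t)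
  have h2 := h1.star
  refine h2.congr_deriv ?_
  change _ = -I * (cubic (fun k => conj (u (-t) k)) n + α * conj (u (-t) 0) * oneSeq n)
  rw [cubic_conj]
  have : conj (oneSeq n) = oneSeq n := by unfold oneSeq; split_ifs <;> simp
  simp [this]

theorem wnormSq_timeRev (r : ℝ) (u : ℝ → ℕ → ℂ) (t : ℝ) :
    wnormSq r (timeRev u t) = wnormSq r (u (-t)) := by
  simp [wnormSq, timeRev]

theorem hhalf_timeRev (u : ℝ → ℕ → ℂ) (t : ℝ) :
    hhalf (timeRev u t) = hhalf (u (-t)) := by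
  simp [hhalf, timeRev]

theorem add_one_le_wgt_sq {r : ℝ} (hr : 1 / 2 < r) (n : ℕ) : (n : ℝ) + 1 ≤ wgt r n ^ 2 := by
  rw [wgt_sq, add_comm]
  have : (1 + (n : ℝ)) ^ (1 : ℝ) ≤ (1 + (n : ℝ)) ^ (2 * r) :=
    Real.rpow_le_rpow_of_exponent_le (by linarith [n.cast_nonneg (α := ℝ)]) (by linarith)
  simpa using this

theorem hhalf_le_wnormSq {r : ℝ} {u : ℕ → ℂ} (hr : 1 / 2 < r)
    (h : Summable fun n => wgt r n ^ 2 * ‖u n‖ ^ 2) : hhalf u ≤ wnormSq r u := by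
  refine (summable_hhalf hr h).tsum_le_tsum (fun n => ?_) h
  gcongr
  exact add_one_le_wgt_sq hr n

/-- The double logarithm governing the growth of the weighted norm. -/
def loglog (q : ℝ) : ℝ := Real.log (1 + Real.log (1 + q))

theorem loglog_mono {p q : ℝ} (hp : 0 ≤ p) (h : p ≤ q) : loglog p ≤ loglog q := by
  have h1 : Real.log (1 + p) ≤ Real.log (1 + q) := Real.log_le_log (by linarith) (by linarith)
  have h2 : 0 ≤ Real.log (1 + p) := Real.log_nonneg (by linarith)
  exact Real.log_le_log (by linarith) (by linarith)

theorem le_of_loglog_le {q g : ℝ} (hq : 0 ≤ q) (h : loglog q ≤ g) :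
    q ≤ Real.exp (Real.exp g) := by
  have h2 : 0 ≤ Real.log (1 + q) := Real.log_nonneg (by linarith)
  have h3 : 1 + Real.log (1 + q) ≤ Real.exp g := (Real.log_le_iff_le_exp (by linarith)).1 h
  have h4 : 1 + q ≤ Real.exp (Real.exp g) :=
    (Real.log_le_iff_le_exp (by linarith)).1 (by linarith)
  linarith

theorem hasDerivAt_loglog {q : ℝ} (hq : 0 ≤ q) :
    HasDerivAt loglog (((1 + q) * (1 + Real.log (1 + q)))⁻¹) q := by
  have h2 : 0 ≤ Real.log (1 + q) := Real.log_nonneg (by linarith)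
  have h1 : HasDerivAt (fun q : ℝ => 1 + q) 1 q := (hasDerivAt_id q).const_add 1
  have h3 := ((h1.log (by linarith)).const_add 1).log (by linarith)
  refine h3.congr_deriv ?_
  have : 1 + q ≠ 0 := by linarith
  have : 1 + Real.log (1 + q) ≠ 0 := by linarith
  field_simp

section Dynamics

variable {α r M a b : ℝ} {u : ℝ → ℕ → ℂ}

theorem sum_wgt_deriv_le (hr : 1 / 2 < r) (hr1 : r ≤ 1) {v : ℕ → ℂ}
    (hv : Summable fun n => wgt r n ^ 2 * ‖v n‖ ^ 2) {c : ℕ → ℝ} (hc0 : ∀ n, 0 ≤ c n)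
    (hc : ∀ n, c n ≤ wgt r n ^ 2) (N : ℕ) :
    |∑ n ∈ Finset.range N, c n * (2 * (cubic v n * conj (v n)).im)| ≤
      8 / (2 * r - 1) * (1 + hhalf v) * ((1 + wnormSq r v) * (1 + Real.log (1 + wnormSq r v))) := by
  obtain ⟨hs, hA⟩ := summable_norm_and_sq_le hr hr1 hv
  have h1 := sum_weight_cubic_le (wgt_nonneg r) (wgt_le_add (by linarith) hr1) hs hv
    (Finset.range N)
  have hQ := wnormSq_nonneg r v
  have hH := hhalf_nonneg v
  have hl : 0 ≤ Real.log (1 + wnormSq r v) := Real.log_nonneg (by linarith)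
  have hδ : 0 < 2 * r - 1 := by linarith
  have h2 : |∑ n ∈ Finset.range N, c n * (2 * (cubic v n * conj (v n)).im)| ≤
      2 * ∑ n ∈ Finset.range N, wgt r n ^ 2 * ‖cubic v n * conj (v n)‖ := by
    rw [Finset.mul_sum]
    refine (Finset.abs_sum_le_sum_abs _ _).trans (Finset.sum_le_sum fun n _ => ?_)
    rw [abs_mul, abs_mul, abs_of_nonneg (hc0 n), abs_two]
    calc c n * (2 * |(cubic v n * conj (v n)).im|)
        ≤ wgt r n ^ 2 * (2 * ‖cubic v n * conj (v n)‖) := by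
          gcongr
          · exact hc n
          · exact Complex.abs_im_le_norm _
      _ = _ := by ring
  change _ ≤ 2 * (wnormSq r v * (∑' n, ‖v n‖) * ∑' n, ‖v n‖) at h1
  calc _ ≤ 4 * (wnormSq r v * (∑' n, ‖v n‖) ^ 2) := by linarith
    _ ≤ 4 * ((1 + wnormSq r v) * (2 / (2 * r - 1) * (1 + hhalf v) *
          (1 + Real.log (1 + wnormSq r v)))) := by gcongr; linarith
    _ = _ := by ring

theorem hasDerivAt_sum_wgt (hsol : SolvesSzego α u) (c : ℕ → ℝ) (N : ℕ) (t : ℝ) :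
    HasDerivAt (fun t => ∑ n ∈ Finset.range N, c n * ‖u t n‖ ^ 2)
      (∑ n ∈ Finset.range N, c n * (2 * (cubic (u t) n * conj (u t n)).im)) t :=
  HasDerivAt.fun_sum fun n _ => (hsol.hasDerivAt_normSq n t).const_mul _

theorem continuousOn_wnormSq (hr : 1 / 2 < r) (hr1 : r ≤ 1) (hsol : SolvesSzego α u)
    (hsum : ∀ t, Summable fun n => wgt r n ^ 2 * ‖u t n‖ ^ 2)
    (hM : ∀ t ∈ Set.Icc a b, wnormSq r (u t) ≤ M) :
    ContinuousOn (fun t => wnormSq r (u t)) (Set.Icc a b) := by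
  rcases Set.eq_empty_or_nonempty (Set.Icc a b) with h | ⟨t0, ht0⟩
  · rw [h]; exact continuousOn_empty _
  have hM0 : 0 ≤ M := (wnormSq_nonneg r (u t0)).trans (hM t0 ht0)
  have hδ : 0 < 2 * r - 1 := by linarith
  have hlM : 0 ≤ Real.log (1 + M) := Real.log_nonneg (by linarith)
  set L : ℝ := 8 / (2 * r - 1) * (1 + M) * ((1 + M) * (1 + Real.log (1 + M))) with hL
  have hL0 : 0 ≤ L := by positivity
  have key : ∀ x ∈ Set.Icc a b, ∀ y ∈ Set.Icc a b,
      |wnormSq r (u y) - wnormSq r (u x)| ≤ L * |y - x| := by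
    intro x hx y hy
    have h1 : ∀ N, |(∑ n ∈ Finset.range N, wgt r n ^ 2 * ‖u y n‖ ^ 2) -
        (∑ n ∈ Finset.range N, wgt r n ^ 2 * ‖u x n‖ ^ 2)| ≤ L * |y - x| := by
      intro N
      refine Convex.norm_image_sub_le_of_norm_hasDerivWithin_le
        (f := fun t => ∑ n ∈ Finset.range N, wgt r n ^ 2 * ‖u t n‖ ^ 2)
        (fun t _ => (hasDerivAt_sum_wgt hsol _ N t).hasDerivWithinAt) (fun t ht => ?_)
        (convex_Icc a b) hx hy
      refine (sum_wgt_deriv_le hr hr1 (hsum t) (fun n => sq_nonneg _) (fun n => le_rfl) N).trans ?_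
      have := hM t ht
      have := hhalf_le_wnormSq hr (hsum t)
      have := wnormSq_nonneg r (u t)
      have := hhalf_nonneg (u t)
      have hl : 0 ≤ Real.log (1 + wnormSq r (u t)) := Real.log_nonneg (by linarith)
      rw [hL]
      gcongr
      linarith
    exact le_of_tendsto (((hsum y).hasSum.tendsto_sum_nat.sub
      (hsum x).hasSum.tendsto_sum_nat).abs) (Eventually.of_forall h1)
  have : LipschitzOnWith (Real.toNNReal L) (fun t => wnormSq r (u t)) (Set.Icc a b) :=
    LipschitzOnWith.of_dist_le_mul fun x hx y hy => by
      rw [Real.coe_toNNReal _ hL0, Real.dist_eq, Real.dist_eq]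
      exact key y hy x hx
  exact this.continuousOn

/-- Conservation of mass plus momentum along a solution with bounded weighted norm. -/
theorem tsum_weight_eq (hr : 1 / 2 < r) (hr1 : r ≤ 1) (hsol : SolvesSzego α u)
    (hsum : ∀ t, Summable fun n => wgt r n ^ 2 * ‖u t n‖ ^ 2) (hab : a ≤ b)
    (hM : ∀ t ∈ Set.Icc a b, wnormSq r (u t) ≤ M) {c : ℝ} (hc0 : 0 ≤ c) (hc1 : c ≤ 1) :
    ∑' n : ℕ, ((n : ℝ) + c) * ‖u b n‖ ^ 2 = ∑' n : ℕ, ((n : ℝ) + c) * ‖u a n‖ ^ 2 := by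
  have hM0 : 0 ≤ M := (wnormSq_nonneg r (u a)).trans (hM a ⟨le_rfl, hab⟩)
  have hδ : 0 < 2 * r - 1 := by linarith
  have hlM : 0 ≤ Real.log (1 + M) := Real.log_nonneg (by linarith)
  have hsc : ∀ t, Summable fun n : ℕ => ((n : ℝ) + c) * ‖u t n‖ ^ 2 := fun t =>
    Summable.of_nonneg_of_le (fun n => by positivity) (fun n => by gcongr)
      (summable_hhalf hr (hsum t))
  set D : ℕ → ℝ → ℝ := fun N t =>
    ∑ n ∈ Finset.range N, ((n : ℝ) + c) * (2 * (cubic (u t) n * conj (u t n)).im) with hD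
  set L : ℝ := 8 / (2 * r - 1) * (1 + M) * ((1 + M) * (1 + Real.log (1 + M))) with hL
  have hder := fun N t => hasDerivAt_sum_wgt hsol (fun n : ℕ => (n : ℝ) + c) N t
  have hbd : ∀ N, ∀ t ∈ Set.Icc a b, ‖D N t‖ ≤ L := by
    intro N t ht
    refine (sum_wgt_deriv_le hr hr1 (hsum t) (fun n => by positivity)
      (fun n => (by linarith : (n : ℝ) + c ≤ n + 1).trans (add_one_le_wgt_sq hr n)) N).trans ?_
    have := hM t ht
    have := hhalf_le_wnormSq hr (hsum t)
    have := wnormSq_nonneg r (u t)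
    have := hhalf_nonneg (u t)
    have hl : 0 ≤ Real.log (1 + wnormSq r (u t)) := Real.log_nonneg (by linarith)
    rw [hL]
    gcongr
    linarith
  have hmeas : ∀ N, Measurable (D N) := fun N => by
    have : D N = deriv fun t => ∑ n ∈ Finset.range N, ((n : ℝ) + c) * ‖u t n‖ ^ 2 :=
      funext fun t => (hder N t).deriv.symm
    rw [this]
    exact measurable_deriv _
  have hbd' : ∀ N, ∀ᵐ t, t ∈ Set.uIoc a b → ‖D N t‖ ≤ L := fun N =>
    Eventually.of_forall fun t ht => hbd N t (by
      rw [Set.uIoc_of_le hab] at ht; exact ⟨ht.1.le, ht.2⟩)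
  have hintg : ∀ N, IntervalIntegrable (D N) MeasureTheory.volume a b := fun N =>
    (intervalIntegrable_const (c := L)).mono_fun' (hmeas N).aestronglyMeasurable
      ((MeasureTheory.ae_restrict_iff' measurableSet_uIoc).2 (hbd' N))
  have hftc := fun N => intervalIntegral.integral_eq_sub_of_hasDerivAt (fun t _ => hder N t)
    (hintg N)
  have hlim : Tendsto (fun N => ∫ t in a..b, D N t) atTop (𝓝 (∫ _ in a..b, (0 : ℝ))) := by
    refine intervalIntegral.tendsto_integral_filter_of_dominated_convergence (fun _ => L)
      (Eventually.of_forall fun N => (hmeas N).aestronglyMeasurable)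
      (Eventually.of_forall hbd') intervalIntegrable_const
      (Eventually.of_forall fun t _ => ?_)
    have hA := (summable_norm_and_sq_le hr hr1 (hsum t)).1
    have := ((hasSum_weight_im_cubic hc0 hA (hsc t)).mul_left 2).tendsto_sum_nat
    rw [mul_zero] at this
    refine this.congr fun N => Finset.sum_congr rfl fun n _ => by ring
  have hlim2 := (hsc b).hasSum.tendsto_sum_nat.sub (hsc a).hasSum.tendsto_sum_nat
  have := tendsto_nhds_unique hlim (hlim2.congr fun N => (hftc N).symm)
  simp only [intervalIntegral.integral_zero] at this
  linarith

theorem loglog_wnormSq_le (hr : 1 / 2 < r) (hr1 : r ≤ 1) (hsol : SolvesSzego α u)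
    (hsum : ∀ t, Summable fun n => wgt r n ^ 2 * ‖u t n‖ ^ 2) (hab : a ≤ b)
    (hM : ∀ t ∈ Set.Icc a b, wnormSq r (u t) ≤ M) :
    loglog (wnormSq r (u b)) ≤
      loglog (wnormSq r (u a)) + 8 / (2 * r - 1) * (1 + hhalf (u a)) * (b - a) := by
  have hδ : 0 < 2 * r - 1 := by linarith
  have hcont := continuousOn_wnormSq hr hr1 hsol hsum hM
  set q : ℝ → ℝ := Set.IccExtend hab ((Set.Icc a b).domRestrict fun t => wnormSq r (u t)) with hq
  have hqc : Continuous q := hcont.domRestrict.Icc_extend'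
  have hqe : ∀ t ∈ Set.Icc a b, q t = wnormSq r (u t) := fun t ht =>
    Set.IccExtend_of_mem hab _ ht
  have hq0 : ∀ t, 0 ≤ q t := fun t => wnormSq_nonneg r _
  have hlq : ∀ t, 0 ≤ Real.log (1 + q t) := fun t => Real.log_nonneg (by linarith [hq0 t])
  set κ := 8 / (2 * r - 1) * (1 + hhalf (u a)) with hκ
  have hκ0 : 0 ≤ κ := by have := hhalf_nonneg (u a); positivity
  set ψ : ℝ → ℝ := fun t => κ * ((1 + q t) * (1 + Real.log (1 + q t))) with hψ
  have hψc : Continuous ψ := by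
    have : Continuous fun t => Real.log (1 + q t) :=
      Continuous.log (by fun_prop) fun t => by linarith [hq0 t]
    fun_prop
  have hψ0 : ∀ t, 0 ≤ ψ t := fun t => by
    have := hq0 t; have := hlq t; positivity
  set Z : ℝ → ℝ := fun t => q a + ∫ x in a..t, ψ x with hZ
  have hZd : ∀ t, HasDerivAt Z (ψ t) t := fun t =>
    (hψc.integral_hasStrictDerivAt a t).hasDerivAt.const_add _
  have hH : ∀ t ∈ Set.Icc a b, hhalf (u t) = hhalf (u a) := fun t ht =>
    tsum_weight_eq hr hr1 hsol hsum ht.1 (fun x hx => hM x ⟨hx.1, hx.2.trans ht.2⟩)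
      zero_le_one le_rfl
  have hqZ : ∀ t ∈ Set.Icc a b, q t ≤ Z t := by
    intro t ht
    have h1 : ∀ N, ∑ n ∈ Finset.range N, wgt r n ^ 2 * ‖u t n‖ ^ 2 ≤ Z t := by
      intro N
      refine image_le_of_deriv_right_le_deriv_boundary
        (f := fun t => ∑ n ∈ Finset.range N, wgt r n ^ 2 * ‖u t n‖ ^ 2) (B := Z)
        (fun x _ => (hasDerivAt_sum_wgt hsol _ N x).continuousAt.continuousWithinAt)
        (fun x _ => (hasDerivAt_sum_wgt hsol _ N x).hasDerivWithinAt) ?_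
        (fun x _ => (hZd x).continuousAt.continuousWithinAt)
        (fun x _ => (hZd x).hasDerivWithinAt) (fun x hx => ?_) ht
      · simp only [hZ, intervalIntegral.integral_same, add_zero]
        rw [hqe a ⟨le_rfl, hab⟩]
        exact (hsum a).sum_le_tsum _ fun n _ => by positivity
      · have hx' : x ∈ Set.Icc a b := ⟨hx.1, hx.2.le⟩
        have := sum_wgt_deriv_le hr hr1 (hsum x) (fun n => sq_nonneg _) (fun n => le_rfl) N
        rw [hH x hx', ← hqe x hx'] at this
        exact (le_abs_self _).trans this
    rw [hqe t ht]
    exact le_of_tendsto' (hsum t).hasSum.tendsto_sum_nat h1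
  have hZ0 : ∀ t ∈ Set.Icc a b, 0 ≤ Z t := fun t ht => (hq0 t).trans (hqZ t ht)
  have hfin : loglog (Z b) ≤ loglog (Z a) + κ * (b - a) := by
    refine image_le_of_deriv_right_le_deriv_boundary
      (f := fun t => loglog (Z t)) (B := fun t => loglog (Z a) + κ * (t - a)) (B' := fun _ => κ)
      (f' := fun t => ((1 + Z t) * (1 + Real.log (1 + Z t)))⁻¹ * ψ t)
      (fun x hx => ((hasDerivAt_loglog (hZ0 x hx)).comp x (hZd x)).continuousAt.continuousWithinAt)
      (fun x hx => ((hasDerivAt_loglog (hZ0 x ⟨hx.1, hx.2.le⟩)).comp x (hZd x)).hasDerivWithinAt)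
      (by simp) (by fun_prop) (fun x _ => ?_) (fun x hx => ?_) ⟨hab, le_rfl⟩
    · have := (((hasDerivAt_id x).sub_const a).const_mul κ).const_add (loglog (Z a))
      simpa using this.hasDerivWithinAt
    · have hx' : x ∈ Set.Icc a b := ⟨hx.1, hx.2.le⟩
      have h1 := hqZ x hx'
      have h2 := hq0 x
      have h3 := hlq x
      have h4 : Real.log (1 + q x) ≤ Real.log (1 + Z x) :=
        Real.log_le_log (by linarith) (by linarith)
      have h5 : 0 < (1 + Z x) * (1 + Real.log (1 + Z x)) :=
        mul_pos (by linarith) (by linarith)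
      rw [inv_mul_le_iff₀ h5, mul_comm]
      simp only [hψ]
      gcongr
      linarith
  have hZa : Z a = wnormSq r (u a) := by
    simp only [hZ, intervalIntegral.integral_same, add_zero]
    exact hqe a ⟨le_rfl, hab⟩
  rw [hZa] at hfin
  refine le_trans (loglog_mono (wnormSq_nonneg r _) ?_) hfin
  rw [← hqe b ⟨hab, le_rfl⟩]
  exact hqZ b ⟨hab, le_rfl⟩

end Dynamics

section LocalBound

variable {α r M a b : ℝ} {u : ℝ → ℕ → ℂ}

theorem summable_wgt_timeRev (hsum : ∀ t, Summable fun n => wgt r n ^ 2 * ‖u t n‖ ^ 2) (t : ℝ) :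
    Summable fun n => wgt r n ^ 2 * ‖timeRev u t n‖ ^ 2 := by
  simpa [timeRev] using hsum (-t)

theorem loglog_wnormSq_le_rev (hr : 1 / 2 < r) (hr1 : r ≤ 1) (hsol : SolvesSzego α u)
    (hsum : ∀ t, Summable fun n => wgt r n ^ 2 * ‖u t n‖ ^ 2) (hab : a ≤ b)
    (hM : ∀ t ∈ Set.Icc a b, wnormSq r (u t) ≤ M) :
    loglog (wnormSq r (u a)) ≤
      loglog (wnormSq r (u b)) + 8 / (2 * r - 1) * (1 + hhalf (u b)) * (b - a) := by
  have h := loglog_wnormSq_le (a := -b) (b := -a) (M := M) hr hr1 hsol.timeRev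
    (summable_wgt_timeRev hsum) (by linarith) (fun t ht => by
      rw [wnormSq_timeRev]
      exact hM _ ⟨by linarith [ht.2], by linarith [ht.1]⟩)
  simp only [wnormSq_timeRev, hhalf_timeRev, neg_neg] at h
  rwa [show -a - -b = b - a by ring] at h

/-- The weighted norm is bounded near `t`. -/
def LocBdd (r : ℝ) (u : ℝ → ℕ → ℂ) (t : ℝ) : Prop :=
  ∃ M, ∀ᶠ x in 𝓝 t, wnormSq r (u x) ≤ M

theorem exists_bound_of_locBdd (h : ∀ t ∈ Set.Icc a b, LocBdd r u t) :
    ∃ M, ∀ t ∈ Set.Icc a b, wnormSq r (u t) ≤ M := by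
  refine isCompact_Icc.induction_on (p := fun s => ∃ M, ∀ t ∈ s, wnormSq r (u t) ≤ M)
    ⟨0, by simp⟩ ?_ ?_ ?_
  · rintro s t hst ⟨M, hM⟩
    exact ⟨M, fun x hx => hM x (hst hx)⟩
  · rintro s t ⟨M, hM⟩ ⟨M', hM'⟩
    exact ⟨max M M', fun x hx => hx.elim (fun hx => (hM x hx).trans (le_max_left _ _))
      fun hx => (hM' x hx).trans (le_max_right _ _)⟩
  · intro x hx
    obtain ⟨M, hM⟩ := h x hx
    exact ⟨_, mem_nhdsWithin_of_mem_nhds hM, M, fun t ht => ht⟩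

theorem isOpen_setOf_locBdd (r : ℝ) (u : ℝ → ℕ → ℂ) : IsOpen {t | LocBdd r u t} := by
  rw [isOpen_iff_mem_nhds]
  rintro t ⟨M, hM⟩
  filter_upwards [hM.eventually_nhds] with x hx
  exact ⟨M, hx⟩

theorem locBdd_timeRev {t : ℝ} (h : LocBdd r (timeRev u) t) : LocBdd r u (-t) := by
  obtain ⟨M, hM⟩ := h
  refine ⟨M, ?_⟩
  have : Tendsto (fun x : ℝ => -x) (𝓝 (-t)) (𝓝 t) := by
    simpa using (continuous_neg (G := ℝ)).tendsto (-t)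
  filter_upwards [this.eventually hM] with x hx
  simpa [wnormSq_timeRev] using hx

/-- Propagation of a bound from a closed set of bad times to the right. -/
theorem loglog_le_of_bad_set (hr : 1 / 2 < r) (hr1 : r ≤ 1) (hsol : SolvesSzego α u)
    (hsum : ∀ t, Summable fun n => wgt r n ^ 2 * ‖u t n‖ ^ 2) (hab : a ≤ b)
    (ha : ¬ LocBdd r u a) (hbad : ∀ t ∈ Set.Icc a b, ¬ LocBdd r u t → wnormSq r (u t) ≤ M) :
    loglog (wnormSq r (u b)) ≤ loglog M + 8 / (2 * r - 1) * (1 + M) * (b - a) := by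
  have hδ : 0 < 2 * r - 1 := by linarith
  set S := Set.Icc a b ∩ {t | LocBdd r u t}ᶜ with hS
  have hSc : IsClosed S := isClosed_Icc.inter (isOpen_setOf_locBdd r u).isClosed_compl
  have hSn : S.Nonempty := ⟨a, ⟨le_rfl, hab⟩, ha⟩
  have hSb : BddAbove S := ⟨b, fun x hx => hx.1.2⟩
  set c := sSup S with hc
  have hcS : c ∈ S := hSc.csSup_mem hSn hSb
  have hac : a ≤ c := hcS.1.1
  have hcb : c ≤ b := hcS.1.2
  have hcM : wnormSq r (u c) ≤ M := hbad c hcS.1 hcS.2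
  have hgood : ∀ x, c < x → x ≤ b → LocBdd r u x := by
    intro x hx hxb
    by_contra h
    exact absurd (le_csSup hSb ⟨⟨hac.trans hx.le, hxb⟩, h⟩) (not_le.2 hx)
  have hQ0 := fun t => wnormSq_nonneg r (u t)
  have hH0 := hhalf_nonneg (u b)
  set g := loglog (wnormSq r (u b)) + 8 / (2 * r - 1) * (1 + hhalf (u b)) * (b - c) with hg
  have hback : ∀ x, c < x → x ≤ b → wnormSq r (u x) ≤ Real.exp (Real.exp g) := by
    intro x hx hxb
    obtain ⟨M', hM'⟩ := exists_bound_of_locBdd (r := r) (u := u) (a := x) (b := b)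
      fun t ht => hgood t (hx.trans_le ht.1) ht.2
    refine le_of_loglog_le (hQ0 x) ((loglog_wnormSq_le_rev hr hr1 hsol hsum hxb hM').trans ?_)
    rw [hg]
    gcongr
  have hfw := loglog_wnormSq_le (a := c) (b := b) (M := max M (Real.exp (Real.exp g))) hr hr1
    hsol hsum hcb (fun t ht => by
      rcases ht.1.eq_or_lt with h | h
      · rw [← h]; exact hcM.trans (le_max_left _ _)
      · exact (hback t h ht.2).trans (le_max_right _ _))
  refine hfw.trans ?_
  have h1 := loglog_mono (hQ0 c) hcM
  have h2 := (hhalf_le_wnormSq hr (hsum c)).trans hcM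
  have h3 := hhalf_nonneg (u c)
  have h4 : 0 ≤ M := h3.trans h2
  gcongr

theorem isClosed_setOf_wnormSq_le (hsol : SolvesSzego α u)
    (hsum : ∀ t, Summable fun n => wgt r n ^ 2 * ‖u t n‖ ^ 2) (M : ℝ) :
    IsClosed {t | wnormSq r (u t) ≤ M} := by
  have : {t | wnormSq r (u t) ≤ M} =
      ⋂ N, {t | ∑ n ∈ Finset.range N, wgt r n ^ 2 * ‖u t n‖ ^ 2 ≤ M} := by
    ext t
    simp only [Set.mem_ofPred_eq, Set.mem_iInter]
    exact ⟨fun h N => ((hsum t).sum_le_tsum _ fun n _ => by positivity).trans h,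
      fun h => le_of_tendsto' (hsum t).hasSum.tendsto_sum_nat h⟩
  rw [this]
  refine isClosed_iInter fun N => isClosed_le ?_ continuous_const
  exact continuous_iff_continuousAt.2 fun t => (hasDerivAt_sum_wgt hsol _ N t).continuousAt

/-- A solution with pointwise finite weighted norm has locally bounded weighted norm. -/
theorem locBdd_of_solution (hr : 1 / 2 < r) (hr1 : r ≤ 1) (hsol : SolvesSzego α u)
    (hsum : ∀ t, Summable fun n => wgt r n ^ 2 * ‖u t n‖ ^ 2) (t : ℝ) : LocBdd r u t := by
  by_contra hbad
  have hδ : 0 < 2 * r - 1 := by linarith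
  set B : Set ℝ := {t | LocBdd r u t}ᶜ with hB
  have hBc : IsClosed B := (isOpen_setOf_locBdd r u).isClosed_compl
  have : Nonempty B := ⟨⟨t, hbad⟩⟩
  have : CompleteSpace B := hBc.completeSpace_coe
  have hcl : ∀ n : ℕ, IsClosed {x : B | wnormSq r (u x) ≤ n} := fun n =>
    (isClosed_setOf_wnormSq_le hsol hsum n).preimage continuous_subtype_val
  have hun : ⋃ n : ℕ, {x : B | wnormSq r (u x) ≤ n} = Set.univ := by
    refine Set.eq_univ_of_forall fun x => Set.mem_iUnion.2 ?_
    exact exists_nat_ge (wnormSq r (u x))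
  obtain ⟨n, ⟨t₀, ht₀⟩, hintg⟩ := nonempty_interior_of_iUnion_of_closed hcl hun
  rw [mem_interior_iff_mem_nhds, nhds_subtype_eq_comap, mem_comap] at hintg
  obtain ⟨V, hV, hVsub⟩ := hintg
  obtain ⟨ρ, hρ, hball⟩ := Metric.mem_nhds_iff.1 hV
  have hb : ∀ x, |x - t₀| < ρ → ¬ LocBdd r u x → wnormSq r (u x) ≤ n := fun x hx hxb =>
    hVsub (a := (⟨x, hxb⟩ : B)) (hball (by rwa [Metric.mem_ball, Real.dist_eq]))
  set g := loglog n + 8 / (2 * r - 1) * (1 + n) * ρ with hg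
  refine ht₀ ⟨Real.exp (Real.exp g), ?_⟩
  filter_upwards [Metric.ball_mem_nhds t₀ hρ] with x hx
  rw [Metric.mem_ball, Real.dist_eq, abs_lt] at hx
  refine le_of_loglog_le (wnormSq_nonneg r _) ?_
  rcases le_total t₀ x with h | h
  · refine (loglog_le_of_bad_set (M := n) hr hr1 hsol hsum h ht₀ fun y hy hyb =>
      hb y (abs_lt.2 ⟨by linarith [hy.1], by linarith [hy.2]⟩) hyb).trans ?_
    rw [hg]; gcongr; linarith
  · have := loglog_le_of_bad_set (M := n) (a := -t₀) (b := -x) hr hr1 hsol.timeRev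
      (summable_wgt_timeRev hsum) (by linarith)
      (fun h => ht₀ (by simpa using locBdd_timeRev h)) (fun y hy hyb => by
        rw [wnormSq_timeRev]
        refine hb (-y) (abs_lt.2 ⟨by linarith [hy.2], by linarith [hy.1]⟩) fun hc => hyb ?_
        have : LocBdd r (timeRev (timeRev u)) (-y) := by
          simpa [LocBdd, wnormSq_timeRev] using hc
        simpa using locBdd_timeRev this)
    rw [wnormSq_timeRev, neg_neg] at this
    refine this.trans ?_
    rw [hg]; gcongr; linarith

theorem exists_bound_of_solution (hr : 1 / 2 < r) (hr1 : r ≤ 1) (hsol : SolvesSzego α u)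
    (hsum : ∀ t, Summable fun n => wgt r n ^ 2 * ‖u t n‖ ^ 2) (a b : ℝ) :
    ∃ M, ∀ t ∈ Set.Icc a b, wnormSq r (u t) ≤ M :=
  exists_bound_of_locBdd fun t _ => locBdd_of_solution hr hr1 hsol hsum t

end LocalBound

section Uniqueness

variable {α r : ℝ} {u v : ℝ → ℕ → ℂ}

theorem tsum_norm_sub_le_of_solution (hα : 0 ≤ α) (hu : SolvesSzego α u) (hv : SolvesSzego α v)
    {a b M K : ℝ} (hab : a ≤ b) (su : ∀ t, Summable fun n => ‖u t n‖)
    (sv : ∀ t, Summable fun n => ‖v t n‖)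
    (hMu : ∀ t ∈ Set.Icc a b, ∑' n, ‖u t n‖ ≤ M) (hMv : ∀ t ∈ Set.Icc a b, ∑' n, ‖v t n‖ ≤ M)
    (hinit : u a = v a) (hK : ∀ t ∈ Set.Icc a b, ∑' n, ‖u t n - v t n‖ ≤ K) :
    ∑' n, ‖u b n - v b n‖ ≤ (3 * M ^ 2 + α) * K * (b - a) := by
  have sd : ∀ t, Summable fun n => ‖u t n - v t n‖ := fun t =>
    Summable.of_nonneg_of_le (fun _ => norm_nonneg _) (fun n => norm_sub_le _ _)
      ((su t).add (sv t))
  refine Real.tsum_le_of_sum_range_le (fun _ => norm_nonneg _) fun N => ?_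
  set θ : ℕ → ℂ := fun n => conj (u b n - v b n) / ‖u b n - v b n‖ with hθ
  have hθ1 : ∀ n, ‖θ n‖ ≤ 1 := fun n => by
    simp only [hθ, norm_div, RCLike.norm_conj, Complex.norm_real, norm_norm]
    exact div_self_le_one _
  have hθ2 : ∀ n, θ n * (u b n - v b n) = ‖u b n - v b n‖ := fun n => by
    rcases eq_or_ne (u b n - v b n) 0 with h | h
    · simp [h]
    · have h' : (‖u b n - v b n‖ : ℂ) ≠ 0 := by simpa using h
      simp only [hθ]
      rw [div_mul_eq_mul_div, div_eq_iff h', Complex.conj_mul']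
      ring
  have hd : ∀ t, HasDerivAt (fun t => ∑ n ∈ Finset.range N, θ n * (u t n - v t n))
      (∑ n ∈ Finset.range N, θ n * (-I * (cubic (u t) n + α * u t 0 * oneSeq n) -
        -I * (cubic (v t) n + α * v t 0 * oneSeq n))) t := fun t =>
    HasDerivAt.fun_sum fun n _ => ((hu n t).sub (hv n t)).const_mul (θ n)
  have key := Convex.norm_image_sub_le_of_norm_hasDerivWithin_le
    (fun t _ => (hd t).hasDerivWithinAt) (C := (3 * M ^ 2 + α) * K) (s := Set.Icc a b)
    (fun t ht => ?_) (convex_Icc a b) ⟨le_rfl, hab⟩ ⟨hab, le_rfl⟩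
  · simp only [hθ2, hinit, sub_self, mul_zero, Finset.sum_const_zero, sub_zero] at key
    rw [← Complex.ofReal_sum, Complex.norm_real, Real.norm_of_nonneg
      (Finset.sum_nonneg fun _ _ => norm_nonneg _), Real.norm_of_nonneg (by linarith)] at key
    exact key
  · have h1 : ∑ n ∈ Finset.range N, ‖cubic (u t) n - cubic (v t) n‖ ≤ 3 * M ^ 2 * K :=
      (sum_cubic_sub_le (su t) (sv t) (hMu t ht) (hMv t ht) _).trans
        (mul_le_mul_of_nonneg_left (hK t ht) (by positivity))
    have h2 : ∑ n ∈ Finset.range N, ‖(α : ℂ) * (u t 0 - v t 0) * oneSeq n‖ ≤ α * K := by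
      have h3 : ‖u t 0 - v t 0‖ ≤ K :=
        ((sd t).le_tsum 0 fun _ _ => norm_nonneg _).trans (hK t ht)
      have h4 : ∀ n, ‖(α : ℂ) * (u t 0 - v t 0) * oneSeq n‖ =
          if n = 0 then α * ‖u t 0 - v t 0‖ else 0 := fun n => by
        unfold oneSeq
        split_ifs <;> simp [abs_of_nonneg hα]
      simp_rw [h4]
      rw [Finset.sum_ite_eq']
      have h5 : α * ‖u t 0 - v t 0‖ ≤ α * K := by gcongr
      split_ifs
      · exact h5
      · exact le_trans (by positivity) h5
    calc _ ≤ ∑ n ∈ Finset.range N, (‖cubic (u t) n - cubic (v t) n‖ +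
          ‖(α : ℂ) * (u t 0 - v t 0) * oneSeq n‖) := by
          refine norm_sum_le_of_le _ fun n _ => ?_
          rw [norm_mul]
          refine (mul_le_of_le_one_left (norm_nonneg _) (hθ1 n)).trans ?_
          have : -I * (cubic (u t) n + α * u t 0 * oneSeq n) -
              -I * (cubic (v t) n + α * v t 0 * oneSeq n) =
              -I * ((cubic (u t) n - cubic (v t) n) + α * (u t 0 - v t 0) * oneSeq n) := by ring
          rw [this, norm_mul, norm_neg, Complex.norm_I, one_mul]
          exact norm_add_le _ _
      _ ≤ _ := by rw [Finset.sum_add_distrib]; linarith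

theorem eq_of_solution_of_bound (hα : 0 < α) (hu : SolvesSzego α u) (hv : SolvesSzego α v)
    {T M : ℝ} (su : ∀ t, Summable fun n => ‖u t n‖) (sv : ∀ t, Summable fun n => ‖v t n‖)
    (hMu : ∀ t ∈ Set.Icc 0 T, ∑' n, ‖u t n‖ ≤ M) (hMv : ∀ t ∈ Set.Icc 0 T, ∑' n, ‖v t n‖ ≤ M)
    (hinit : u 0 = v 0) : ∀ t ∈ Set.Icc 0 T, u t = v t := by
  set h : ℝ := 1 / (2 * (3 * M ^ 2 + α)) with hh
  have hL : 0 < 3 * M ^ 2 + α := by positivity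
  have hh0 : 0 < h := by positivity
  have sd : ∀ t, Summable fun n => ‖u t n - v t n‖ := fun t =>
    Summable.of_nonneg_of_le (fun _ => norm_nonneg _) (fun n => norm_sub_le _ _)
      ((su t).add (sv t))
  have step : ∀ a ∈ Set.Icc 0 T, u a = v a → ∀ t ∈ Set.Icc a T, t ≤ a + h → u t = v t := by
    intro a ha hua
    have hM0 : 0 ≤ M := (tsum_nonneg fun n => norm_nonneg (u a n)).trans (hMu a ha)
    have claim : ∀ k : ℕ, ∀ t ∈ Set.Icc a T, t ≤ a + h →
        ∑' n, ‖u t n - v t n‖ ≤ 2 * M / 2 ^ k := by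
      intro k
      induction k with
      | zero =>
        intro t ht _
        have ht' : t ∈ Set.Icc 0 T := ⟨ha.1.trans ht.1, ht.2⟩
        have h1 := (sd t).tsum_le_tsum (fun n => norm_sub_le (u t n) (v t n)) ((su t).add (sv t))
        rw [(su t).tsum_add (sv t)] at h1
        have := hMu t ht'
        have := hMv t ht'
        rw [pow_zero, div_one]
        linarith
      | succ k ih =>
        intro t ht hth
        have h0 : ∀ x ∈ Set.Icc a t, x ∈ Set.Icc 0 T := fun x hx =>
          ⟨ha.1.trans hx.1, hx.2.trans ht.2⟩
        refine (tsum_norm_sub_le_of_solution hα.le hu hv ht.1 su sv (fun x hx => hMu x (h0 x hx))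
          (fun x hx => hMv x (h0 x hx)) hua
          (fun x hx => ih x ⟨hx.1, hx.2.trans ht.2⟩ (hx.2.trans hth))).trans ?_
        calc (3 * M ^ 2 + α) * (2 * M / 2 ^ k) * (t - a)
            ≤ (3 * M ^ 2 + α) * (2 * M / 2 ^ k) * h := by gcongr; linarith
          _ = 2 * M / 2 ^ (k + 1) := by rw [hh, pow_succ]; field_simp; ring
    intro t ht hth
    have hlim : Tendsto (fun k : ℕ => 2 * M / 2 ^ k) atTop (𝓝 0) := by
      have := (tendsto_pow_atTop_nhds_zero_of_lt_one (r := (1 / 2 : ℝ)) (by norm_num)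
        (by norm_num)).const_mul (2 * M)
      rw [mul_zero] at this
      refine this.congr fun k => ?_
      rw [one_div, inv_pow, div_eq_mul_inv]
    have h0 : ∑' n, ‖u t n - v t n‖ ≤ 0 := ge_of_tendsto' hlim fun k => claim k t ht hth
    funext n
    have h1 : ‖u t n - v t n‖ ≤ 0 := ((sd t).le_tsum n fun _ _ => norm_nonneg _).trans h0
    exact sub_eq_zero.1 (norm_le_zero_iff.1 h1)
  have all : ∀ j : ℕ, ∀ t ∈ Set.Icc 0 T, t ≤ j * h → u t = v t := by
    intro j
    induction j with
    | zero =>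
      intro t ht h0
      have : t = 0 := le_antisymm (by simpa using h0) ht.1
      rw [this, hinit]
    | succ j ih =>
      intro t ht h0
      rcases le_total t (j * h) with h1 | h1
      · exact ih t ht h1
      · have hj : (j : ℝ) * h ∈ Set.Icc 0 T := ⟨by positivity, h1.trans ht.2⟩
        exact step _ hj (ih _ hj le_rfl) t ⟨h1, ht.2⟩ (by push_cast at h0; linarith)
  intro t ht
  obtain ⟨j, hj⟩ := exists_nat_ge (t / h)
  exact all j t ht ((div_le_iff₀ hh0).1 hj)

theorem exists_tsum_norm_bound (hr : 1 / 2 < r) (hr1 : r ≤ 1) (hu : SolvesSzego α u)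
    (su : ∀ t, Summable fun n => wgt r n ^ 2 * ‖u t n‖ ^ 2) (T : ℝ) :
    ∃ M, ∀ t ∈ Set.Icc 0 T, ∑' n, ‖u t n‖ ≤ M := by
  obtain ⟨M, hM⟩ := exists_bound_of_solution hr hr1 hu su 0 T
  have hδ : 0 < 2 * r - 1 := by linarith
  refine ⟨√(2 / (2 * r - 1) * (1 + M) * (1 + Real.log (1 + M))), fun t ht => ?_⟩
  refine Real.le_sqrt_of_sq_le ((summable_norm_and_sq_le hr hr1 (su t)).2.trans ?_)
  have h1 := hM t ht
  have h2 := hhalf_le_wnormSq hr (su t)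
  have h3 := wnormSq_nonneg r (u t)
  have h4 := hhalf_nonneg (u t)
  have hl : 0 ≤ Real.log (1 + wnormSq r (u t)) := Real.log_nonneg (by linarith)
  have : 0 ≤ M := h3.trans h1
  gcongr
  linarith

theorem eq_of_solution_of_nonneg (hα : 0 < α) (hr : 1 / 2 < r) (hr1 : r ≤ 1)
    (hu : SolvesSzego α u) (hv : SolvesSzego α v)
    (su : ∀ t, Summable fun n => wgt r n ^ 2 * ‖u t n‖ ^ 2)
    (sv : ∀ t, Summable fun n => wgt r n ^ 2 * ‖v t n‖ ^ 2) (hinit : u 0 = v 0) {t : ℝ}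
    (ht : 0 ≤ t) : u t = v t := by
  obtain ⟨M, hM⟩ := exists_tsum_norm_bound hr hr1 hu su t
  obtain ⟨M', hM'⟩ := exists_tsum_norm_bound hr hr1 hv sv t
  exact eq_of_solution_of_bound (M := max M M') hα hu hv
    (fun t => (summable_norm_and_sq_le hr hr1 (su t)).1)
    (fun t => (summable_norm_and_sq_le hr hr1 (sv t)).1)
    (fun t ht => (hM t ht).trans (le_max_left _ _))
    (fun t ht => (hM' t ht).trans (le_max_right _ _)) hinit t ⟨ht, le_rfl⟩

/-- Uniqueness for the α-Szegő equation among pointwise `H^r`-valued solutions. -/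
theorem eq_of_solution (hα : 0 < α) (hr : 1 / 2 < r) (hr1 : r ≤ 1)
    (hu : SolvesSzego α u) (hv : SolvesSzego α v)
    (su : ∀ t, Summable fun n => wgt r n ^ 2 * ‖u t n‖ ^ 2)
    (sv : ∀ t, Summable fun n => wgt r n ^ 2 * ‖v t n‖ ^ 2) (hinit : u 0 = v 0) (t : ℝ) :
    u t = v t := by
  rcases le_total 0 t with ht | ht
  · exact eq_of_solution_of_nonneg hα hr hr1 hu hv su sv hinit ht
  · have := eq_of_solution_of_nonneg hα hr hr1 hu.timeRev hv.timeRev (summable_wgt_timeRev su)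
      (summable_wgt_timeRev sv) (by funext n; simp [timeRev, hinit]) (t := -t) (by linarith)
    funext n
    have h := congrFun this n
    simp only [timeRev, neg_neg] at h
    exact (starRingEnd ℂ).injective h

/-- Conservation of the momentum `∑ n |u_n|²`. -/
theorem momentum_eq (hr : 1 / 2 < r) (hr1 : r ≤ 1) (hu : SolvesSzego α u)
    (su : ∀ t, Summable fun n => wgt r n ^ 2 * ‖u t n‖ ^ 2) (t : ℝ) :
    ∑' n : ℕ, (n : ℝ) * ‖u t n‖ ^ 2 = ∑' n : ℕ, (n : ℝ) * ‖u 0 n‖ ^ 2 := by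
  rcases le_total 0 t with ht | ht
  · obtain ⟨M, hM⟩ := exists_bound_of_solution hr hr1 hu su 0 t
    simpa using tsum_weight_eq hr hr1 hu su ht hM le_rfl zero_le_one
  · obtain ⟨M, hM⟩ := exists_bound_of_solution hr hr1 hu su t 0
    simpa using (tsum_weight_eq hr hr1 hu su ht hM le_rfl zero_le_one).symm

end Uniqueness

theorem memL2_iff {h : ℕ → ℂ} : MemL2 h ↔ Summable fun n => ‖h n‖ ^ 2 := by
  unfold MemL2
  rw [memℓp_gen_iff (by norm_num)]
  simp

theorem summable_mul_of_memL2 {f g : ℕ → ℂ} (hf : MemL2 f) (hg : MemL2 g) :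
    Summable fun n => ‖f n‖ * ‖g n‖ := by
  rw [memL2_iff] at hf hg
  refine Summable.of_nonneg_of_le (fun n => by positivity) (fun n => ?_) (hf.add hg)
  nlinarith [sq_nonneg (‖f n‖ - ‖g n‖), sq_nonneg (‖f n‖ + ‖g n‖)]

theorem summable_hinner {f g : ℕ → ℂ} (hf : MemL2 f) (hg : MemL2 g) :
    Summable fun n => f n * conj (g n) := by
  refine Summable.of_norm ?_
  simpa using summable_mul_of_memL2 hf hg

theorem hinner_add_left {f g h : ℕ → ℂ} (hf : MemL2 f) (hg : MemL2 g) (hh : MemL2 h) :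
    hinner (f + g) h = hinner f h + hinner g h := by
  unfold hinner
  rw [← (summable_hinner hf hh).tsum_add (summable_hinner hg hh)]
  exact tsum_congr fun n => by simp [add_mul]

theorem hinner_smul_left (c : ℂ) (f h : ℕ → ℂ) : hinner (c • f) h = c * hinner f h := by
  unfold hinner
  rw [← tsum_mul_left]
  exact tsum_congr fun n => by simp [mul_assoc]

theorem hinner_conj_symm (f g : ℕ → ℂ) : conj (hinner f g) = hinner g f := by
  unfold hinner
  rw [Complex.conj_tsum]
  exact tsum_congr fun n => by simp [mul_comm]

theorem hinner_self_eq (f : ℕ → ℂ) : hinner f f = ((∑' n, ‖f n‖ ^ 2 : ℝ) : ℂ) := by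
  unfold hinner
  rw [Complex.ofReal_tsum]
  exact tsum_congr fun n => by rw [Complex.mul_conj, Complex.normSq_eq_norm_sq]

theorem eq_zero_of_hinner_self {f : ℕ → ℂ} (hf : MemL2 f) (h : hinner f f = 0) : f = 0 := by
  rw [hinner_self_eq] at h
  have h0 : (∑' n, ‖f n‖ ^ 2 : ℝ) = 0 := by exact_mod_cast h
  have := (hasSum_zero_iff_of_nonneg (fun n => by positivity)).1
    (h0 ▸ (memL2_iff.1 hf).hasSum)
  funext n
  simpa using congrFun this n

theorem hinner_oneSeq (f : ℕ → ℂ) : hinner f oneSeq = f 0 := by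
  unfold hinner
  rw [tsum_eq_single 0 (fun n hn => by simp [oneSeq, hn])]
  simp [oneSeq]

theorem memL2_oneSeq : MemL2 oneSeq := by
  rw [memL2_iff]
  refine summable_of_ne_finset_zero (s := {0}) fun n hn => ?_
  have : n ≠ 0 := by simpa using hn
  simp [oneSeq, this]

theorem MemL2.of_summable {u : ℕ → ℂ} (su : Summable fun n => ‖u n‖) : MemL2 u := by
  rw [memL2_iff]
  have h1 : ∀ n, ‖u n‖ ≤ ∑' n, ‖u n‖ := fun n => su.le_tsum n fun _ _ => norm_nonneg _
  refine Summable.of_nonneg_of_le (fun n => by positivity) (fun n => ?_)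
    (su.mul_left (∑' n, ‖u n‖))
  rw [sq]
  exact mul_le_mul_of_nonneg_right (h1 n) (norm_nonneg _)

/-- The backward shift `T_z^*`. -/
def bshift (h : ℕ → ℂ) : ℕ → ℂ := fun n => h (n + 1)

theorem khankel_eq_hankel_bshift (u h : ℕ → ℂ) : khankel u h = hankel (bshift u) h := by
  funext k
  unfold khankel hankel bshift
  exact tsum_congr fun l => by rw [add_right_comm]

theorem khankel_eq_bshift_hankel (u h : ℕ → ℂ) : khankel u h = bshift (hankel u h) := rfl

section Hankel

variable {u : ℕ → ℂ}

theorem summable_shift (su : Summable fun n => ‖u n‖) (k : ℕ) :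
    Summable (fun l => ‖u (k + l)‖) := by
  simpa [add_comm] using (summable_nat_add_iff (f := fun n => ‖u n‖) k).2 su

theorem summable_hankel (su : Summable fun n => ‖u n‖) {h : ℕ → ℂ} (hh : MemL2 h) (k : ℕ) :
    Summable fun l => u (k + l) * conj (h l) :=
  summable_hinner (MemL2.of_summable (summable_shift su k)) hh

theorem summable_hankel_double (su : Summable fun n => ‖u n‖) {h : ℕ → ℂ} (hh : MemL2 h) :
    Summable fun q : ℕ × ℕ => ‖u (q.1 + q.2)‖ * ‖h q.2‖ ^ 2 := by
  rw [memL2_iff] at hh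
  have hsw : Summable fun q : ℕ × ℕ => ‖u (q.2 + q.1)‖ * ‖h q.1‖ ^ 2 := by
    refine (summable_prod_of_nonneg (fun q => by positivity)).2 ⟨fun l => ?_, ?_⟩
    · have := (summable_shift su l).mul_right (‖h l‖ ^ 2)
      simpa only [add_comm] using this
    · refine Summable.of_nonneg_of_le (fun l => tsum_nonneg fun k => by positivity) (fun l => ?_)
        (hh.mul_left (∑' n, ‖u n‖))
      dsimp only
      rw [tsum_mul_right]
      refine mul_le_mul_of_nonneg_right ?_ (by positivity)
      exact Summable.tsum_le_tsum_of_inj (fun k => k + l) (add_left_injective l)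
        (fun _ _ => norm_nonneg _) (fun _ => le_rfl) ((summable_nat_add_iff l).2 su) su
  exact (Equiv.prodComm ℕ ℕ).summable_iff.1 hsw

theorem memL2_hankel (su : Summable fun n => ‖u n‖) {h : ℕ → ℂ} (hh : MemL2 h) :
    MemL2 (hankel u h) := by
  have hd := summable_hankel_double su hh
  rw [memL2_iff]
  have hfib := (summable_prod_of_nonneg (fun q => by positivity)).1 hd
  refine Summable.of_nonneg_of_le (fun n => by positivity) (fun k => ?_)
    (hfib.2.mul_left (∑' n, ‖u n‖))
  have hA : ∑' l, ‖u (k + l)‖ ≤ ∑' n, ‖u n‖ :=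
    Summable.tsum_le_tsum_of_inj (fun l => k + l) (add_right_injective k)
        (fun _ _ => norm_nonneg _) (fun _ => le_rfl) (summable_shift su k) su
  have h1 : ‖hankel u h k‖ ≤ ∑' l, ‖u (k + l)‖ * ‖h l‖ := by
    have hs : Summable fun l => ‖u (k + l) * conj (h l)‖ := (summable_hankel su hh k).norm
    refine (norm_tsum_le_tsum_norm hs).trans (le_of_eq (tsum_congr fun l => by simp))
  have hs1 : Summable fun l => ‖u (k + l)‖ * ‖h l‖ :=
    summable_mul_of_memL2 (MemL2.of_summable (summable_shift su k)) hh
  have h2 : (∑' l, ‖u (k + l)‖ * ‖h l‖) ^ 2 ≤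
      (∑' l, ‖u (k + l)‖) * ∑' l, ‖u (k + l)‖ * ‖h l‖ ^ 2 := by
    have key : ∀ s : Finset ℕ, (∑ l ∈ s, ‖u (k + l)‖ * ‖h l‖) ^ 2 ≤
        (∑' l, ‖u (k + l)‖) * ∑' l, ‖u (k + l)‖ * ‖h l‖ ^ 2 := fun s => by
      refine (Finset.sum_sq_le_sum_mul_sum_of_sq_le_mul s (f := fun l => ‖u (k + l)‖)
        (g := fun l => ‖u (k + l)‖ * ‖h l‖ ^ 2) (fun _ _ => norm_nonneg _)
        (fun _ _ => by positivity) (fun _ _ => by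
          rw [mul_pow, sq ‖u _‖, mul_assoc])).trans ?_
      refine mul_le_mul ((summable_shift su k).sum_le_tsum s fun _ _ => norm_nonneg _)
        ((hfib.1 k).sum_le_tsum s fun _ _ => by positivity)
        (Finset.sum_nonneg fun _ _ => by positivity) (tsum_nonneg fun _ => norm_nonneg _)
    exact le_of_tendsto ((hs1.hasSum.pow 2)) (Eventually.of_forall key)
  calc ‖hankel u h k‖ ^ 2 ≤ (∑' l, ‖u (k + l)‖ * ‖h l‖) ^ 2 := by
        gcongr
    _ ≤ _ := h2
    _ ≤ _ := mul_le_mul_of_nonneg_right hA (tsum_nonneg fun _ => by positivity)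

theorem hankel_add (su : Summable fun n => ‖u n‖) {f g : ℕ → ℂ} (hf : MemL2 f) (hg : MemL2 g) :
    hankel u (f + g) = hankel u f + hankel u g := by
  funext k
  simp only [hankel, Pi.add_apply]
  rw [← (summable_hankel su hf k).tsum_add (summable_hankel su hg k)]
  exact tsum_congr fun n => by simp [mul_add]

theorem hankel_smul (c : ℂ) (f : ℕ → ℂ) : hankel u (c • f) = conj c • hankel u f := by
  funext k
  simp only [hankel, Pi.smul_apply, smul_eq_mul]
  rw [← tsum_mul_left]
  exact tsum_congr fun n => by simp; ring

theorem hinner_hankel_symm (su : Summable fun n => ‖u n‖) {f g : ℕ → ℂ} (hf : MemL2 f)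
    (hg : MemL2 g) : hinner (hankel u f) g = hinner (hankel u g) f := by
  have hs : Summable fun q : ℕ × ℕ => u (q.1 + q.2) * conj (f q.2) * conj (g q.1) := by
    refine Summable.of_norm_bounded (g := fun q : ℕ × ℕ => ‖u (q.1 + q.2)‖ * ‖f q.2‖ ^ 2 +
      ‖u (q.1 + q.2)‖ * ‖g q.1‖ ^ 2) ((summable_hankel_double su hf).add ?_) fun q => ?_
    · have := (Equiv.prodComm ℕ ℕ).summable_iff.2 (summable_hankel_double su hg)
      refine this.congr fun q => ?_
      simp [add_comm]
    · rw [norm_mul, norm_mul, RCLike.norm_conj, RCLike.norm_conj, mul_assoc, ← mul_add]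
      refine mul_le_mul_of_nonneg_left ?_ (norm_nonneg _)
      nlinarith [sq_nonneg (‖f q.2‖ - ‖g q.1‖), sq_nonneg (‖f q.2‖ + ‖g q.1‖)]
  unfold hinner hankel
  have e1 : ∀ k, (∑' l, u (k + l) * conj (f l)) * conj (g k) =
      ∑' l, u (k + l) * conj (f l) * conj (g k) := fun k => by rw [tsum_mul_right]
  have e2 : ∀ k, (∑' l, u (k + l) * conj (g l)) * conj (f k) =
      ∑' l, u (l + k) * conj (f k) * conj (g l) := fun k => by
    rw [← tsum_mul_right]
    exact tsum_congr fun l => by rw [add_comm l k]; ring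
  simp_rw [e1, e2]
  exact Summable.tsum_comm (f := fun l k => u (k + l) * conj (f l) * conj (g k))
    ((Equiv.prodComm ℕ ℕ).summable_iff.2 hs)

theorem hinner_hankel_hankel (su : Summable fun n => ‖u n‖) {f g : ℕ → ℂ} (hf : MemL2 f)
    (hg : MemL2 g) : hinner (hankel u (hankel u f)) g = hinner f (hankel u (hankel u g)) := by
  rw [hinner_hankel_symm su (memL2_hankel su hf) hg, ← hinner_conj_symm _ f,
    hinner_hankel_symm su (memL2_hankel su hg) hf, hinner_conj_symm]

end Hankel

theorem MemL2.add' {f g : ℕ → ℂ} (hf : MemL2 f) (hg : MemL2 g) : MemL2 (f + g) := Memℓp.add hf hg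

theorem MemL2.smul {f : ℕ → ℂ} (c : ℂ) (hf : MemL2 f) : MemL2 (c • f) := Memℓp.const_smul hf c

section KHankel

variable {u : ℕ → ℂ}

theorem summable_bshift (su : Summable fun n => ‖u n‖) : Summable fun n => ‖bshift u n‖ :=
  (summable_nat_add_iff (f := fun n => ‖u n‖) 1).2 su

theorem memL2_khankel (su : Summable fun n => ‖u n‖) {h : ℕ → ℂ} (hh : MemL2 h) :
    MemL2 (khankel u h) := by
  rw [khankel_eq_hankel_bshift]
  exact memL2_hankel (summable_bshift su) hh

theorem khankel_add (su : Summable fun n => ‖u n‖) {f g : ℕ → ℂ} (hf : MemL2 f) (hg : MemL2 g) :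
    khankel u (f + g) = khankel u f + khankel u g := by
  simp only [khankel_eq_hankel_bshift]
  exact hankel_add (summable_bshift su) hf hg

theorem khankel_smul (c : ℂ) (f : ℕ → ℂ) : khankel u (c • f) = conj c • khankel u f := by
  simp only [khankel_eq_hankel_bshift]
  exact hankel_smul c f

theorem memL2_ku2 (su : Summable fun n => ‖u n‖) {h : ℕ → ℂ} (hh : MemL2 h) :
    MemL2 (ku2 u h) := memL2_khankel su (memL2_khankel su hh)

theorem ku2_add (su : Summable fun n => ‖u n‖) {f g : ℕ → ℂ} (hf : MemL2 f) (hg : MemL2 g) :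
    ku2 u (f + g) = ku2 u f + ku2 u g := by
  unfold ku2
  rw [khankel_add su hf hg, khankel_add su (memL2_khankel su hf) (memL2_khankel su hg)]

theorem ku2_smul (c : ℂ) (f : ℕ → ℂ) : ku2 u (c • f) = c • ku2 u f := by
  unfold ku2
  rw [khankel_smul, khankel_smul, Complex.conj_conj]

theorem hinner_ku2 (su : Summable fun n => ‖u n‖) {f g : ℕ → ℂ} (hf : MemL2 f)
    (hg : MemL2 g) : hinner (ku2 u f) g = hinner f (ku2 u g) := by
  simp only [ku2, khankel_eq_hankel_bshift]
  exact hinner_hankel_hankel (summable_bshift su) hf hg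

/-- The eigenspace `ker (K_u² - τ²)` as a submodule. -/
def FSub (su : Summable fun n => ‖u n‖) (τ : ℝ) : Submodule ℂ (ℕ → ℂ) where
  carrier := Fspace u τ
  add_mem' := by
    rintro f g ⟨hf, hf'⟩ ⟨hg, hg'⟩
    exact ⟨hf.add' hg, by rw [ku2_add su hf hg, hf', hg', smul_add]⟩
  zero_mem' := ⟨zero_memℓp, by
    have := ku2_smul (u := u) 0 0
    simpa using this⟩
  smul_mem' := by
    rintro c f ⟨hf, hf'⟩
    exact ⟨hf.smul c, by rw [ku2_smul, hf', smul_comm]⟩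

theorem span_Fspace (su : Summable fun n => ‖u n‖) (τ : ℝ) :
    Submodule.span ℂ (Fspace u τ) = FSub su τ :=
  Submodule.span_eq (FSub su τ)

theorem memL2_of_finsupp (p : ℕ →₀ ℂ) : MemL2 (p : ℕ → ℂ) := by
  rw [memL2_iff]
  refine summable_of_ne_finset_zero (s := p.support) fun n hn => ?_
  simp [Finsupp.notMem_support_iff.1 hn]

theorem sigma_ne_zero (su : Summable fun n => ‖u n‖) (hfin : kuRank u < Cardinal.aleph0) {τ : ℝ}
    (hdim : Module.rank ℂ (Submodule.span ℂ (Fspace u τ)) = kuRank u) : τ ≠ 0 := by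
  rintro rfl
  rw [span_Fspace su] at hdim
  have fF : FiniteDimensional ℂ (FSub su 0) := by
    rw [FiniteDimensional, ← Module.rank_lt_aleph0_iff, hdim]; exact hfin
  set W := Submodule.span ℂ (khankel u '' {h | MemL2 h}) with hW
  have fW : FiniteDimensional ℂ W := by
    rw [FiniteDimensional, ← Module.rank_lt_aleph0_iff]; exact hfin
  let T : (ℕ →₀ ℂ) →ₗ[ℂ] W :=
    { toFun := fun p => ⟨ku2 u p, Submodule.subset_span
        ⟨khankel u p, memL2_khankel su (memL2_of_finsupp p), rfl⟩⟩
      map_add' := fun p q => Subtype.ext (by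
        simpa using ku2_add su (memL2_of_finsupp p) (memL2_of_finsupp q))
      map_smul' := fun c p => Subtype.ext (by simpa using ku2_smul (u := u) c p) }
  have fK : FiniteDimensional ℂ (LinearMap.ker T) := by
    let J : LinearMap.ker T →ₗ[ℂ] FSub su 0 :=
      { toFun := fun p => ⟨(p : ℕ →₀ ℂ), memL2_of_finsupp _, by
          have h0 : ku2 u (p : ℕ →₀ ℂ) = 0 := congrArg Subtype.val (LinearMap.mem_ker.1 p.2)
          rw [h0]; simp⟩
        map_add' := fun p q => Subtype.ext (by simp)
        map_smul' := fun c p => Subtype.ext (by simp) }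
    refine Module.Finite.of_injective J fun p q h => ?_
    have := congrArg Subtype.val h
    exact Subtype.ext (DFunLike.coe_injective this)
  have : FiniteDimensional ℂ (ℕ →₀ ℂ) := by
    rw [FiniteDimensional, Module.finite_def]
    refine Submodule.fg_of_fg_map_of_fg_inf_ker T ?_ ?_
    · exact IsNoetherian.noetherian _
    · rw [top_inf_eq]
      exact (Submodule.fg_top _).1 fK.fg_top
  have h2 := Module.rank_lt_aleph0 ℂ (ℕ →₀ ℂ)
  rw [rank_finsupp_self] at h2
  simp at h2

/-- When the eigenspace exhausts the range, `K_u² = τ²` on the range of `K_u`. -/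
theorem khankel_mem_Fspace (su : Summable fun n => ‖u n‖) (hfin : kuRank u < Cardinal.aleph0)
    {τ : ℝ} (hτ : τ ≠ 0)
    (hdim : Module.rank ℂ (Submodule.span ℂ (Fspace u τ)) = kuRank u) {h : ℕ → ℂ}
    (hh : MemL2 h) : khankel u h ∈ Fspace u τ := by
  rw [span_Fspace su] at hdim
  set W := Submodule.span ℂ (khankel u '' {h | MemL2 h}) with hW
  have fW : FiniteDimensional ℂ W := by
    rw [FiniteDimensional, ← Module.rank_lt_aleph0_iff]; exact hfin
  have hle : FSub su τ ≤ W := by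
    rintro f ⟨hf, hf'⟩
    have hc : ((τ : ℂ) ^ 2) ≠ 0 := pow_ne_zero 2 (by exact_mod_cast hτ)
    have : f = ((τ : ℂ) ^ 2)⁻¹ • ku2 u f := by rw [hf', smul_smul, inv_mul_cancel₀ hc, one_smul]
    rw [this]
    exact W.smul_mem _ (Submodule.subset_span ⟨_, memL2_khankel su hf, rfl⟩)
  have heq : FSub su τ = W := by
    refine Submodule.eq_of_le_of_finrank_eq hle ?_
    unfold Module.finrank
    rw [hdim]; rfl
  have : khankel u h ∈ FSub su τ := heq ▸ Submodule.subset_span ⟨h, hh, rfl⟩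
  exact this

end KHankel

/-- Coercion of the Hardy space to sequences, as a linear map. -/
def hardyCoe : Hardy →ₗ[ℂ] (ℕ → ℂ) where
  toFun := fun x => x
  map_add' := fun _ _ => rfl
  map_smul' := fun _ _ => rfl

theorem exists_dominating (V : Submodule ℂ (ℕ → ℂ)) [FiniteDimensional ℂ V]
    (hV : ∀ h ∈ V, MemL2 h) :
    ∃ B : ℕ → ℝ, Summable B ∧ (∀ n, 0 ≤ B n) ∧
      ∀ h ∈ V, ∀ n, ‖h n‖ ^ 2 ≤ B n * ∑' k, ‖h k‖ ^ 2 := by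
  let V' : Submodule ℂ Hardy := V.comap hardyCoe
  have hinj : Function.Injective hardyCoe := fun x y h => lp.ext h
  have : FiniteDimensional ℂ V' := by
    let J : V' →ₗ[ℂ] V := (hardyCoe.comp V'.subtype).codRestrict V fun x => x.2
    refine Module.Finite.of_injective J fun x y h => ?_
    have h2 := congrArg (Subtype.val : V → ℕ → ℂ) h
    exact Subtype.ext (hinj h2)
  let b := stdOrthonormalBasis ℂ V'
  refine ⟨fun n => ∑ i, ‖(b i : Hardy) n‖ ^ 2,
    summable_sum fun i _ => memL2_iff.1 (lp.memℓp (b i : Hardy)), 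
    fun n => Finset.sum_nonneg fun _ _ => by positivity, fun h hh n => ?_⟩
  let x : V' := ⟨⟨h, hV h hh⟩, hh⟩
  have hx : h n = ∑ i, b.repr x i * (b i : Hardy) n := by
    have h1 := congrArg (fun y : V' => hardyCoe (y : Hardy) n) (b.sum_repr x)
    simp only [Submodule.coe_sum, map_sum, Submodule.coe_smul, map_smul, Finset.sum_apply,
      Pi.smul_apply, smul_eq_mul] at h1
    exact h1.symm
  have hnorm : ∑ i, ‖b.repr x i‖ ^ 2 = ∑' k, ‖h k‖ ^ 2 := by
    rw [← EuclideanSpace.norm_sq_eq, LinearIsometryEquiv.norm_map]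
    have := lp.norm_rpow_eq_tsum (p := 2) (by norm_num) (x : Hardy)
    have h3 : ‖x‖ = ‖(x : Hardy)‖ := rfl
    simp only [ENNReal.toReal_ofNat, Real.rpow_ofNat] at this
    rw [h3, this]
  rw [← hnorm, hx, mul_comm]
  calc ‖∑ i, b.repr x i * (b i : Hardy) n‖ ^ 2 ≤ (∑ i, ‖b.repr x i‖ * ‖(b i : Hardy) n‖) ^ 2 := by
        gcongr
        refine (norm_sum_le _ _).trans (le_of_eq ?_)
        exact Finset.sum_congr rfl fun i _ => norm_mul _ _
    _ ≤ _ := Finset.sum_mul_sq_le_sq_mul_sq _ _ _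

theorem summable_pow_mul_of_finite_shift_invariant (V : Submodule ℂ (ℕ → ℂ))
    [FiniteDimensional ℂ V] (hV : ∀ h ∈ V, MemL2 h) (hS : ∀ h ∈ V, bshift h ∈ V) {h : ℕ → ℂ}
    (hh : h ∈ V) (m : ℕ) : Summable fun n : ℕ => (n : ℝ) ^ m * ‖h n‖ := by
  obtain ⟨B, sB, hB0, hB⟩ := exists_dominating V hV
  obtain ⟨N, hN⟩ : ∃ N, ∑' n, B (n + N) ≤ 1 / 4 := by
    have := tendsto_sum_nat_add B
    have := (this.eventually (ge_mem_nhds (show (0 : ℝ) < 1 / 4 by norm_num))).exists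
    exact this
  have hSit : ∀ k, ∀ h ∈ V, (fun n => h (n + k)) ∈ V := by
    intro k
    induction k with
    | zero => intro h hh; exact hh
    | succ k ih =>
      intro h hh
      have := hS _ (ih h hh)
      refine (congrArg (· ∈ V) ?_).mp this
      funext n
      simp [bshift]
      congr 1; ring
  set M := N + 1 with hM
  have hBM : ∑' n, B (n + M) ≤ 1 / 4 := by
    refine le_trans ?_ hN
    exact Summable.tsum_le_tsum_of_inj (fun n => n + 1) (add_left_injective 1)
      (fun n _ => hB0 _) (fun n => by rw [hM, add_comm N 1, add_assoc])
      ((summable_nat_add_iff M).2 sB) ((summable_nat_add_iff N).2 sB)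
  have step : ∀ g ∈ V, ∑' n, ‖g (n + M)‖ ^ 2 ≤ 1 / 4 * ∑' n, ‖g n‖ ^ 2 := by
    intro g hg
    calc ∑' n, ‖g (n + M)‖ ^ 2 ≤ ∑' n, B (n + M) * ∑' k, ‖g k‖ ^ 2 :=
          Summable.tsum_le_tsum (fun n => hB g hg (n + M))
            ((summable_nat_add_iff M).2 (memL2_iff.1 (hV g hg)))
            (((summable_nat_add_iff M).2 sB).mul_right _)
      _ = (∑' n, B (n + M)) * ∑' k, ‖g k‖ ^ 2 := tsum_mul_right
      _ ≤ _ := mul_le_mul_of_nonneg_right hBM (tsum_nonneg fun _ => by positivity)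
  set Q := ∑' n, ‖h n‖ ^ 2 with hQ
  have iter : ∀ j, ∑' n, ‖h (n + j * M)‖ ^ 2 ≤ (1 / 4) ^ j * Q := by
    intro j
    induction j with
    | zero => simp [hQ]
    | succ j ih =>
      have h1 := step _ (hSit (j * M) h hh)
      have e : (fun n => ‖h (n + M + j * M)‖ ^ 2) = fun n => ‖h (n + (j + 1) * M)‖ ^ 2 := by
        funext n; congr 3; ring
      rw [e] at h1
      refine h1.trans ?_
      rw [pow_succ]
      nlinarith
  have hQ0 : 0 ≤ Q := tsum_nonneg fun _ => by positivity
  have hMpos : (0 : ℝ) < M := by rw [hM]; positivity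
  set r : ℝ := (1 / 2 : ℝ) ^ (1 / (M : ℝ)) with hr
  have hr0 : 0 < r := by rw [hr]; positivity
  have hr1 : r < 1 := Real.rpow_lt_one (by norm_num) (by norm_num) (by positivity)
  have hbound : ∀ n : ℕ, ‖h n‖ ≤ 2 * Real.sqrt Q * r ^ n := by
    intro n
    have h1 : ‖h n‖ ^ 2 ≤ (1 / 4) ^ (n / M) * Q := by
      refine le_trans ?_ (iter (n / M))
      have := (memL2_iff.1 (hV _ (hSit (n / M * M) h hh))).le_tsum (n % M)
        fun _ _ => by positivity
      rwa [Nat.mod_add_div'] at this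
    have h2 : ‖h n‖ ≤ (1 / 2) ^ (n / M) * Real.sqrt Q := by
      refine abs_le_of_sq_le_sq' ?_ (by positivity) |>.2
      rw [mul_pow, Real.sq_sqrt hQ0, ← pow_mul, mul_comm (n / M) 2, pow_mul]
      norm_num at h1 ⊢
      exact h1
    have h3 : (1 / 2 : ℝ) ^ (n / M) ≤ 2 * r ^ n := by
      have e1 : r ^ n = (1 / 2 : ℝ) ^ ((n : ℝ) / M) := by
        rw [hr, ← Real.rpow_natCast, ← Real.rpow_mul (by norm_num)]
        congr 1; ring
      have e2 : (2 : ℝ) * (1 / 2 : ℝ) ^ ((n : ℝ) / M) = (1 / 2 : ℝ) ^ ((n : ℝ) / M - 1) := by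
        rw [Real.rpow_sub (by norm_num), Real.rpow_one]; ring
      rw [e1, e2, ← Real.rpow_natCast]
      refine Real.rpow_le_rpow_of_exponent_ge (by norm_num) (by norm_num) ?_
      have : (n : ℝ) < ((n / M : ℕ) + 1) * M := by
        have := Nat.lt_div_mul_add (a := n) (b := M) (by omega)
        have h4 : (n : ℝ) < (n / M : ℕ) * M + M := by exact_mod_cast this
        linarith
      rw [sub_le_iff_le_add, div_le_iff₀ hMpos]
      exact this.le
    calc ‖h n‖ ≤ (1 / 2) ^ (n / M) * Real.sqrt Q := h2
      _ ≤ 2 * r ^ n * Real.sqrt Q := by gcongr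
      _ = _ := by ring
  have hg := (summable_pow_mul_geometric_of_norm_lt_one m
    (r := r) (by rw [Real.norm_of_nonneg hr0.le]; exact hr1)).mul_left (2 * Real.sqrt Q)
  refine Summable.of_nonneg_of_le (fun n => by positivity) (fun n => ?_) hg
  calc (n : ℝ) ^ m * ‖h n‖ ≤ (n : ℝ) ^ m * (2 * Real.sqrt Q * r ^ n) := by gcongr; exact hbound n
    _ = _ := by ring

theorem bshift_khankel {u h : ℕ → ℂ} (su : Summable fun n => ‖u n‖) (hh : MemL2 h) :
    ∃ g, MemL2 g ∧ bshift (khankel u h) = khankel u g := by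
  refine ⟨fun n => if n = 0 then 0 else h (n - 1), ?_, ?_⟩
  · rw [memL2_iff] at hh ⊢
    refine (summable_nat_add_iff 1).1 ?_
    simpa using hh
  · have hg : MemL2 (fun n => if n = 0 then 0 else h (n - 1)) := by
      rw [memL2_iff] at hh ⊢
      refine (summable_nat_add_iff 1).1 ?_
      simpa using hh
    funext k
    simp only [bshift, khankel]
    have := summable_hankel su hg (k + 1)
    rw [this.tsum_eq_zero_add]
    simp only [if_true, map_zero, mul_zero, zero_add, Nat.add_eq_zero_iff, one_ne_zero, and_false,
      if_false, Nat.add_sub_cancel]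
    exact tsum_congr fun l => by congr 2; ring

theorem hankel_zero_apply (u h : ℕ → ℂ) : hankel u h 0 = hinner u h := by
  simp [hankel, hinner]

theorem hankel_eq_add_khankel_bshift {u h : ℕ → ℂ} (su : Summable fun n => ‖u n‖)
    (hh : MemL2 h) (k : ℕ) :
    hankel u h k = u k * conj (h 0) + khankel u (bshift h) k := by
  unfold hankel khankel bshift
  rw [(summable_hankel su hh k).tsum_eq_zero_add]
  simp only [add_zero]
  congr 1
  exact tsum_congr fun l => by congr 2; ring

theorem exists_profile {u₀ : ℕ → ℂ} (su : Summable fun n => ‖u₀ n‖)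
    (hfin : kuRank u₀ < Cardinal.aleph0) {σ : ℝ} (hσK : SigmaK u₀ = {σ})
    (hdim : Module.rank ℂ (Submodule.span ℂ (Fspace u₀ σ)) = kuRank u₀) (α : ℝ) :
    0 < σ ∧ ∃ a : ℂ, σ < ‖a‖ ∧ u₀ 0 = a - σ ^ 2 / conj a ∧
      (∀ k, khankel u₀ u₀ k = conj a * u₀ (k + 1)) ∧
      (∑' n, ‖u₀ n‖ ^ 2 = ‖a‖ ^ 2 - σ ^ 2) ∧
      (∀ m : ℕ, Summable fun n : ℕ => (n : ℝ) ^ m * ‖u₀ n‖) ∧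
      (∃ n, u₀ (n + 1) ≠ 0) ∧
      (hinner (ku2 u₀ u₀) u₀ - (α : ℂ) * hinner (ku2 u₀ oneSeq) oneSeq = 0 ↔ ‖a‖ ^ 2 = α) := by
  have hσ0 : σ ≠ 0 := sigma_ne_zero su hfin hdim
  have hmem : σ ∈ SigmaK u₀ := by rw [hσK]; rfl
  have hσpos : 0 < σ := lt_of_le_of_ne hmem.1 (Ne.symm hσ0)
  obtain ⟨-, v₀, -, hv₀⟩ := hmem
  have hu : MemL2 u₀ := MemL2.of_summable su
  have hc : ((σ : ℂ) ^ 2) ≠ 0 := pow_ne_zero 2 (by exact_mod_cast hσ0)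
  have hσc : (σ : ℂ) ≠ 0 := by exact_mod_cast hσ0
  have hRan : ∀ {h}, MemL2 h → khankel u₀ h ∈ FSub su σ := fun hh =>
    khankel_mem_Fspace su hfin hσ0 hdim hh
  have hF2 : ∀ {h}, h ∈ FSub su σ → MemL2 h := fun hh => hh.1
  have hFK : ∀ {h}, h ∈ FSub su σ → ku2 u₀ h = ((σ : ℂ) ^ 2) • h := fun hh => hh.2
  have hu_ne : u₀ ≠ 0 := by
    rintro rfl
    exact hv₀ (by simp [hinner])
  -- `u₀` lies in the eigenspace
  have hker : ∀ h, MemL2 h → ku2 u₀ h = 0 → hinner u₀ h = 0 := by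
    intro h hh hz
    by_contra hne
    have : (0 : ℝ) ∈ SigmaK u₀ := ⟨le_rfl, h, ⟨hh, by simpa using hz⟩, hne⟩
    rw [hσK] at this
    exact hσ0 this.symm
  have huF : u₀ ∈ FSub su σ := by
    set d : ℕ → ℂ := u₀ + (-((σ : ℂ) ^ 2)⁻¹) • ku2 u₀ u₀ with hd
    have hd2 : MemL2 d := hu.add' ((memL2_ku2 su hu).smul _)
    have hkd : ku2 u₀ d = 0 := by
      have hKK : ku2 u₀ (ku2 u₀ u₀) = ((σ : ℂ) ^ 2) • ku2 u₀ u₀ :=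
        hFK (hRan (memL2_khankel su hu))
      rw [hd, ku2_add su hu ((memL2_ku2 su hu).smul _), ku2_smul, hKK, smul_smul, neg_mul,
        inv_mul_cancel₀ hc]
      simp
    have h1 := hker d hd2 hkd
    have h2 : hinner (ku2 u₀ u₀) d = 0 := by
      rw [hinner_ku2 su hu hd2, hkd]
      simp [hinner]
    have h3 : hinner d d = 0 := by
      conv_lhs => rw [hd]
      rw [hinner_add_left hu ((memL2_ku2 su hu).smul _) hd2, hinner_smul_left, h1, h2]
      simp
    have h4 := eq_zero_of_hinner_self hd2 h3
    have h5 : u₀ = ((σ : ℂ) ^ 2)⁻¹ • ku2 u₀ u₀ := by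
      rw [hd, neg_smul, ← sub_eq_add_neg, sub_eq_zero] at h4
      exact h4
    refine (congrArg (fun x => x ∈ FSub su σ) h5).mpr ?_
    exact (FSub su σ).smul_mem _ (hRan (memL2_khankel su hu))
  obtain ⟨k₁, hk₁⟩ : ∃ n, u₀ (n + 1) ≠ 0 := by
    by_contra! hz
    refine hu_ne ?_
    have h1 := hFK huF
    have h0 : ∀ h, khankel u₀ h = 0 := fun h => by
      funext k
      simp only [khankel, Pi.zero_apply]
      rw [← tsum_zero]
      exact tsum_congr fun l => by
        rw [show k + 1 + l = (k + l) + 1 by ring, hz, zero_mul]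
    rw [ku2, h0] at h1
    exact (smul_eq_zero.1 h1.symm).resolve_left hc
  -- the projection of `1` on the eigenspace
  set e : ℕ → ℂ := ((σ : ℂ) ^ 2)⁻¹ • ku2 u₀ oneSeq with he
  have h1L := memL2_oneSeq
  have heF : e ∈ FSub su σ := (FSub su σ).smul_mem _ (hRan (memL2_khankel su h1L))
  have hK1 : khankel u₀ oneSeq = bshift u₀ := by
    funext k
    simp only [khankel, bshift]
    rw [tsum_eq_single 0 (fun n hn => by simp [oneSeq, hn])]
    simp [oneSeq]
  have hKe : khankel u₀ e = bshift u₀ := by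
    have h1 : khankel u₀ (ku2 u₀ oneSeq) = ku2 u₀ (khankel u₀ oneSeq) := rfl
    rw [he, khankel_smul, h1, hFK (hRan h1L), smul_smul, hK1]
    have : conj (((σ : ℂ) ^ 2)⁻¹) = ((σ : ℂ) ^ 2)⁻¹ := by simp
    rw [this, inv_mul_cancel₀ hc, one_smul]
  have hpair : ∀ {h}, h ∈ FSub su σ → hinner h e = h 0 := by
    intro h hh
    have h1 : hinner e h = conj (h 0) := by
      rw [he, hinner_smul_left, hinner_ku2 su h1L (hF2 hh), hFK hh, ← hinner_conj_symm,
        hinner_smul_left, hinner_oneSeq]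
      simp only [map_mul, map_pow, Complex.conj_ofReal]
      rw [← mul_assoc, inv_mul_cancel₀ hc, one_mul]
    rw [← hinner_conj_symm, h1, Complex.conj_conj]
  have hS : ∀ h ∈ FSub su σ, bshift h ∈ FSub su σ := by
    intro h hh
    have h1 : h = khankel u₀ (((σ : ℂ) ^ 2)⁻¹ • khankel u₀ h) := by
      rw [khankel_smul]
      have h2 : khankel u₀ (khankel u₀ h) = ((σ : ℂ) ^ 2) • h := hFK hh
      have : conj (((σ : ℂ) ^ 2)⁻¹) = ((σ : ℂ) ^ 2)⁻¹ := by simp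
      rw [h2, smul_smul, this, inv_mul_cancel₀ hc, one_smul]
    obtain ⟨g, hg, hg'⟩ := bshift_khankel su
      ((memL2_khankel su (hF2 hh)).smul ((σ : ℂ) ^ 2)⁻¹)
    rw [h1, hg']
    exact hRan hg
  have horth : ∀ {h}, h ∈ FSub su σ → h 0 = 0 → hinner u₀ h = 0 := by
    intro h hh h0
    have h1 : khankel u₀ (bshift h) = hankel u₀ h := by
      funext k
      rw [hankel_eq_add_khankel_bshift su (hF2 hh), h0]; simp
    have h2 : khankel u₀ (hankel u₀ h) = ((σ : ℂ) ^ 2) • bshift h := by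
      rw [← h1]; exact hFK (hS h hh)
    have h3 := congrFun h2 k₁
    have h4 : khankel u₀ (hankel u₀ h) k₁ =
        u₀ (k₁ + 1) * conj (hankel u₀ h 0) + ku2 u₀ h (k₁ + 1) := by
      have := hankel_eq_add_khankel_bshift su (memL2_hankel su (hF2 hh)) (k₁ + 1)
      rw [← khankel_eq_bshift_hankel] at this
      exact this
    rw [h4, hFK hh] at h3
    simp only [Pi.smul_apply, bshift, add_eq_right, mul_eq_zero, hk₁, false_or,
      map_eq_zero] at h3
    rw [← hankel_zero_apply]; exact h3
  have hee : hinner e e = e 0 := hpair heF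
  have he0 : e 0 ≠ 0 := by
    intro h0
    rw [h0] at hee
    have := eq_zero_of_hinner_self (hF2 heF) hee
    rw [this] at hKe
    refine hk₁ ?_
    have h2 := congrFun hKe k₁
    simp only [khankel, bshift, Pi.zero_apply, map_zero, mul_zero, tsum_zero] at h2
    exact h2.symm
  set a : ℂ := u₀ 0 / e 0 with ha
  have hua : u₀ = a • e := by
    set d : ℕ → ℂ := u₀ + (-a) • e with hd
    have hdF : d ∈ FSub su σ := (FSub su σ).add_mem huF ((FSub su σ).smul_mem _ heF)
    have hd0 : d 0 = 0 := by
      simp only [hd, Pi.add_apply, Pi.smul_apply, smul_eq_mul, ha]; field_simp; ring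
    have h1 := horth hdF hd0
    have h2 : hinner e d = 0 := by
      rw [← hinner_conj_symm, hpair hdF, hd0, map_zero]
    have h3 : hinner d d = 0 := by
      conv_lhs => rw [hd]
      rw [hinner_add_left hu ((hF2 heF).smul _) (hF2 hdF), hinner_smul_left, h1, h2]
      simp
    have h4 := eq_zero_of_hinner_self (hF2 hdF) h3
    rw [hd, neg_smul, ← sub_eq_add_neg, sub_eq_zero] at h4
    exact h4
  have ha0 : a ≠ 0 := by
    intro h0
    rw [h0, zero_smul] at hua
    exact hu_ne hua
  have hac : conj a ≠ 0 := (map_ne_zero _).2 ha0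
  have hKu : khankel u₀ u₀ = conj a • bshift u₀ := by
    calc khankel u₀ u₀ = khankel u₀ (a • e) := congrArg _ hua
      _ = _ := by rw [khankel_smul, hKe]
  have hKS : khankel u₀ (bshift u₀) = ((σ : ℂ) ^ 2 / a) • u₀ := by
    have h1 : bshift u₀ = (conj a)⁻¹ • khankel u₀ u₀ := by
      rw [hKu, smul_smul, inv_mul_cancel₀ hac, one_smul]
    have h2 : khankel u₀ (khankel u₀ u₀) = ((σ : ℂ) ^ 2) • u₀ := hFK huF
    rw [h1, khankel_smul, h2, smul_smul]
    congr 1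
    simp only [map_inv₀, Complex.conj_conj]
    field_simp
  have hH : ∀ k, hankel u₀ u₀ k = u₀ k * conj (u₀ 0) + (σ : ℂ) ^ 2 / a * u₀ k := by
    intro k
    rw [hankel_eq_add_khankel_bshift su hu, hKS]; rfl
  have hmean : conj (u₀ 0) = conj a - (σ : ℂ) ^ 2 / a := by
    have h1 := hH (k₁ + 1)
    have h2 : hankel u₀ u₀ (k₁ + 1) = conj a * u₀ (k₁ + 1) := congrFun hKu k₁
    rw [h2] at h1
    have h3 : u₀ (k₁ + 1) * (conj a - (conj (u₀ 0) + (σ : ℂ) ^ 2 / a)) = 0 := by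
      linear_combination h1
    have h4 := (mul_eq_zero.1 h3).resolve_left hk₁
    linear_combination -h4
  have hmean' : u₀ 0 = a - (σ : ℂ) ^ 2 / conj a := by
    have := congrArg conj hmean
    simpa using this
  have hnorm : (∑' n, ‖u₀ n‖ ^ 2 : ℝ) = ‖a‖ ^ 2 - σ ^ 2 := by
    have h1 := hinner_self_eq u₀
    rw [← hankel_zero_apply, hH, hmean, hmean'] at h1
    have h2 : (a - (σ : ℂ) ^ 2 / conj a) * (conj a - (σ : ℂ) ^ 2 / a) +
        (σ : ℂ) ^ 2 / a * (a - (σ : ℂ) ^ 2 / conj a) = a * conj a - (σ : ℂ) ^ 2 := by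
      field_simp; ring
    rw [h2, Complex.mul_conj, Complex.normSq_eq_norm_sq] at h1
    exact_mod_cast h1.symm
  have hpos : 0 < (∑' n, ‖u₀ n‖ ^ 2 : ℝ) := by
    refine (memL2_iff.1 hu).tsum_pos (fun _ => by positivity) (k₁ + 1) ?_
    have := norm_pos_iff.2 hk₁
    positivity
  refine ⟨hσpos, a, ?_, hmean', fun k => congrFun hKu k, hnorm, ?_, ⟨k₁, hk₁⟩, ?_⟩
  · exact lt_of_pow_lt_pow_left₀ 2 (norm_nonneg _) (by linarith)
  · intro m
    have : FiniteDimensional ℂ (FSub su σ) := by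
      rw [FiniteDimensional, ← Module.rank_lt_aleph0_iff, ← span_Fspace su, hdim]
      exact hfin
    exact summable_pow_mul_of_finite_shift_invariant (FSub su σ) (fun h hh => hF2 hh) hS huF m
  · have h1 : hinner (ku2 u₀ u₀) u₀ = (σ : ℂ) ^ 2 * (u₀ 0 * conj a) := by
      rw [hFK huF, hinner_smul_left, ← hankel_zero_apply, hH, hmean]
      congr 1; ring
    have h2 : hinner (ku2 u₀ oneSeq) oneSeq = (σ : ℂ) ^ 2 * e 0 := by
      rw [hinner_oneSeq, he]
      simp only [Pi.smul_apply, smul_eq_mul]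
      rw [← mul_assoc, mul_inv_cancel₀ hc, one_mul]
    have h3 : u₀ 0 = a * e 0 := congrFun hua 0
    have h4 : hinner (ku2 u₀ u₀) u₀ - (α : ℂ) * hinner (ku2 u₀ oneSeq) oneSeq =
        (σ : ℂ) ^ 2 * e 0 * (((‖a‖ ^ 2 - α : ℝ)) : ℂ) := by
      have h5 : a * conj a = ((‖a‖ ^ 2 : ℝ) : ℂ) := by
        rw [Complex.mul_conj, Complex.normSq_eq_norm_sq]
      rw [h1, h2, h3, Complex.ofReal_sub, ← h5]; ring
    rw [h4]
    simp only [mul_eq_zero, hc, he0, false_or, Complex.ofReal_eq_zero, sub_eq_zero]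

/-- A bounded Lipschitz autonomous vector field is complete. -/
theorem exists_global_solution {E : Type*} [NormedAddCommGroup E] [NormedSpace ℝ E]
    [CompleteSpace E] {f : E → E} {K M : NNReal} (hf : LipschitzWith K f) (hM : ∀ x, ‖f x‖ ≤ M)
    (x₀ : E) : ∃ γ : ℝ → E, γ 0 = x₀ ∧ ∀ t, HasDerivAt γ (f (γ t)) t := by
  have hloc : ∀ n : ℕ, ∃ γ : ℝ → E, γ 0 = x₀ ∧
      ∀ t ∈ Set.Ioo (-(n + 1 : ℝ)) (n + 1 : ℝ), HasDerivAt γ (f (γ t)) t := by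
    intro n
    have h0 : (0 : ℝ) ∈ Set.Icc (-(n + 1 : ℝ)) (n + 1 : ℝ) :=
      ⟨by linarith [n.cast_nonneg (α := ℝ)], by positivity⟩
    have hP : IsPicardLindelof (fun _ => f) (⟨0, h0⟩ : Set.Icc (-(n + 1 : ℝ)) (n + 1 : ℝ)) x₀
        (M * (n + 1 : NNReal)) 0 M K :=
      { lipschitzOnWith := fun _ _ => hf.lipschitzOnWith
        continuousOn := fun _ _ => continuousOn_const
        norm_le := fun _ _ x _ => hM x
        mul_max_le := by simp }
    obtain ⟨γ, hγ0, hγ⟩ := hP.exists_eq_forall_mem_Icc_hasDerivWithinAt₀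
    exact ⟨γ, hγ0, fun t ht => (hγ t (Set.Ioo_subset_Icc_self ht)).hasDerivAt
      (Icc_mem_nhds ht.1 ht.2)⟩
  choose γ hγ0 hγ using hloc
  have hcomp : ∀ n m : ℕ, n ≤ m → Set.EqOn (γ n) (γ m) (Set.Ioo (-(n + 1 : ℝ)) (n + 1 : ℝ)) := by
    intro n m hnm
    have hnm' : (n : ℝ) ≤ m := by exact_mod_cast hnm
    have h0 : (0 : ℝ) ∈ Set.Ioo (-(n + 1 : ℝ)) (n + 1 : ℝ) :=
      ⟨by linarith [n.cast_nonneg (α := ℝ)], by positivity⟩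
    refine ODE_solution_unique_of_mem_Ioo (v := fun _ => f) (s := fun _ => Set.univ)
      (fun _ _ => hf.lipschitzOnWith) h0 (fun t ht => ⟨hγ n t ht, trivial⟩)
      (fun t ht => ⟨hγ m t ⟨by linarith [ht.1], by linarith [ht.2]⟩, trivial⟩) ?_
    rw [hγ0, hγ0]
  have hmem : ∀ {t : ℝ} {n : ℕ}, |t| ≤ n → t ∈ Set.Ioo (-(n + 1 : ℝ)) (n + 1 : ℝ) := by
    intro t n h
    have := abs_le.1 h
    exact ⟨by linarith, by linarith⟩
  have key : ∀ (n : ℕ) (t : ℝ), |t| ≤ (n : ℝ) → γ ⌈|t|⌉₊ t = γ n t := by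
    intro n t ht
    have h1 : ⌈|t|⌉₊ ≤ n := Nat.ceil_le.2 ht
    exact hcomp _ _ h1 (hmem (Nat.le_ceil _))
  refine ⟨fun t => γ ⌈|t|⌉₊ t, by simp [hγ0], fun t => ?_⟩
  set n := ⌈|t|⌉₊ + 1 with hn
  have hlt : |t| < n := by
    have := Nat.le_ceil |t|
    rw [hn]; push_cast; linarith
  have hev : (fun t => γ ⌈|t|⌉₊ t) =ᶠ[𝓝 t] γ n := by
    filter_upwards [continuous_abs.continuousAt.eventually (gt_mem_nhds hlt)] with s hs
    exact key n s (le_of_lt hs)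
  have h2 := (hγ n t (hmem hlt.le)).congr_of_eventuallyEq hev
  rw [← key n t hlt.le] at h2
  exact h2

theorem eq_mul_exp_of_hasDerivAt {y g : ℝ → ℝ} (hg : Continuous g)
    (hy : ∀ t, HasDerivAt y (g t * y t) t) (t : ℝ) :
    y t = y 0 * Real.exp (∫ s in (0 : ℝ)..t, g s) := by
  have hG : ∀ t, HasDerivAt (fun t => ∫ s in (0 : ℝ)..t, g s) (g t) t := fun t =>
    intervalIntegral.integral_hasDerivAt_right (hg.intervalIntegrable _ _)
      (hg.stronglyMeasurableAtFilter _ _) hg.continuousAt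
  have hd : ∀ t, HasDerivAt (fun t => y t * Real.exp (-∫ s in (0 : ℝ)..t, g s)) 0 t := by
    intro t
    refine ((hy t).mul (hG t).neg.exp).congr_deriv ?_
    ring
  have hc := is_const_of_deriv_eq_zero (fun t => (hd t).differentiableAt)
    (fun t => (hd t).deriv) t 0
  simp only [intervalIntegral.integral_same, neg_zero, Real.exp_zero, mul_one] at hc
  rw [← hc, mul_assoc, ← Real.exp_add]
  simp

theorem eq_const_of_hasDerivAt {y : ℝ → ℝ} (hy : ∀ t, HasDerivAt y 0 t) (t : ℝ) : y t = y 0 :=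
  is_const_of_deriv_eq_zero (fun t => (hy t).differentiableAt) (fun t => (hy t).deriv) t 0

/-- Component fields of the reduced system. -/
def fieldA (σ α : ℝ) (a β : ℂ) : ℂ :=
  -I * ((a * conj a + σ ^ 2 + α) * a + σ * (a ^ 2 * conj β + α * β))

/-- Component fields of the reduced system. -/
def fieldB (σ : ℝ) (a β : ℂ) : ℂ :=
  -I * (a * σ + (2 * (a * conj a) + σ ^ 2) * β + conj a * σ * β ^ 2)

/-- Component fields of the reduced system. -/
def fieldE (σ : ℝ) (a β η : ℂ) : ℂ :=
  -I * ((2 * (a * conj a) + σ ^ 2 + σ * (a * conj β + conj a * β)) * η)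

section Laws

variable {σ α : ℝ} {a β η : ℝ → ℂ} {c : ℝ → ℝ} {t : ℝ}

theorem HasDerivAt.normSq' {f : ℝ → ℂ} {f' : ℂ} (h : HasDerivAt f f' t) :
    HasDerivAt (fun t => ‖f t‖ ^ 2) (2 * (conj (f t) * f').re) t := by
  refine h.norm_sq.congr_deriv ?_
  rw [Complex.inner, mul_comm f']

theorem HasDerivAt.conj' {f : ℝ → ℂ} {f' : ℂ} (h : HasDerivAt f f' t) :
    HasDerivAt (fun t => conj (f t)) (conj f') t :=
  Complex.conjCLE.toContinuousLinearMap.hasFDerivAt.comp_hasDerivAt t h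

theorem HasDerivAt.re' {f : ℝ → ℂ} {f' : ℂ} (h : HasDerivAt f f' t) :
    HasDerivAt (fun t => (f t).re) f'.re t :=
  Complex.reCLM.hasFDerivAt.comp_hasDerivAt t h

theorem HasDerivAt.im' {f : ℝ → ℂ} {f' : ℂ} (h : HasDerivAt f f' t) :
    HasDerivAt (fun t => (f t).im) f'.im t :=
  Complex.imCLM.hasFDerivAt.comp_hasDerivAt t h

theorem sq_norm_eq (z : ℂ) : ‖z‖ ^ 2 = z.re ^ 2 + z.im ^ 2 := by
  rw [← Complex.normSq_eq_norm_sq, Complex.normSq_apply]; ring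

theorem hasDerivAt_normSq_a (ha : HasDerivAt a (c t * fieldA σ α (a t) (β t)) t) :
    HasDerivAt (fun t => ‖a t‖ ^ 2 - α)
      (2 * σ * c t * (a t * conj (β t)).im * (‖a t‖ ^ 2 - α)) t := by
  refine (ha.normSq'.sub_const α).congr_deriv ?_
  rw [sq_norm_eq]
  simp [fieldA, pow_two]
  ring

theorem hasDerivAt_mul_conj (ha : HasDerivAt a (c t * fieldA σ α (a t) (β t)) t)
    (hβ : HasDerivAt β (c t * fieldB σ (a t) (β t)) t) :
    HasDerivAt (fun t => a t * conj (β t))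
      (c t * I * ((‖a t‖ ^ 2 - α : ℝ) * (a t * conj (β t)) +
        σ * (‖a t‖ ^ 2 - α * ‖β t‖ ^ 2 : ℝ))) t := by
  refine (ha.mul hβ.conj').congr_deriv ?_
  have h1 : ((‖a t‖ ^ 2 : ℝ) : ℂ) = a t * conj (a t) := by
    rw [Complex.mul_conj, Complex.normSq_eq_norm_sq]
  have h2 : ((‖β t‖ ^ 2 : ℝ) : ℂ) = β t * conj (β t) := by
    rw [Complex.mul_conj, Complex.normSq_eq_norm_sq]
  rw [Complex.ofReal_sub, Complex.ofReal_sub, Complex.ofReal_mul, h1, h2]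
  simp only [fieldA, fieldB, map_mul, map_add, map_pow, map_neg, Complex.conj_I,
    Complex.conj_ofReal, Complex.conj_conj, map_ofNat]
  ring

theorem hasDerivAt_one_sub_normSq_b (hβ : HasDerivAt β (c t * fieldB σ (a t) (β t)) t) :
    HasDerivAt (fun t => 1 - ‖β t‖ ^ 2)
      (-(2 * σ * c t * (a t * conj (β t)).im) * (1 - ‖β t‖ ^ 2)) t := by
  refine (hβ.normSq'.const_sub 1).congr_deriv ?_
  rw [sq_norm_eq]
  simp [fieldB, pow_two]
  ring

theorem hasDerivAt_normSq_e (hη : HasDerivAt η (c t * fieldE σ (a t) (β t) (η t)) t) :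
    HasDerivAt (fun t => ‖η t‖ ^ 2) 0 t := by
  refine hη.normSq'.congr_deriv ?_
  have h1 : ((σ : ℂ) ^ 2).im = 0 := by rw [← Complex.ofReal_pow, Complex.ofReal_im]
  simp [fieldE, h1]
  ring

theorem hasDerivAt_energy (ha : HasDerivAt a (c t * fieldA σ α (a t) (β t)) t)
    (hβ : HasDerivAt β (c t * fieldB σ (a t) (β t)) t) :
    HasDerivAt (fun t => ‖a t‖ ^ 2 - α + 2 * σ * (a t * conj (β t)).re) 0 t := by
  refine ((hasDerivAt_normSq_a ha).add
    ((hasDerivAt_mul_conj ha hβ).re'.const_mul (2 * σ))).congr_deriv ?_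
  generalize ‖a t‖ ^ 2 - α = x, ‖a t‖ ^ 2 - α * ‖β t‖ ^ 2 = y
  simp only [Complex.mul_re, Complex.mul_im, Complex.add_re, Complex.add_im, Complex.ofReal_re,
    Complex.ofReal_im, Complex.I_re, Complex.I_im]
  ring

end Laws

/-- The reduced finite-dimensional system is globally well-posed in the open disc. -/
theorem exists_reduced_solution {σ α : ℝ} (hσ : 0 < σ) (a₀ β₀ η₀ : ℂ) (hβ₀ : ‖β₀‖ < 1)
    (hη₀ : ‖η₀‖ = 1) : ∃ a β η : ℝ → ℂ, a 0 = a₀ ∧ β 0 = β₀ ∧ η 0 = η₀ ∧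
      (∀ t, HasDerivAt a (fieldA σ α (a t) (β t)) t) ∧
      (∀ t, HasDerivAt β (fieldB σ (a t) (β t)) t) ∧
      (∀ t, HasDerivAt η (fieldE σ (a t) (β t) (η t)) t) ∧
      (∀ t, ‖β t‖ < 1) ∧ (∀ t, ‖η t‖ = 1) ∧ (∃ A, ∀ t, ‖a t‖ ≤ A) := by
  set J := ‖a₀‖ ^ 2 + 2 * σ * (a₀ * conj β₀).re with hJ
  set R := 2 * σ + |J| + 1 with hR
  have hRpos : 0 < R := by positivity
  let X : ℂ × ℂ × ℂ → ℂ × ℂ × ℂ := fun p =>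
    (fieldA σ α p.1 p.2.1, fieldB σ p.1 p.2.1, fieldE σ p.1 p.2.1 p.2.2)
  have hX : ContDiff ℝ 1 X := by
    have hconj : ContDiff ℝ 1 (fun z : ℂ => conj z) := Complex.conjCLE.contDiff
    have c1 : ContDiff ℝ 1 (fun p : ℂ × ℂ × ℂ => conj p.1) := hconj.comp contDiff_fst
    have c2 : ContDiff ℝ 1 (fun p : ℂ × ℂ × ℂ => conj p.2.1) :=
      hconj.comp (contDiff_fst.comp contDiff_snd)
    refine ContDiff.prodMk ?_ (ContDiff.prodMk ?_ ?_)
    · unfold fieldA; fun_prop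
    · unfold fieldB; fun_prop
    · unfold fieldE; fun_prop
  let χ : ContDiffBump (0 : ℂ × ℂ × ℂ) :=
    { rIn := R + 1, rOut := R + 2, rIn_pos := by positivity, rIn_lt_rOut := by linarith }
  let Y : ℂ × ℂ × ℂ → ℂ × ℂ × ℂ := fun p => χ p • X p
  have hY : ContDiff ℝ 1 Y := χ.contDiff.smul hX
  have hYs : HasCompactSupport Y := χ.hasCompactSupport.smul_right
  obtain ⟨K, hK⟩ := hY.lipschitzWith_of_hasCompactSupport hYs one_ne_zero
  obtain ⟨M, hM⟩ := hY.continuous.bounded_above_of_compact_support hYs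
  obtain ⟨γ, hγ0, hγ⟩ := exists_global_solution (M := M.toNNReal) hK
    (fun x => (hM x).trans (Real.le_coe_toNNReal M)) (a₀, β₀, η₀)
  set a : ℝ → ℂ := fun t => (γ t).1 with ha
  set β : ℝ → ℂ := fun t => (γ t).2.1 with hβ
  set η : ℝ → ℂ := fun t => (γ t).2.2 with hη
  set c : ℝ → ℝ := fun t => χ (γ t) with hc
  have hγc : Continuous γ := continuous_iff_continuousAt.2 fun t => (hγ t).continuousAt
  have hcc : Continuous c := χ.continuous.comp hγc
  have ha' : ∀ t, HasDerivAt a (c t * fieldA σ α (a t) (β t)) t := fun t => by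
    have := (ContinuousLinearMap.fst ℝ ℂ (ℂ × ℂ)).hasFDerivAt.comp_hasDerivAt t (hγ t)
    exact this.congr_deriv (by simp [Y, X, c, a, β])
  have hβ' : ∀ t, HasDerivAt β (c t * fieldB σ (a t) (β t)) t := fun t => by
    have := ((ContinuousLinearMap.fst ℝ ℂ ℂ).comp
      (ContinuousLinearMap.snd ℝ ℂ (ℂ × ℂ))).hasFDerivAt.comp_hasDerivAt t (hγ t)
    exact this.congr_deriv (by simp [Y, X, c, a, β])
  have hη' : ∀ t, HasDerivAt η (c t * fieldE σ (a t) (β t) (η t)) t := fun t => by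
    have := ((ContinuousLinearMap.snd ℝ ℂ ℂ).comp
      (ContinuousLinearMap.snd ℝ ℂ (ℂ × ℂ))).hasFDerivAt.comp_hasDerivAt t (hγ t)
    exact this.congr_deriv (by simp [Y, X, c, a, β, η])
  have ha0 : a 0 = a₀ := by simp [ha, hγ0]
  have hβ0 : β 0 = β₀ := by simp [hβ, hγ0]
  have hη0 : η 0 = η₀ := by simp [hη, hγ0]
  have hac : Continuous a := continuous_fst.comp hγc
  have hβc : Continuous β := (continuous_fst.comp continuous_snd).comp hγc
  have hβ1 : ∀ t, ‖β t‖ < 1 := by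
    intro t
    have hg : Continuous fun t => -(2 * σ * c t * (a t * conj (β t)).im) := by fun_prop
    have h1 := eq_mul_exp_of_hasDerivAt hg (fun t => hasDerivAt_one_sub_normSq_b (hβ' t)) t
    have h2 : 0 < 1 - ‖β t‖ ^ 2 := by
      rw [h1, hβ0]
      refine mul_pos ?_ (Real.exp_pos _)
      nlinarith [norm_nonneg β₀]
    nlinarith [norm_nonneg (β t)]
  have hη1 : ∀ t, ‖η t‖ = 1 := by
    intro t
    have h1 := eq_const_of_hasDerivAt (fun t => hasDerivAt_normSq_e (hη' t)) t
    rw [hη0, hη₀, one_pow] at h1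
    exact (pow_eq_one_iff_of_nonneg (norm_nonneg _) two_ne_zero).1 h1
  have haR : ∀ t, ‖a t‖ ≤ R := by
    intro t
    have h1 := eq_const_of_hasDerivAt (fun t => hasDerivAt_energy (ha' t) (hβ' t)) t
    rw [ha0, hβ0] at h1
    have h2 : ‖a t‖ ^ 2 + 2 * σ * (a t * conj (β t)).re = J := by rw [hJ]; linarith
    have h3 : -‖a t‖ ≤ (a t * conj (β t)).re := by
      have h4 := Complex.abs_re_le_norm (a t * conj (β t))
      rw [norm_mul, RCLike.norm_conj] at h4
      have := abs_le.1 h4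
      nlinarith [norm_nonneg (a t), hβ1 t]
    by_contra! hlt
    have h5 : J ≤ |J| := le_abs_self J
    have h6 : 0 ≤ |J| := abs_nonneg J
    nlinarith [norm_nonneg (a t)]
  have hc1 : ∀ t, c t = 1 := by
    intro t
    refine χ.one_of_mem_closedBall ?_
    rw [mem_closedBall_zero_iff]
    change ‖γ t‖ ≤ R + 1
    rw [Prod.norm_def, Prod.norm_def]
    refine max_le ((haR t).trans (by linarith)) (max_le ?_ ?_)
    · exact (hβ1 t).le.trans (by linarith)
    · exact (hη1 t).le.trans (by linarith)
  refine ⟨a, β, η, ha0, hβ0, hη0, fun t => ?_, fun t => ?_, fun t => ?_, hβ1, hη1, R, haR⟩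
  · simpa [hc1] using ha' t
  · simpa [hc1] using hβ' t
  · simpa [hc1] using hη' t

section Dynamics

variable {σ α : ℝ} {a β : ℝ → ℂ}

theorem one_sub_normSq_of_resonant (hα : σ ^ 2 < α)
    (ha : ∀ t, HasDerivAt a (fieldA σ α (a t) (β t)) t)
    (hβ : ∀ t, HasDerivAt β (fieldB σ (a t) (β t)) t)
    (h0 : ‖a 0‖ ^ 2 = α) (h1 : a 0 * conj (β 0) = -σ) (t : ℝ) :
    α * (1 - ‖β t‖ ^ 2) =
      (Real.sqrt (α - σ ^ 2) / Real.cosh (σ * Real.sqrt (α - σ ^ 2) * t)) ^ 2 := by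
  have ha' : ∀ t, HasDerivAt a (((fun _ => 1 : ℝ → ℝ) t : ℝ) * fieldA σ α (a t) (β t)) t :=
    fun t => by simpa using ha t
  have hβ' : ∀ t, HasDerivAt β (((fun _ => 1 : ℝ → ℝ) t : ℝ) * fieldB σ (a t) (β t)) t :=
    fun t => by simpa using hβ t
  have hac : Continuous a := continuous_iff_continuousAt.2 fun t => (ha t).continuousAt
  have hβc : Continuous β := continuous_iff_continuousAt.2 fun t => (hβ t).continuousAt
  set κ := Real.sqrt (α - σ ^ 2) with hκ
  have hκ2 : κ ^ 2 = α - σ ^ 2 := Real.sq_sqrt (by linarith)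
  have hκpos : 0 < κ := Real.sqrt_pos.2 (by linarith)
  have hmod : ∀ t, ‖a t‖ ^ 2 - α = 0 := fun t => by
    have hg : Continuous fun t => 2 * σ * (1 : ℝ) * (a t * conj (β t)).im := by fun_prop
    have h2 := eq_mul_exp_of_hasDerivAt (y := fun t => ‖a t‖ ^ 2 - α) hg
      (fun t => hasDerivAt_normSq_a (c := fun _ => 1) (ha' t)) t
    simpa [h0] using h2
  have hw : ∀ t, HasDerivAt (fun t => a t * conj (β t))
      (I * (σ * (α * (1 - ‖β t‖ ^ 2)) : ℝ)) t := fun t => by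
    refine (hasDerivAt_mul_conj (c := fun _ => 1) (ha' t) (hβ' t)).congr_deriv ?_
    have h2 := hmod t
    rw [h2, show ‖a t‖ ^ 2 - α * ‖β t‖ ^ 2 = α * (1 - ‖β t‖ ^ 2) by linarith]
    push_cast; ring
  have hre : ∀ t, (a t * conj (β t)).re = -σ := fun t => by
    have h2 : ∀ t, HasDerivAt (fun t => (a t * conj (β t)).re) 0 t := fun t => by
      refine (hw t).re'.congr_deriv ?_
      rw [Complex.mul_re, Complex.I_re, Complex.ofReal_im]; simp
    rw [eq_const_of_hasDerivAt h2 t, h1]; simp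
  set y : ℝ → ℝ := fun t => (a t * conj (β t)).im with hy
  have hyc : Continuous y := by rw [hy]; fun_prop
  have hE : ∀ t, α * (1 - ‖β t‖ ^ 2) = κ ^ 2 - y t ^ 2 := fun t => by
    have h2 := sq_norm_eq (a t * conj (β t))
    rw [norm_mul, RCLike.norm_conj, hre, mul_pow] at h2
    have h3 := hmod t
    have h4 : ‖a t‖ ^ 2 = α := by linarith
    rw [h4] at h2
    rw [hκ2]
    linarith
  have hy' : ∀ t, HasDerivAt y (σ * (κ ^ 2 - y t ^ 2)) t := fun t => by
    refine (hw t).im'.congr_deriv ?_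
    rw [hE]
    simp only [Complex.mul_im, Complex.I_re, Complex.ofReal_im, Complex.I_im, Complex.ofReal_re]
    ring
  have hy0 : y 0 = 0 := by rw [hy]; dsimp only; rw [h1]; simp
  have hl : ∀ t : ℝ, HasDerivAt (fun t : ℝ => σ * κ * t) (σ * κ) t := fun t => by
    simpa using (hasDerivAt_id t).const_mul (σ * κ)
  have hg : Continuous fun t => -σ * y t := by fun_prop
  have hf : ∀ t, HasDerivAt (fun t => (κ - y t) * Real.exp (σ * κ * t))
      (-σ * y t * ((κ - y t) * Real.exp (σ * κ * t))) t := fun t => by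
    refine (((hy' t).const_sub κ).mul (hl t).exp).congr_deriv ?_
    ring
  have hk : ∀ t, HasDerivAt (fun t => (κ + y t) * Real.exp (-(σ * κ * t)))
      (-σ * y t * ((κ + y t) * Real.exp (-(σ * κ * t)))) t := fun t => by
    refine (((hy' t).const_add κ).mul (hl t).fun_neg.exp).congr_deriv ?_
    ring
  have e1 := eq_mul_exp_of_hasDerivAt hg hf t
  have e2 := eq_mul_exp_of_hasDerivAt hg hk t
  simp only [hy0, mul_zero, Real.exp_zero, neg_zero, sub_zero, add_zero, mul_one] at e1 e2
  set F := κ * Real.exp (∫ s in (0 : ℝ)..t, -σ * y s) with hF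
  set x := σ * κ * t with hx
  have hp : Real.exp x * Real.exp (-x) = 1 := by rw [← Real.exp_add]; simp
  have hF1 : κ - y t = F * Real.exp (-x) := by
    rw [← e1, mul_assoc, hp, mul_one]
  have hF2 : κ + y t = F * Real.exp x := by
    rw [← e2, mul_assoc, mul_comm (Real.exp (-x)), hp, mul_one]
  have hcosh : κ / Real.cosh x = F := by
    rw [div_eq_iff (Real.cosh_pos x).ne', Real.cosh_eq]
    linarith
  rw [hE, hcosh]
  calc κ ^ 2 - y t ^ 2 = (κ - y t) * (κ + y t) := by ring
    _ = F ^ 2 * (Real.exp x * Real.exp (-x)) := by rw [hF1, hF2]; ring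
    _ = F ^ 2 := by rw [hp, mul_one]

theorem exists_exp_bounds_of_resonant (hσ : 0 < σ) (hα : σ ^ 2 < α)
    (ha : ∀ t, HasDerivAt a (fieldA σ α (a t) (β t)) t)
    (hβ : ∀ t, HasDerivAt β (fieldB σ (a t) (β t)) t)
    (h0 : ‖a 0‖ ^ 2 = α) (h1 : a 0 * conj (β 0) = -σ) :
    ∃ κ c C : ℝ, 0 < κ ∧ 0 < c ∧ 0 < C ∧ ∀ t, c * Real.exp (-(2 * κ * |t|)) ≤ 1 - ‖β t‖ ^ 2 ∧
      1 - ‖β t‖ ^ 2 ≤ C * Real.exp (-(2 * κ * |t|)) := by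
  set κ := Real.sqrt (α - σ ^ 2) with hκ
  have hκ2 : κ ^ 2 = α - σ ^ 2 := Real.sq_sqrt (by linarith)
  have hκpos : 0 < κ := Real.sqrt_pos.2 (by linarith)
  have hαpos : 0 < α := by nlinarith
  refine ⟨σ * κ, κ ^ 2 / α, 4 * κ ^ 2 / α, by positivity, by positivity, by positivity,
    fun t => ?_⟩
  have hE := one_sub_normSq_of_resonant hα ha hβ h0 h1 t
  rw [← hκ] at hE
  set z := σ * κ * |t| with hz
  have hz0 : 0 ≤ z := by positivity
  have hcosh : Real.cosh (σ * κ * t) = Real.cosh z := by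
    rw [← Real.cosh_abs, abs_mul, abs_of_pos (by positivity : 0 < σ * κ)]
  have hexp : Real.exp (-(2 * (σ * κ) * |t|)) = (Real.exp z ^ 2)⁻¹ := by
    rw [← Real.exp_nat_mul, ← Real.exp_neg]; congr 1; rw [hz]; push_cast; ring
  have hup : Real.cosh z ≤ Real.exp z := by
    rw [Real.cosh_eq]
    have : Real.exp (-z) ≤ Real.exp z := Real.exp_le_exp.2 (by linarith)
    linarith
  have hlo : Real.exp z / 2 ≤ Real.cosh z := by
    rw [Real.cosh_eq]
    have := Real.exp_pos (-z)
    linarith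
  have hval : 1 - ‖β t‖ ^ 2 = κ ^ 2 / α * (Real.cosh z ^ 2)⁻¹ := by
    have h2 : 1 - ‖β t‖ ^ 2 = (κ / Real.cosh z) ^ 2 / α := by
      rw [← hcosh, ← hE]; field_simp
    rw [h2, div_pow]; field_simp
  have hez := Real.exp_pos z
  have hcz := Real.cosh_pos z
  rw [hval, hexp]
  constructor
  · gcongr
  · rw [show 4 * κ ^ 2 / α * (Real.exp z ^ 2)⁻¹ = κ ^ 2 / α * ((Real.exp z / 2) ^ 2)⁻¹ by
      field_simp; ring]
    gcongr

theorem exists_lower_bound_of_nonresonant (hα : 0 < α)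
    (ha : ∀ t, HasDerivAt a (fieldA σ α (a t) (β t)) t)
    (hβ : ∀ t, HasDerivAt β (fieldB σ (a t) (β t)) t)
    (h0 : ‖a 0‖ ^ 2 ≠ α) (hβ1 : ∀ t, ‖β t‖ < 1) {A : ℝ} (hA : ∀ t, ‖a t‖ ≤ A) :
    ∃ c : ℝ, 0 < c ∧ ∀ t, c ≤ 1 - ‖β t‖ ^ 2 := by
  have ha' : ∀ t, HasDerivAt a (((fun _ => 1 : ℝ → ℝ) t : ℝ) * fieldA σ α (a t) (β t)) t :=
    fun t => by simpa using ha t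
  have hβ' : ∀ t, HasDerivAt β (((fun _ => 1 : ℝ → ℝ) t : ℝ) * fieldB σ (a t) (β t)) t :=
    fun t => by simpa using hβ t
  have hpos : ∀ t, 0 < 1 - ‖β t‖ ^ 2 := fun t => by nlinarith [norm_nonneg (β t), hβ1 t]
  have hconst : ∀ t, (‖a t‖ ^ 2 - α) * (1 - ‖β t‖ ^ 2) =
      (‖a 0‖ ^ 2 - α) * (1 - ‖β 0‖ ^ 2) := by
    refine eq_const_of_hasDerivAt fun t => ?_
    refine ((hasDerivAt_normSq_a (c := fun _ => 1) (ha' t)).mul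
      (hasDerivAt_one_sub_normSq_b (c := fun _ => 1) (hβ' t))).congr_deriv ?_
    ring
  set l := |(‖a 0‖ ^ 2 - α) * (1 - ‖β 0‖ ^ 2)| with hl
  have hlpos : 0 < l := abs_pos.2 (mul_ne_zero (sub_ne_zero.2 h0) (hpos 0).ne')
  have hA0 : 0 ≤ A := (norm_nonneg _).trans (hA 0)
  refine ⟨l / (A ^ 2 + α), by positivity, fun t => ?_⟩
  rw [div_le_iff₀ (by positivity), hl, ← hconst t, abs_mul, abs_of_pos (hpos t), mul_comm]
  refine mul_le_mul_of_nonneg_left ?_ (hpos t).le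
  have h2 : ‖a t‖ ^ 2 ≤ A ^ 2 := by gcongr; exact hA t
  rw [abs_le]
  constructor <;> nlinarith [sq_nonneg ‖a t‖]

end Dynamics

/-- Continuous complex-valued functions on the circle. -/
abbrev CircleFun : Type := C(UnitAddCircle, ℂ)

/-- The `n`-th Fourier coefficient as a continuous linear functional. -/
def coeffL (n : ℤ) : CircleFun →L[ℂ] ℂ :=
  (innerSL ℂ (fourierLp 2 n)).comp (ContinuousMap.toLp 2 AddCircle.haarAddCircle ℂ)

theorem coeffL_apply (n : ℤ) (f : CircleFun) : coeffL n f = fourierCoeff f n := by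
  rw [← fourierCoeff_toLp, ← fourierBasis_repr, HilbertBasis.repr_apply_apply, coe_fourierBasis]
  rfl

theorem coeffL_fourier (n k : ℤ) : coeffL n (fourier k) = if k = n then 1 else 0 := by
  rw [coeffL_apply, fourierCoeff_fourier, Pi.single_apply]
  simp [eq_comm]

theorem coeffL_one (n : ℤ) : coeffL n 1 = if n = 0 then 1 else 0 := by
  rw [show (1 : CircleFun) = fourier 0 by ext; simp, coeffL_fourier]
  simp [eq_comm]

theorem hasSum_normSq_coeffL (f : CircleFun) :
    HasSum (fun n => ‖coeffL n f‖ ^ 2) (∫ x : UnitAddCircle, ‖f x‖ ^ 2 ∂AddCircle.haarAddCircle) := by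
  have h := hasSum_sq_fourierCoeff (ContinuousMap.toLp 2 AddCircle.haarAddCircle ℂ f)
  simp only [fourierCoeff_toLp, ← coeffL_apply] at h
  convert h using 1
  refine MeasureTheory.integral_congr_ae ?_
  filter_upwards [ContinuousMap.coeFn_toLp (p := 2) (𝕜 := ℂ) AddCircle.haarAddCircle f] with x hx
  rw [hx]

theorem coeffL_zero_eq_integral (f : CircleFun) :
    coeffL 0 f = ∫ x : UnitAddCircle, f x ∂AddCircle.haarAddCircle := by
  rw [coeffL_apply, fourierCoeff]; simp

theorem coeffL_star (n : ℤ) (f : CircleFun) : coeffL n (star f) = conj (coeffL (-n) f) := by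
  rw [coeffL_apply, coeffL_apply, fourierCoeff, fourierCoeff, ← integral_conj]
  congr 1
  ext x
  simp

theorem eq_of_coeffL_eq {f g : CircleFun} (h : ∀ n, coeffL n f = coeffL n g) : f = g := by
  have h0 : fourierCoeff (f - g : CircleFun) = 0 := funext fun n => by
    rw [← coeffL_apply, map_sub, h, sub_self, Pi.zero_apply]
  have hs : Summable (fourierCoeff (f - g : CircleFun)) := by rw [h0]; exact summable_zero
  have h1 := hasSum_fourier_series_of_summable hs
  have h2 : (fun i => fourierCoeff (f - g : CircleFun) i • (fourier i : CircleFun)) =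
      fun _ => 0 := funext fun i => by rw [h0]; exact zero_smul ℂ (fourier i : CircleFun)
  rw [h2] at h1
  exact sub_eq_zero.1 (h1.unique hasSum_zero)

/-- The disc algebra, as the closure of the polynomials in `z`. -/
def discAlg : Subalgebra ℂ CircleFun := (Algebra.adjoin ℂ {fourier 1}).topologicalClosure

theorem isClosed_discAlg : IsClosed (discAlg : Set CircleFun) :=
  Subalgebra.isClosed_topologicalClosure _

theorem fourier_one_pow (n : ℕ) : (fourier 1 : CircleFun) ^ n = fourier n := by
  ext x
  simp [fourier_apply, AddCircle.toCircle_nsmul]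

theorem fourier_natCast_mem (n : ℕ) : (fourier n : CircleFun) ∈ discAlg := by
  rw [← fourier_one_pow]
  have h : (fourier 1 : CircleFun) ∈ Algebra.adjoin ℂ {(fourier 1 : CircleFun)} :=
    Algebra.subset_adjoin (Set.mem_singleton _)
  exact Subalgebra.le_topologicalClosure _ (pow_mem h n)

theorem coeffL_aeval (p : Polynomial ℂ) (n : ℤ) :
    coeffL n (Polynomial.aeval (fourier 1 : CircleFun) p) =
      if 0 ≤ n then p.coeff n.toNat else 0 := by
  induction p using Polynomial.induction_on' with
  | add p q hp hq => rw [map_add, map_add, hp, hq]; split_ifs <;> simp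
  | monomial k c =>
    rw [Polynomial.aeval_monomial, fourier_one_pow, ← Algebra.smul_def, map_smul, coeffL_fourier,
      Polynomial.coeff_monomial]
    by_cases hn : 0 ≤ n
    · obtain ⟨m, rfl⟩ := Int.eq_ofNat_of_zero_le hn
      simp
    · rw [if_neg hn, if_neg (by omega)]; simp

theorem exists_aeval_seq {f : CircleFun} (hf : f ∈ discAlg) :
    ∃ p : ℕ → Polynomial ℂ,
      Tendsto (fun n => Polynomial.aeval (fourier 1 : CircleFun) (p n)) atTop (𝓝 f) := by
  have h1 : f ∈ closure ((Algebra.adjoin ℂ {(fourier 1 : CircleFun)} : Subalgebra ℂ CircleFun) :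
      Set CircleFun) := hf
  obtain ⟨x, hx, hxf⟩ := mem_closure_iff_seq_limit.1 h1
  have h2 : ∀ n, ∃ p : Polynomial ℂ, Polynomial.aeval (fourier 1 : CircleFun) p = x n := fun n => by
    have := hx n
    rw [SetLike.mem_coe, Algebra.adjoin_singleton_eq_range_aeval] at this
    exact this
  choose p hp using h2
  exact ⟨p, by simpa only [hp] using hxf⟩

theorem coeffL_of_neg {f : CircleFun} (hf : f ∈ discAlg) {n : ℤ} (hn : n < 0) :
    coeffL n f = 0 := by
  obtain ⟨p, hp⟩ := exists_aeval_seq hf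
  refine tendsto_nhds_unique (((coeffL n).continuous.tendsto f).comp hp) ?_
  refine tendsto_const_nhds.congr fun k => ?_
  rw [Function.comp, coeffL_aeval, if_neg (by omega)]

theorem coeffL_zero_mul {f g : CircleFun} (hf : f ∈ discAlg) (hg : g ∈ discAlg) :
    coeffL 0 (f * g) = coeffL 0 f * coeffL 0 g := by
  obtain ⟨p, hp⟩ := exists_aeval_seq hf
  obtain ⟨q, hq⟩ := exists_aeval_seq hg
  refine tendsto_nhds_unique (((coeffL 0).continuous.tendsto _).comp (hp.mul hq)) ?_
  refine ((((coeffL 0).continuous.tendsto f).comp hp).mul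
    (((coeffL 0).continuous.tendsto g).comp hq)).congr fun k => ?_
  simp only [Function.comp, ← map_mul, coeffL_aeval]
  simp [Polynomial.mul_coeff_zero]

theorem inverse_mem_discAlg {h : CircleFun} (hh : h ∈ discAlg) (h1 : ‖h‖ < 1) :
    ∃ R ∈ discAlg, R * (1 - h) = 1 ∧ Ring.inverse (1 - h) = R := by
  refine ⟨∑' n : ℕ, h ^ n, ?_, geom_series_mul_neg h h1, ?_⟩
  · refine isClosed_discAlg.mem_of_tendsto
      (summable_geometric_of_norm_lt_one h1).hasSum (Eventually.of_forall fun s => ?_)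
    exact sum_mem fun i _ => pow_mem hh i
  · exact NormedRing.inverse_one_sub _ h1

theorem coeffL_mul_fourier (f : CircleFun) (n k : ℤ) :
    coeffL n (f * fourier k) = coeffL (n - k) f := by
  rw [coeffL_apply, coeffL_apply, fourierCoeff, fourierCoeff]
  congr 1
  ext x
  rw [show -(n - k) = -n + k by ring, fourier_add, ContinuousMap.mul_apply, smul_eq_mul,
    smul_eq_mul]
  ring

/-- The continuous function on the circle with absolutely summable coefficients `u`. -/
def fourierSum (u : ℕ → ℂ) : CircleFun := ∑' n : ℕ, u n • (fourier (n : ℤ) : CircleFun)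

section FourierSum

variable {u : ℕ → ℂ}

theorem summable_norm_smul_fourier (su : Summable fun n => ‖u n‖) :
    Summable fun n : ℕ => ‖u n • (fourier (n : ℤ) : CircleFun)‖ := by
  simpa only [norm_smul, fourier_norm, mul_one] using su

theorem hasSum_fourierSum (su : Summable fun n => ‖u n‖) :
    HasSum (fun n : ℕ => u n • (fourier (n : ℤ) : CircleFun)) (fourierSum u) :=
  (summable_norm_smul_fourier su).of_norm.hasSum

theorem fourierSum_mem (su : Summable fun n => ‖u n‖) : fourierSum u ∈ discAlg :=
  isClosed_discAlg.mem_of_tendsto (hasSum_fourierSum su) (Eventually.of_forall fun _ =>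
    sum_mem fun i _ => Subalgebra.smul_mem _ (fourier_natCast_mem i) _)

theorem coeffL_fourierSum (su : Summable fun n => ‖u n‖) (n : ℕ) :
    coeffL n (fourierSum u) = u n := by
  have h := (coeffL n).hasSum (hasSum_fourierSum su)
  refine h.unique ?_
  convert hasSum_ite_eq n (u n) using 2 with k
  simp only [map_smul, coeffL_fourier, Nat.cast_inj, smul_eq_mul, mul_ite, mul_one,
    mul_zero]
  split_ifs with hk <;> simp [hk]

theorem hasSum_star_fourierSum (su : Summable fun n => ‖u n‖) :
    HasSum (fun n : ℕ => conj (u n) • (fourier (-(n : ℤ)) : CircleFun)) (star (fourierSum u)) := by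
  convert (hasSum_fourierSum su).star using 2 with n
  ext x
  rw [ContinuousMap.smul_apply, ContinuousMap.star_apply, ContinuousMap.smul_apply, fourier_neg,
    smul_eq_mul, smul_eq_mul, RCLike.star_def, map_mul]

theorem coeffL_mul_star_fourierSum (su : Summable fun n => ‖u n‖) (k : ℕ) :
    coeffL k (fourierSum u * star (fourierSum u)) = hankel u u k := by
  have h := (coeffL k).hasSum ((hasSum_star_fourierSum su).mul_left (fourierSum u))
  refine (h.tsum_eq.symm).trans (tsum_congr fun l => ?_)
  rw [mul_smul_comm, map_smul, coeffL_mul_fourier, sub_neg_eq_add, ← Nat.cast_add,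
    coeffL_fourierSum su, smul_eq_mul, mul_comm]

theorem coeffL_cubic (su : Summable fun n => ‖u n‖) (n : ℕ) :
    coeffL n (fourierSum u * (star (fourierSum u) * fourierSum u)) = cubic u n := by
  have s1 := summable_norm_smul_fourier su
  have s2 : Summable fun n : ℕ => ‖conj (u n) • (fourier (-(n : ℤ)) : CircleFun)‖ := by
    simpa only [norm_smul, fourier_norm, mul_one, RCLike.norm_conj] using su
  have s3 := s2.mul_norm s1
  have h3 := (hasSum_star_fourierSum su).mul (hasSum_fourierSum su) s3.of_norm
  have h4 := (hasSum_fourierSum su).mul h3 (s1.mul_norm s3).of_norm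
  refine ((coeffL n).hasSum h4).tsum_eq.symm.trans (tsum_congr fun q => ?_)
  have h5 : (u q.1 • (fourier (q.1 : ℤ) : CircleFun)) * ((conj (u q.2.1) •
      (fourier (-(q.2.1 : ℤ)) : CircleFun)) * (u q.2.2 • (fourier (q.2.2 : ℤ) : CircleFun))) =
      (u q.1 * conj (u q.2.1) * u q.2.2) • (fourier ((q.1 : ℤ) + (-q.2.1 + q.2.2))) := by
    ext x
    simp only [ContinuousMap.mul_apply, ContinuousMap.smul_apply, smul_eq_mul, fourier_add]
    ring
  rw [h5, map_smul, coeffL_fourier, smul_eq_mul, mul_ite, mul_one, mul_zero]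
  exact if_congr (by omega) rfl rfl

end FourierSum

theorem eq_fourierSum {f : CircleFun} (hf : f ∈ discAlg)
    (sf : Summable fun n : ℕ => ‖coeffL n f‖) : f = fourierSum fun n => coeffL n f := by
  refine eq_of_coeffL_eq fun n => ?_
  rcases lt_or_ge n 0 with hn | hn
  · rw [coeffL_of_neg hf hn, coeffL_of_neg (fourierSum_mem sf) hn]
  · obtain ⟨m, rfl⟩ := Int.eq_ofNat_of_zero_le hn
    rw [coeffL_fourierSum sf]

theorem hasSum_normSq_coeffL_nat {f : CircleFun} (hf : ∀ n < 0, coeffL n f = 0) :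
    HasSum (fun n : ℕ => ‖coeffL n f‖ ^ 2)
      (∫ x : UnitAddCircle, ‖f x‖ ^ 2 ∂AddCircle.haarAddCircle) := by
  refine (Nat.cast_injective.hasSum_iff fun n hn => ?_).2 (hasSum_normSq_coeffL f)
  rw [hf, norm_zero, zero_pow two_ne_zero]
  by_contra! h
  exact hn ⟨n.toNat, by simpa using h⟩

/-- Smoothness of a function on the circle, through its periodic lift. -/
def IsSmoothFun (f : CircleFun) : Prop :=
  ContDiff ℝ (⊤ : ℕ∞) fun x : ℝ => f (x : UnitAddCircle)

theorem exists_derivFun {f : CircleFun} (hf : IsSmoothFun f) :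
    ∃ f' : CircleFun, (∀ x : ℝ, f' (x : UnitAddCircle) = deriv (fun x : ℝ => f x) x) ∧
      IsSmoothFun f' ∧ ∀ n : ℤ, coeffL n f' = (2 * Real.pi * I * n) * coeffL n f := by
  set F : ℝ → ℂ := fun x => f (x : UnitAddCircle) with hF
  obtain ⟨hd, hs⟩ := contDiff_infty_iff_deriv.1 hf
  have hper : Function.Periodic (deriv F) 1 := fun x => by
    rw [← deriv_comp_add_const]
    congr 1
    ext y
    simp [hF]
  have hcont : Continuous (hper.lift : UnitAddCircle → ℂ) :=
    continuous_coinduced_dom.2 hs.continuous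
  refine ⟨⟨hper.lift, hcont⟩, fun x => hper.lift_coe x, hs, fun n => ?_⟩
  rw [coeffL_apply, coeffL_apply, fourierCoeff_eq_intervalIntegral _ _ 0,
    fourierCoeff_eq_intervalIntegral _ _ 0]
  have hfc : Continuous fun x : ℝ => (fourier (-n) (x : UnitAddCircle) : ℂ) :=
    (map_continuous _).comp (AddCircle.continuous_mk' 1)
  have hder : ∀ x : ℝ, HasDerivAt (fun x : ℝ => fourier (-n) (x : UnitAddCircle) * F x)
      (-2 * Real.pi * I * n * (fourier (-n) (x : UnitAddCircle) * F x) +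
        fourier (-n) (x : UnitAddCircle) * deriv F x) x := fun x => by
    refine ((hasDerivAt_fourier_neg 1 n x).mul (hd x).hasDerivAt).congr_deriv ?_
    push_cast; ring
  have hi1 : Continuous fun x : ℝ =>
      -2 * Real.pi * I * n * (fourier (-n) (x : UnitAddCircle) * F x) := by
    have := hd.continuous
    fun_prop
  have hi2 : Continuous fun x : ℝ => fourier (-n) (x : UnitAddCircle) * deriv F x := by
    have := hs.continuous
    fun_prop
  have h := intervalIntegral.integral_eq_sub_of_hasDerivAt (a := 0) (b := 0 + 1)
    (fun x _ => hder x) ((hi1.add hi2).intervalIntegrable _ _)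
  rw [intervalIntegral.integral_add (hi1.intervalIntegrable _ _) (hi2.intervalIntegrable _ _),
    intervalIntegral.integral_const_mul] at h
  have h0 : fourier (-n) (((0 : ℝ) + 1 : ℝ) : UnitAddCircle) * F (0 + 1) -
      fourier (-n) ((0 : ℝ) : UnitAddCircle) * F 0 = 0 := by
    have : (((0 : ℝ) + 1 : ℝ) : UnitAddCircle) = ((0 : ℝ) : UnitAddCircle) := by simp
    simp only [hF, this, sub_self]
  rw [h0] at h
  simp only [smul_eq_mul, ContinuousMap.coe_mk, Function.Periodic.lift_coe]
  simp only [one_div, inv_one, one_smul]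
  linear_combination h

theorem exists_iteratedDerivFun {f : CircleFun} (hf : IsSmoothFun f) (m : ℕ) :
    ∃ f' : CircleFun, (∀ x : ℝ, f' (x : UnitAddCircle) = iteratedDeriv m (fun x : ℝ => f x) x) ∧
      IsSmoothFun f' ∧ ∀ n : ℤ, coeffL n f' = (2 * Real.pi * I * n) ^ m * coeffL n f := by
  induction m with
  | zero => exact ⟨f, by simp, hf, by simp⟩
  | succ m ih =>
    obtain ⟨g, hg, hgs, hgc⟩ := ih
    obtain ⟨h, hh, hhs, hhc⟩ := exists_derivFun hgs
    refine ⟨h, fun x => ?_, hhs, fun n => by rw [hhc, hgc, pow_succ]; ring⟩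
    rw [hh, iteratedDeriv_succ]
    congr 1
    exact funext hg

theorem exists_iteratedDeriv_bound {G : ℝ → ℂ} (hG : ContDiff ℝ (⊤ : ℕ∞) G)
    (hG1 : ∀ x, ‖G x‖ = 1) (hb : ∀ m, ∃ M, ∀ x, ‖iteratedDeriv m G x‖ ≤ M) (m : ℕ) :
    ∃ C, 0 ≤ C ∧ ∀ i ≤ m, ∀ c : ℂ, ‖c‖ < 1 → ∀ x,
      ‖iteratedDeriv i (fun x => G x / (1 + c * G x)) x‖ * ‖1 + c * G x‖ ^ (i + 1) ≤ C := by
  choose M hM using hb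
  induction m with
  | zero =>
    refine ⟨1, zero_le_one, fun i hi c hc x => ?_⟩
    obtain rfl : i = 0 := by omega
    have hne : 1 + c * G x ≠ 0 := fun h => by
      have h1 : ‖c * G x‖ = 1 := by
        rw [show c * G x = -1 by linear_combination h]; simp
      rw [norm_mul, hG1] at h1; linarith
    rw [iteratedDeriv_zero, norm_div, hG1]
    simp [hne]
  | succ m ih =>
    obtain ⟨C, hC, h⟩ := ih
    have hM0 : ∀ j, 0 ≤ M j := fun j => (norm_nonneg _).trans (hM j 0)
    refine ⟨C + (M (m + 1) * 2 ^ (m + 1) +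
      ∑ i ∈ Finset.range (m + 1), ((m + 1).choose i : ℝ) * C * M (m + 1 - i) * 2 ^ (m - i)),
      ?_, fun i hi c hc x => ?_⟩
    · have : 0 ≤ ∑ i ∈ Finset.range (m + 1),
          ((m + 1).choose i : ℝ) * C * M (m + 1 - i) * 2 ^ (m - i) :=
        Finset.sum_nonneg fun i _ => by have := hM0 (m + 1 - i); positivity
      have := hM0 (m + 1)
      positivity
    have hnn : 0 ≤ M (m + 1) * 2 ^ (m + 1) +
      ∑ i ∈ Finset.range (m + 1), ((m + 1).choose i : ℝ) * C * M (m + 1 - i) * 2 ^ (m - i) := by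
      have : 0 ≤ ∑ i ∈ Finset.range (m + 1),
          ((m + 1).choose i : ℝ) * C * M (m + 1 - i) * 2 ^ (m - i) :=
        Finset.sum_nonneg fun i _ => by have := hM0 (m + 1 - i); positivity
      have := hM0 (m + 1)
      positivity
    rcases Nat.le_succ_iff.1 hi with hi | rfl
    · exact (h i hi c hc x).trans (by linarith)
    have hne : ∀ x, 1 + c * G x ≠ 0 := fun x h => by
      have h1 : ‖c * G x‖ = 1 := by
        rw [show c * G x = -1 by linear_combination h]; simp
      rw [norm_mul, hG1] at h1; linarith
    have hQ : ContDiff ℝ (⊤ : ℕ∞) fun x => 1 + c * G x := contDiff_const.add (contDiff_const.mul hG)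
    have hF : ContDiff ℝ (⊤ : ℕ∞) fun x => G x / (1 + c * G x) := by
      simp only [div_eq_mul_inv]
      exact hG.mul (hQ.inv hne)
    have hL : iteratedDeriv (m + 1) G x = ∑ i ∈ Finset.range (m + 2), ((m + 1).choose i : ℂ) *
        iteratedDeriv i (fun x => G x / (1 + c * G x)) x *
          iteratedDeriv (m + 1 - i) (fun x => 1 + c * G x) x := by
      rw [← iteratedDeriv_fun_mul (hF.of_le (by exact_mod_cast le_top)).contDiffAt
        (hQ.of_le (by exact_mod_cast le_top)).contDiffAt]
      congr 1
      ext y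
      rw [div_mul_cancel₀ _ (hne y)]
    rw [Finset.sum_range_succ, Nat.choose_self, Nat.cast_one, one_mul, Nat.sub_self,
      iteratedDeriv_zero] at hL
    set q := ‖1 + c * G x‖ with hq
    have hq0 : 0 ≤ q := norm_nonneg _
    have hq2 : q ≤ 2 := by
      refine (norm_add_le _ _).trans ?_
      rw [norm_mul, hG1, norm_one]; linarith
    have hterm : ∀ i ∈ Finset.range (m + 1), ‖((m + 1).choose i : ℂ) *
        iteratedDeriv i (fun x => G x / (1 + c * G x)) x *
          iteratedDeriv (m + 1 - i) (fun x => 1 + c * G x) x‖ * q ^ (m + 1) ≤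
        ((m + 1).choose i : ℝ) * C * M (m + 1 - i) * 2 ^ (m - i) := fun i hi => by
      have him : i ≤ m := Nat.lt_succ_iff.1 (Finset.mem_range.1 hi)
      have h1 : ‖iteratedDeriv (m + 1 - i) (fun x => 1 + c * G x) x‖ ≤ M (m + 1 - i) := by
        rw [iteratedDeriv_const_add (by omega), iteratedDeriv_const_mul_field, norm_mul]
        have := hM (m + 1 - i) x
        nlinarith [norm_nonneg c, norm_nonneg (iteratedDeriv (m + 1 - i) G x)]
      rw [norm_mul, norm_mul, Complex.norm_natCast,
        show q ^ (m + 1) = q ^ (i + 1) * q ^ (m - i) by rw [← pow_add]; congr 1; omega]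
      have h2 := h i him c hc x
      have h3 : q ^ (m - i) ≤ 2 ^ (m - i) := pow_le_pow_left₀ hq0 hq2 _
      calc _ = ((m + 1).choose i : ℝ) * (‖iteratedDeriv i (fun x => G x / (1 + c * G x)) x‖ *
            q ^ (i + 1)) * ‖iteratedDeriv (m + 1 - i) (fun x => 1 + c * G x) x‖ *
            q ^ (m - i) := by ring
        _ ≤ _ := by
          have := hM0 (m + 1 - i)
          gcongr
    have hsum : ‖iteratedDeriv (m + 1) (fun x => G x / (1 + c * G x)) x‖ * q ≤
        ‖iteratedDeriv (m + 1) G x‖ + ∑ i ∈ Finset.range (m + 1), ‖((m + 1).choose i : ℂ) *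
        iteratedDeriv i (fun x => G x / (1 + c * G x)) x *
          iteratedDeriv (m + 1 - i) (fun x => 1 + c * G x) x‖ := by
      rw [hq, ← norm_mul, ← sub_eq_of_eq_add' hL]
      exact (norm_sub_le _ _).trans (add_le_add_right (norm_sum_le _ _) _)
    have h5 := Finset.sum_le_sum hterm
    rw [← Finset.sum_mul] at h5
    have h6 : ‖iteratedDeriv (m + 1) G x‖ * q ^ (m + 1) ≤ M (m + 1) * 2 ^ (m + 1) := by
      gcongr
      · exact hM0 _
      · exact hM _ _
    have h7 := mul_le_mul_of_nonneg_right hsum (pow_nonneg hq0 (m + 1))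
    rw [add_mul] at h7
    calc _ = ‖iteratedDeriv (m + 1) (fun x => G x / (1 + c * G x)) x‖ * q * q ^ (m + 1) := by
          rw [Nat.succ_eq_add_one, mul_assoc, ← pow_succ']
      _ ≤ _ := by linarith

theorem forall_circle {P : UnitAddCircle → Prop} (h : ∀ x : ℝ, P (x : UnitAddCircle)) (x) : P x :=
  QuotientAddGroup.induction_on x h

section Inner

variable {g : CircleFun}

theorem norm_mul_lt_one (hg1 : ∀ x, ‖g x‖ = 1) {c : ℂ} (hc : ‖c‖ < 1) : ‖-(c • g)‖ < 1 := by
  rw [norm_neg, norm_smul]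
  have : ‖g‖ ≤ 1 := (ContinuousMap.norm_le _ zero_le_one).2 fun x => (hg1 x).le
  nlinarith [norm_nonneg c, norm_nonneg g]

theorem exists_inverse (hg : g ∈ discAlg) (hg1 : ∀ x, ‖g x‖ = 1) {c : ℂ}
    (hc : ‖c‖ < 1) : ∃ R ∈ discAlg, R * (1 + c • g) = 1 ∧ Ring.inverse (1 + c • g) = R := by
  have h := inverse_mem_discAlg (neg_mem (Subalgebra.smul_mem _ hg c)) (norm_mul_lt_one hg1 hc)
  simpa only [sub_neg_eq_add] using h

theorem coeffL_zero_inverse (hg : g ∈ discAlg) (hg0 : coeffL 0 g = 0) {c : ℂ} {R : CircleFun}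
    (hR : R ∈ discAlg) (hRg : R * (1 + c • g) = 1) : coeffL 0 R = 1 := by
  have h1 := congrArg (coeffL 0) hRg
  rw [coeffL_zero_mul hR (add_mem (one_mem _) (Subalgebra.smul_mem _ hg c)), map_add, map_smul,
    hg0, coeffL_one] at h1
  simpa using h1

theorem integral_normSq_inverse (hg : g ∈ discAlg) (hg1 : ∀ x, ‖g x‖ = 1)
    (hg0 : coeffL 0 g = 0) {c : ℂ} {R : CircleFun} (hR : R ∈ discAlg)
    (hRg : R * (1 + c • g) = 1) :
    (1 - ‖c‖ ^ 2) * ∫ x : UnitAddCircle, ‖R x‖ ^ 2 ∂AddCircle.haarAddCircle = 1 := by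
  have h0 := coeffL_zero_inverse hg hg0 hR hRg
  have hpt : ∀ x, (1 - ‖c‖ ^ 2) * ‖R x‖ ^ 2 = 2 * (R x).re - 1 := fun x => by
    have h1 : R x * (1 + c * g x) = 1 := by
      have := congrArg (fun f : CircleFun => f x) hRg
      simpa using this
    have h2 : g x * conj (g x) = 1 := by
      rw [Complex.mul_conj, Complex.normSq_eq_norm_sq, hg1]; simp
    have h3 : conj (R x) * (1 + conj c * conj (g x)) = 1 := by
      simpa using congrArg conj h1
    have h4 : (R x) + conj (R x) = ((2 * (R x).re : ℝ) : ℂ) := Complex.add_conj _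
    have h5 : ((‖c‖ ^ 2 : ℝ) : ℂ) = c * conj c := by
      rw [Complex.mul_conj, Complex.normSq_eq_norm_sq]
    have h6 : ((‖R x‖ ^ 2 : ℝ) : ℂ) = R x * conj (R x) := by
      rw [Complex.mul_conj, Complex.normSq_eq_norm_sq]
    apply Complex.ofReal_injective
    rw [Complex.ofReal_mul, Complex.ofReal_sub, Complex.ofReal_sub, ← h4, h5, h6,
      Complex.ofReal_one]
    linear_combination (R x - R x * (1 + c * g x)) * h3 + (conj (R x) - 1) * h1 +
      R x * conj (R x) * c * conj c * h2
  rw [← MeasureTheory.integral_const_mul]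
  simp only [hpt]
  have hi : MeasureTheory.Integrable (fun x => R x)
      (AddCircle.haarAddCircle : MeasureTheory.Measure UnitAddCircle) :=
    R.continuous.integrable_of_hasCompactSupport (HasCompactSupport.of_compactSpace _)
  have hi' : MeasureTheory.Integrable (fun x => (R x).re)
      (AddCircle.haarAddCircle : MeasureTheory.Measure UnitAddCircle) := hi.re
  rw [MeasureTheory.integral_sub (hi'.const_mul 2) (MeasureTheory.integrable_const _),
    MeasureTheory.integral_const_mul]
  have h7 : ∫ x : UnitAddCircle, (R x).re ∂AddCircle.haarAddCircle = 1 := by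
    have h8 := integral_re hi
    rw [← coeffL_zero_eq_integral, h0] at h8
    simpa using h8
  rw [h7]
  simp; norm_num

theorem exists_moment_bound (hg : g ∈ discAlg) (hg1 : ∀ x, ‖g x‖ = 1)
    (hg0 : coeffL 0 g = 0) (hgs : IsSmoothFun g) (m : ℕ) :
    ∃ C, 0 ≤ C ∧ ∀ c : ℂ, ‖c‖ < 1 → ∀ R : CircleFun, R ∈ discAlg → R * (1 + c • g) = 1 →
      (Summable fun n : ℕ => (n : ℝ) ^ (2 * m) * ‖coeffL n (g * R)‖ ^ 2) ∧
      (∑' n : ℕ, (n : ℝ) ^ (2 * m) * ‖coeffL n (g * R)‖ ^ 2) * (1 - ‖c‖ ^ 2) ^ (2 * m + 1) ≤ C := by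
  have hb : ∀ m, ∃ M, ∀ x : ℝ, ‖iteratedDeriv m (fun x : ℝ => g x) x‖ ≤ M := fun m => by
    obtain ⟨gm, h1, -, -⟩ := exists_iteratedDerivFun hgs m
    exact ⟨‖gm‖, fun x => by rw [← h1]; exact gm.norm_coe_le_norm _⟩
  obtain ⟨C, hC, hbd⟩ := exists_iteratedDeriv_bound hgs (fun x => hg1 _) hb m
  refine ⟨C ^ 2 * 2 ^ (2 * m), by positivity, fun c hc R hR hRg => ?_⟩
  have hRx : ∀ x, R x * (1 + c * g x) = 1 := fun x => by
    have := congrArg (fun f : CircleFun => f x) hRg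
    simpa using this
  have hne : ∀ x, 1 + c * g x ≠ 0 := fun x => right_ne_zero_of_mul_eq_one (hRx x)
  have hRi : ∀ x, R x = (1 + c * g x)⁻¹ := fun x => eq_inv_of_mul_eq_one_left (hRx x)
  have hfun : (fun x : ℝ => (g * R) (x : UnitAddCircle)) =
      fun x : ℝ => g (x : UnitAddCircle) / (1 + c * g (x : UnitAddCircle)) := by
    ext x
    rw [ContinuousMap.mul_apply, hRi, div_eq_mul_inv]
  have hs : IsSmoothFun (g * R) := by
    unfold IsSmoothFun
    rw [hfun]
    simp only [div_eq_mul_inv]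
    exact hgs.mul ((contDiff_const.add (contDiff_const.mul hgs)).inv fun x => hne _)
  obtain ⟨f, hf, -, hfc⟩ := exists_iteratedDerivFun hs m
  have hfbd : ∀ x, ‖f x‖ ≤ C * ‖R x‖ ^ (m + 1) := forall_circle fun x => by
    have h1 := hbd m le_rfl c hc x
    rw [← hfun, ← hf] at h1
    have h2 : 0 < ‖1 + c * g x‖ := norm_pos_iff.2 (hne _)
    rw [hRi, norm_inv, inv_pow, ← div_eq_mul_inv, le_div_iff₀ (by positivity)]
    exact h1
  have hpos : 0 < 1 - ‖c‖ := by linarith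
  have hRbd : ∀ x, ‖R x‖ * (1 - ‖c‖) ≤ 1 := fun x => by
    have h2 : 1 - ‖c‖ ≤ ‖1 + c * g x‖ := by
      have := norm_sub_norm_le (1 : ℂ) (-(c * g x))
      rw [norm_neg, norm_mul, hg1, sub_neg_eq_add, norm_one] at this
      linarith
    have h3 : ‖R x‖ * ‖1 + c * g x‖ = 1 := by rw [← norm_mul, hRx, norm_one]
    nlinarith [norm_nonneg (R x)]
  have hneg : ∀ n < 0, coeffL n f = 0 := fun n hn => by
    rw [hfc, coeffL_of_neg (mul_mem hg hR) hn, mul_zero]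
  have hsum := hasSum_normSq_coeffL_nat hneg
  have hle : ∀ n : ℕ, (n : ℝ) ^ (2 * m) * ‖coeffL n (g * R)‖ ^ 2 ≤ ‖coeffL n f‖ ^ 2 := fun n => by
    rw [hfc, norm_mul, norm_pow, mul_pow, ← pow_mul, mul_comm m 2]
    gcongr
    rw [norm_mul, norm_mul, norm_mul, Complex.norm_I, Complex.norm_real, Complex.norm_ofNat,
      Int.cast_natCast, Complex.norm_natCast, Real.norm_of_nonneg Real.pi_pos.le]
    have := Real.pi_gt_three
    have hn : (0 : ℝ) ≤ n := n.cast_nonneg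
    nlinarith
  have hsm := Summable.of_nonneg_of_le (fun n => by positivity) hle hsum.summable
  refine ⟨hsm, ?_⟩
  have h1 := (hsm.tsum_le_tsum hle hsum.summable).trans_eq hsum.tsum_eq
  have hintg : ∀ f : CircleFun, MeasureTheory.Integrable (fun x => ‖f x‖ ^ 2)
      (AddCircle.haarAddCircle : MeasureTheory.Measure UnitAddCircle) := fun f =>
    (f.continuous.norm.pow 2).integrable_of_hasCompactSupport (HasCompactSupport.of_compactSpace _)
  have h2 : (∫ x : UnitAddCircle, ‖f x‖ ^ 2 ∂AddCircle.haarAddCircle) * (1 - ‖c‖) ^ (2 * m) ≤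
      C ^ 2 * ∫ x : UnitAddCircle, ‖R x‖ ^ 2 ∂AddCircle.haarAddCircle := by
    rw [← MeasureTheory.integral_mul_const, ← MeasureTheory.integral_const_mul]
    refine MeasureTheory.integral_mono ((hintg f).mul_const _) ((hintg R).const_mul _) fun x => ?_
    have h3 := pow_le_one₀ (by positivity) (hRbd x) (n := 2 * m)
    have h4 : ‖f x‖ ^ 2 ≤ C ^ 2 * (‖R x‖ ^ (2 * m) * ‖R x‖ ^ 2) := by
      refine (pow_le_pow_left₀ (norm_nonneg _) (hfbd x) 2).trans_eq ?_
      ring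
    calc ‖f x‖ ^ 2 * (1 - ‖c‖) ^ (2 * m)
        ≤ C ^ 2 * (‖R x‖ ^ (2 * m) * ‖R x‖ ^ 2) * (1 - ‖c‖) ^ (2 * m) := by gcongr
      _ = C ^ 2 * ‖R x‖ ^ 2 * (‖R x‖ * (1 - ‖c‖)) ^ (2 * m) := by rw [mul_pow]; ring
      _ ≤ C ^ 2 * ‖R x‖ ^ 2 * 1 := by gcongr
      _ = C ^ 2 * ‖R x‖ ^ 2 := mul_one _
  have h5 := integral_normSq_inverse hg hg1 hg0 hR hRg
  have h6 : 1 - ‖c‖ ^ 2 ≤ 2 * (1 - ‖c‖) := by nlinarith [norm_nonneg c]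
  have h7 : 0 < 1 - ‖c‖ ^ 2 := by nlinarith [norm_nonneg c]
  have h8 : 0 ≤ ∑' n : ℕ, (n : ℝ) ^ (2 * m) * ‖coeffL n (g * R)‖ ^ 2 :=
    tsum_nonneg fun n => by positivity
  set S := ∑' n : ℕ, (n : ℝ) ^ (2 * m) * ‖coeffL n (g * R)‖ ^ 2
  calc S * (1 - ‖c‖ ^ 2) ^ (2 * m + 1)
      = S * (1 - ‖c‖ ^ 2) ^ (2 * m) * (1 - ‖c‖ ^ 2) := by ring
    _ ≤ S * (2 * (1 - ‖c‖)) ^ (2 * m) * (1 - ‖c‖ ^ 2) := by gcongr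
    _ = (S * (1 - ‖c‖) ^ (2 * m)) * (2 ^ (2 * m) * (1 - ‖c‖ ^ 2)) := by rw [mul_pow]; ring
    _ ≤ (C ^ 2 * ∫ x : UnitAddCircle, ‖R x‖ ^ 2 ∂AddCircle.haarAddCircle) *
        (2 ^ (2 * m) * (1 - ‖c‖ ^ 2)) := by
      refine mul_le_mul_of_nonneg_right (le_trans ?_ h2) (by positivity)
      exact mul_le_mul_of_nonneg_right h1 (by positivity)
    _ = C ^ 2 * 2 ^ (2 * m) := by linear_combination C ^ 2 * 2 ^ (2 * m) * h5

end Inner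

/-- The Möbius transform `(η g + β) / (1 + conj β η g)` of an inner function `g`. -/
def mobiusFun (g : CircleFun) (β η : ℂ) : CircleFun :=
  (η • g + β • 1) * Ring.inverse (1 + (conj β * η) • g)

section Mobius

variable {g : CircleFun} {β η : ℂ}

theorem norm_conj_mul_lt_one (hβ : ‖β‖ < 1) (hη : ‖η‖ = 1) : ‖conj β * η‖ < 1 := by
  rwa [norm_mul, hη, RCLike.norm_conj, mul_one]

theorem mobiusFun_mul (hg : g ∈ discAlg) (hg1 : ∀ x, ‖g x‖ = 1) (hβ : ‖β‖ < 1) (hη : ‖η‖ = 1) :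
    mobiusFun g β η * (1 + (conj β * η) • g) = η • g + β • 1 := by
  obtain ⟨R, hR, hRg, hi⟩ := exists_inverse hg hg1 (norm_conj_mul_lt_one hβ hη)
  rw [mobiusFun, hi, mul_assoc, hRg, mul_one]

theorem mobiusFun_mul_apply (hg : g ∈ discAlg) (hg1 : ∀ x, ‖g x‖ = 1) (hβ : ‖β‖ < 1)
    (hη : ‖η‖ = 1) (x : UnitAddCircle) :
    mobiusFun g β η x * (1 + conj β * η * g x) = η * g x + β := by
  simpa using congrArg (fun f : CircleFun => f x) (mobiusFun_mul hg hg1 hβ hη)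

theorem one_add_ne_zero (hg1 : ∀ x, ‖g x‖ = 1) (hβ : ‖β‖ < 1) (hη : ‖η‖ = 1)
    (x : UnitAddCircle) : 1 + conj β * η * g x ≠ 0 := fun h => by
  have h1 : ‖conj β * η * g x‖ = 1 := by
    rw [show conj β * η * g x = -1 by linear_combination h]; simp
  rw [norm_mul, hg1, mul_one] at h1
  exact (norm_conj_mul_lt_one hβ hη).ne h1

theorem mobiusFun_mem (hg : g ∈ discAlg) (hg1 : ∀ x, ‖g x‖ = 1) (hβ : ‖β‖ < 1) (hη : ‖η‖ = 1) :
    mobiusFun g β η ∈ discAlg := by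
  obtain ⟨R, hR, hRg, hi⟩ := exists_inverse hg hg1 (norm_conj_mul_lt_one hβ hη)
  rw [mobiusFun, hi]
  exact mul_mem (add_mem (Subalgebra.smul_mem _ hg _) (Subalgebra.smul_mem _ (one_mem _) _)) hR

theorem coeffL_zero_mobiusFun (hg : g ∈ discAlg) (hg1 : ∀ x, ‖g x‖ = 1) (hg0 : coeffL 0 g = 0)
    (hβ : ‖β‖ < 1) (hη : ‖η‖ = 1) : coeffL 0 (mobiusFun g β η) = β := by
  obtain ⟨R, hR, hRg, hi⟩ := exists_inverse hg hg1 (norm_conj_mul_lt_one hβ hη)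
  rw [mobiusFun, hi, coeffL_zero_mul (add_mem (Subalgebra.smul_mem _ hg _)
    (Subalgebra.smul_mem _ (one_mem _) _)) hR, coeffL_zero_inverse hg hg0 hR hRg, map_add,
    map_smul, map_smul, hg0, coeffL_one]
  simp

theorem norm_mobiusFun_apply (hg : g ∈ discAlg) (hg1 : ∀ x, ‖g x‖ = 1) (hβ : ‖β‖ < 1)
    (hη : ‖η‖ = 1) (x : UnitAddCircle) : ‖mobiusFun g β η x‖ = 1 := by
  have h1 := congrArg norm (mobiusFun_mul_apply hg hg1 hβ hη x)
  have h2 : ‖η * g x + β‖ = ‖1 + conj β * η * g x‖ := by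
    have h3 : (η * g x) * conj (η * g x) = 1 := by
      rw [Complex.mul_conj, Complex.normSq_eq_norm_sq, norm_mul, hη, hg1]; simp
    have h4 : 1 + conj β * η * g x = (η * g x) * conj (η * g x + β) := by
      rw [map_add]; linear_combination -h3
    rw [h4, norm_mul, RCLike.norm_conj, norm_mul, hη, hg1]; simp
  rw [norm_mul, h2] at h1
  exact mul_right_cancel₀ (norm_ne_zero_iff.2 (one_add_ne_zero hg1 hβ hη x)) (h1.trans (one_mul _).symm)

theorem hasSum_normSq_mobiusFun (hg : g ∈ discAlg) (hg1 : ∀ x, ‖g x‖ = 1)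
    (hβ : ‖β‖ < 1) (hη : ‖η‖ = 1) :
    HasSum (fun n : ℕ => ‖coeffL n (mobiusFun g β η)‖ ^ 2) 1 := by
  have h := hasSum_normSq_coeffL_nat fun n => coeffL_of_neg (mobiusFun_mem hg hg1 hβ hη) (n := n)
  simpa [norm_mobiusFun_apply hg hg1 hβ hη] using h

theorem exists_moment_bound_mobiusFun (hg : g ∈ discAlg) (hg1 : ∀ x, ‖g x‖ = 1)
    (hg0 : coeffL 0 g = 0) (hgs : IsSmoothFun g) {m : ℕ} (hm : m ≠ 0) :
    ∃ C, 0 ≤ C ∧ ∀ β η : ℂ, ‖β‖ < 1 → ‖η‖ = 1 →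
      (Summable fun n : ℕ => (n : ℝ) ^ (2 * m) * ‖coeffL n (mobiusFun g β η)‖ ^ 2) ∧
      (∑' n : ℕ, (n : ℝ) ^ (2 * m) * ‖coeffL n (mobiusFun g β η)‖ ^ 2) *
        (1 - ‖β‖ ^ 2) ^ (2 * m) ≤ C * (1 - ‖β‖ ^ 2) := by
  obtain ⟨C, hC, h⟩ := exists_moment_bound hg hg1 hg0 hgs m
  refine ⟨C, hC, fun β η hβ hη => ?_⟩
  obtain ⟨R, hR, hRg, hi⟩ := exists_inverse hg hg1 (norm_conj_mul_lt_one hβ hη)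
  obtain ⟨hs, hb⟩ := h _ (norm_conj_mul_lt_one hβ hη) R hR hRg
  have hεpos : 0 < 1 - ‖β‖ ^ 2 := by nlinarith [norm_nonneg β]
  set ε := 1 - ‖β‖ ^ 2 with hε
  have hb1 : ((ε : ℝ) : ℂ) = 1 - β * conj β := by
    rw [hε, Complex.mul_conj, Complex.normSq_eq_norm_sq]; push_cast; ring
  have hM : mobiusFun g β η = β • 1 + (ε * η) • (g * R) := by
    rw [mobiusFun, hi]
    ext x
    have h1 := congrArg (fun f : CircleFun => f x) hRg
    simp only [ContinuousMap.mul_apply, ContinuousMap.add_apply, ContinuousMap.smul_apply,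
      ContinuousMap.one_apply, smul_eq_mul] at h1 ⊢
    rw [hb1]
    linear_combination β * h1
  have hterm : ∀ n : ℕ, (n : ℝ) ^ (2 * m) * ‖coeffL n (mobiusFun g β η)‖ ^ 2 =
      ε ^ 2 * ((n : ℝ) ^ (2 * m) * ‖coeffL n (g * R)‖ ^ 2) := fun n => by
    rcases Nat.eq_zero_or_pos n with rfl | hn
    · simp [hm]
    · rw [hM, map_add, map_smul, map_smul, coeffL_one, if_neg (by exact_mod_cast hn.ne'),
        smul_zero, zero_add, smul_eq_mul, norm_mul, norm_mul, hη, Complex.norm_real,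
        Real.norm_of_nonneg hεpos.le]
      ring
  simp only [hterm]
  refine ⟨hs.mul_left _, ?_⟩
  rw [tsum_mul_left]
  have hc : ‖conj β * η‖ = ‖β‖ := by rw [norm_mul, hη, RCLike.norm_conj, mul_one]
  rw [hc, ← hε] at hb
  calc _ = ((∑' n : ℕ, (n : ℝ) ^ (2 * m) * ‖coeffL n (g * R)‖ ^ 2) * ε ^ (2 * m + 1)) * ε := by
        ring
    _ ≤ C * ε := by gcongr

end Mobius

section Evolution

variable {g : CircleFun} {σ α : ℝ} {a β η : ℝ → ℂ}

theorem hasDerivAt_mobiusFun (hg : g ∈ discAlg) (hg1 : ∀ x, ‖g x‖ = 1)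
    (hβ : ∀ t, HasDerivAt β (fieldB σ (a t) (β t)) t)
    (hη : ∀ t, HasDerivAt η (fieldE σ (a t) (β t) (η t)) t)
    (hβ1 : ∀ t, ‖β t‖ < 1) (hη1 : ∀ t, ‖η t‖ = 1) (t : ℝ) :
    HasDerivAt (fun t => mobiusFun g (β t) (η t))
      ((-I) • ((a t * σ) • 1 + (2 * (a t * conj (a t)) + (σ : ℂ) ^ 2) • mobiusFun g (β t) (η t) +
        (conj (a t) * σ) • (mobiusFun g (β t) (η t)) ^ 2)) t := by
  have hc : HasDerivAt (fun t => conj (β t) * η t) _ t := (hβ t).conj'.mul (hη t)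
  have hw : HasDerivAt (fun t => 1 + (conj (β t) * η t) • g) _ t := (hc.smul_const g).const_add 1
  have hn : HasDerivAt (fun t => η t • g + β t • (1 : CircleFun)) _ t :=
    ((hη t).smul_const g).add ((hβ t).smul_const (1 : CircleFun))
  obtain ⟨R, -, hRg, hi⟩ := exists_inverse hg hg1 (norm_conj_mul_lt_one (hβ1 t) (hη1 t))
  have hd : DifferentiableAt ℝ (fun t => mobiusFun g (β t) (η t)) t := by
    refine hn.differentiableAt.mul ?_
    have hu : IsUnit (1 + (conj (β t) * η t) • g) := .of_mul_eq_one R (by rw [mul_comm]; exact hRg)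
    exact (differentiableAt_inverse hu).comp t hw.differentiableAt
  have h1 : HasDerivAt (fun t => mobiusFun g (β t) (η t) * (1 + (conj (β t) * η t) • g)) _ t :=
    hd.hasDerivAt.mul hw
  have h2 := h1.congr_of_eventuallyEq (f₁ := fun t => η t • g + β t • (1 : CircleFun))
    (Eventually.of_forall fun t => (mobiusFun_mul hg hg1 (hβ1 t) (hη1 t)).symm)
  have h3 := h2.unique hn
  refine hd.hasDerivAt.congr_deriv ?_
  ext x
  have h4 := congrArg (fun f : CircleFun => f x) h3
  have h5 := mobiusFun_mul_apply hg hg1 (hβ1 t) (hη1 t) x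
  simp only [ContinuousMap.mul_apply, ContinuousMap.add_apply, ContinuousMap.smul_apply,
      ContinuousMap.one_apply, smul_eq_mul, ContinuousMap.pow_apply] at h4 ⊢
  refine mul_right_cancel₀ (one_add_ne_zero hg1 (hβ1 t) (hη1 t) x) ?_
  generalize (deriv (fun t => mobiusFun g (β t) (η t)) t) x = D at *
  generalize mobiusFun g (β t) (η t) x = b at *
  simp only [fieldB, fieldE, map_mul, map_add, map_pow, map_neg, Complex.conj_I,
    Complex.conj_ofReal, Complex.conj_conj, map_ofNat] at h4
  linear_combination h4 + I * (2 * (a t * conj (a t)) + (σ : ℂ) ^ 2 + conj (a t) * σ * b +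
    conj (a t) * σ * β t) * h5

end Evolution

section InitialData

variable {u : ℕ → ℂ}

theorem iteratedDeriv_fourier (n : ℕ) (k : ℕ) :
    iteratedDeriv k (fun x : ℝ => (fourier (n : ℤ) (x : UnitAddCircle) : ℂ)) =
      fun x : ℝ => (2 * Real.pi * I * n) ^ k * fourier (n : ℤ) (x : UnitAddCircle) := by
  induction k with
  | zero => simp
  | succ k ih =>
    rw [iteratedDeriv_succ, ih]
    ext x
    have h := ((hasDerivAt_fourier 1 (n : ℤ) x).const_mul ((2 * Real.pi * I * n) ^ k)).deriv
    rw [h]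
    push_cast
    ring

theorem isSmoothFun_fourierSum (hu : ∀ m : ℕ, Summable fun n : ℕ => (n : ℝ) ^ m * ‖u n‖) :
    IsSmoothFun (fourierSum u) := by
  have su : Summable fun n => ‖u n‖ := by simpa using hu 0
  have h1 : (fun x : ℝ => fourierSum u (x : UnitAddCircle)) =
      fun x : ℝ => ∑' n : ℕ, u n * fourier (n : ℤ) (x : UnitAddCircle) := by
    ext x
    have h2 := ContinuousMap.hasSum_apply (hasSum_fourierSum su) (x : UnitAddCircle)
    exact h2.tsum_eq.symm
  unfold IsSmoothFun
  rw [h1]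
  have hsm : ∀ n : ℕ, ContDiff ℝ (⊤ : ℕ∞)
      (fun x : ℝ => u n * fourier (n : ℤ) (x : UnitAddCircle)) := fun n => by
    simp only [fourier_coe_apply]
    exact contDiff_const.mul
      ((contDiff_const.mul Complex.ofRealCLM.contDiff).div_const _).cexp
  refine contDiff_tsum (v := fun (k n : ℕ) => (2 * Real.pi) ^ k * ((n : ℝ) ^ k * ‖u n‖)) hsm
    (fun k _ => (hu k).mul_left _) fun k n x _ => ?_
  rw [norm_iteratedFDeriv_eq_norm_iteratedDeriv, iteratedDeriv_const_mul_field,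
    iteratedDeriv_fourier]
  have h3 : ‖(fourier (n : ℤ) (x : UnitAddCircle) : ℂ)‖ = 1 := by
    rw [fourier_apply]; exact Circle.norm_coe _
  simp only [norm_mul, norm_pow, h3, Complex.norm_I, Complex.norm_real, Complex.norm_ofNat,
    Complex.norm_natCast, Real.norm_of_nonneg Real.pi_pos.le, mul_pow]
  apply le_of_eq
  ring

theorem fourierSum_sub_mul_star {σ : ℝ} {a : ℂ} (su : Summable fun n => ‖u n‖) (ha : a ≠ 0)
    (h0 : u 0 = a - σ ^ 2 / conj a) (hk : ∀ k, khankel u u k = conj a * u (k + 1))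
    (hn : ∑' n, ‖u n‖ ^ 2 = ‖a‖ ^ 2 - σ ^ 2) :
    (fourierSum u - a • 1) * star (fourierSum u - a • 1) = ((σ : ℂ) ^ 2) • 1 := by
  have hstar : ∀ n : ℕ, coeffL n (star (fourierSum u)) = if n = 0 then conj (u 0) else 0 := by
    intro n
    rw [coeffL_star]
    split_ifs with h
    · subst h
      rw [← coeffL_fourierSum su 0]; simp
    · rw [coeffL_of_neg (fourierSum_mem su) (by omega), map_zero]
  have hexp : (fourierSum u - a • 1) * star (fourierSum u - a • 1) =
      fourierSum u * star (fourierSum u) - conj a • fourierSum u - a • star (fourierSum u) +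
        (a * conj a) • 1 := by
    ext x
    simp only [ContinuousMap.mul_apply, ContinuousMap.add_apply, ContinuousMap.sub_apply,
      ContinuousMap.smul_apply, ContinuousMap.one_apply, smul_eq_mul, ContinuousMap.star_apply,
      RCLike.star_def, map_sub, map_mul, map_one]
    ring
  have hnat : ∀ n : ℕ, coeffL n ((fourierSum u - a • 1) * star (fourierSum u - a • 1)) =
      coeffL n (((σ : ℂ) ^ 2) • (1 : CircleFun)) := fun n => by
    rw [hexp, map_add, map_sub, map_sub, map_smul, map_smul, map_smul, map_smul,
      coeffL_mul_star_fourierSum su, coeffL_fourierSum su, hstar, coeffL_one]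
    rcases n with _ | n
    · have h1 : hankel u u 0 = ((‖a‖ ^ 2 - σ ^ 2 : ℝ) : ℂ) := by
        rw [← hn, Complex.ofReal_tsum]
        refine tsum_congr fun l => ?_
        rw [zero_add, Complex.mul_conj, Complex.normSq_eq_norm_sq]
      have h2 : ((‖a‖ ^ 2 : ℝ) : ℂ) = a * conj a := by
        rw [Complex.mul_conj, Complex.normSq_eq_norm_sq]
      have ha' : conj a ≠ 0 := (map_ne_zero _).2 ha
      rw [h1, Complex.ofReal_sub, h2, h0]
      simp
      field_simp
      ring
    · have h1 : hankel u u (n + 1) = conj a * u (n + 1) := hk n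
      rw [h1, if_neg (by omega), if_neg (by omega)]
      simp
  refine eq_of_coeffL_eq fun n => ?_
  rcases le_or_gt 0 n with h | h
  · obtain ⟨m, rfl⟩ := Int.eq_ofNat_of_zero_le h
    exact hnat m
  · obtain ⟨m, hm⟩ := Int.eq_ofNat_of_zero_le (neg_nonneg.2 h.le)
    have h1 := congrArg conj (hnat m)
    rw [← hm, ← coeffL_star, ← coeffL_star] at h1
    convert h1 using 2
    · rw [star_mul, star_star]
    · ext x; simp

theorem exists_inner_function {σ : ℝ} {a : ℂ} (hσ : 0 < σ) (ha : σ < ‖a‖)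
    (hu : ∀ m : ℕ, Summable fun n : ℕ => (n : ℝ) ^ m * ‖u n‖)
    (h0 : u 0 = a - σ ^ 2 / conj a) (hk : ∀ k, khankel u u k = conj a * u (k + 1))
    (hn : ∑' n, ‖u n‖ ^ 2 = ‖a‖ ^ 2 - σ ^ 2) :
    ∃ g ∈ discAlg, (∀ x, ‖g x‖ = 1) ∧ coeffL 0 g = 0 ∧ IsSmoothFun g ∧
      fourierSum u = a • 1 + (σ : ℂ) • mobiusFun g (-σ / conj a) 1 := by
  have su : Summable fun n => ‖u n‖ := by simpa using hu 0
  have ha0 : a ≠ 0 := norm_pos_iff.1 (hσ.trans ha)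
  have hσ0 : (σ : ℂ) ≠ 0 := Complex.ofReal_ne_zero.2 hσ.ne'
  set β : ℂ := -σ / conj a with hβ
  have hβ1 : ‖β‖ < 1 := by
    rw [hβ, norm_div, norm_neg, RCLike.norm_conj, Complex.norm_real, Real.norm_of_nonneg hσ.le,
      div_lt_one (hσ.trans ha)]
    exact ha
  set b : CircleFun := (σ : ℂ)⁻¹ • (fourierSum u - a • 1) with hb
  have hbm : b ∈ discAlg := Subalgebra.smul_mem _ (sub_mem (fourierSum_mem su)
    (Subalgebra.smul_mem _ (one_mem _) _)) _
  have hb1 : ∀ x, ‖b x‖ = 1 := fun x => by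
    have h1 := congrArg (fun f : CircleFun => f x) (fourierSum_sub_mul_star su ha0 h0 hk hn)
    simp only [ContinuousMap.mul_apply, ContinuousMap.star_apply, ContinuousMap.smul_apply,
      ContinuousMap.one_apply, smul_eq_mul, mul_one, RCLike.star_def] at h1
    rw [Complex.mul_conj, Complex.normSq_eq_norm_sq] at h1
    have h2 : ‖(fourierSum u - a • (1 : CircleFun)) x‖ ^ 2 = σ ^ 2 := by exact_mod_cast h1
    have h3 := (pow_left_inj₀ (norm_nonneg _) hσ.le two_ne_zero).1 h2
    rw [hb, ContinuousMap.smul_apply, norm_smul, h3, norm_inv, Complex.norm_real,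
      Real.norm_of_nonneg hσ.le, inv_mul_cancel₀ hσ.ne']
  have hb0 : coeffL 0 b = β := by
    have h1 : coeffL 0 (fourierSum u) = u 0 := coeffL_fourierSum su 0
    rw [hb, map_smul, map_sub, map_smul, h1, coeffL_one, h0, hβ]
    simp
    field_simp
  have hbs : IsSmoothFun b := by
    have h1 : (fun x : ℝ => b (x : UnitAddCircle)) =
        fun x : ℝ => (σ : ℂ)⁻¹ * (fourierSum u (x : UnitAddCircle) - a) := by
      ext x; simp [hb]
    unfold IsSmoothFun
    rw [h1]
    exact contDiff_const.mul ((isSmoothFun_fourierSum hu).sub contDiff_const)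
  have hβ' : ‖-β‖ < 1 := by rwa [norm_neg]
  have hg1 := norm_mobiusFun_apply hbm hb1 hβ' norm_one
  have hgm := mobiusFun_mem hbm hb1 hβ' norm_one
  have hgb := mobiusFun_mul_apply hbm hb1 hβ' norm_one
  have hne := one_add_ne_zero hb1 hβ' norm_one
  refine ⟨mobiusFun b (-β) 1, hgm, hg1, ?_, ?_, ?_⟩
  · obtain ⟨R, hR, hRg, hi⟩ := exists_inverse hbm hb1 (norm_conj_mul_lt_one hβ' norm_one)
    have h1 : coeffL 0 ((1 : ℂ) • b + (-β) • (1 : CircleFun)) = 0 := by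
      rw [one_smul, map_add, hb0, map_smul, coeffL_one]
      simp
    rw [mobiusFun, hi, coeffL_zero_mul (add_mem (Subalgebra.smul_mem _ hbm _)
      (Subalgebra.smul_mem _ (one_mem _) _)) hR, h1, zero_mul]
  · have h1 : (fun x : ℝ => mobiusFun b (-β) 1 (x : UnitAddCircle)) = fun x : ℝ =>
        (1 * b (x : UnitAddCircle) + -β) * (1 + conj (-β) * 1 * b (x : UnitAddCircle))⁻¹ := by
      ext x
      rw [← div_eq_mul_inv, eq_div_iff (hne _), hgb]
    unfold IsSmoothFun
    rw [h1]
    exact ((contDiff_const.mul hbs).add contDiff_const).mul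
      ((contDiff_const.add (contDiff_const.mul hbs)).inv fun x => hne _)
  · have h1 : mobiusFun (mobiusFun b (-β) 1) β 1 = b := by
      ext x
      refine mul_right_cancel₀ (one_add_ne_zero hg1 hβ1 norm_one x) ?_
      rw [mobiusFun_mul_apply hgm hg1 hβ1 norm_one]
      have h2 := hgb x
      rw [map_neg] at h2
      linear_combination h2
    rw [h1, hb, smul_smul, mul_inv_cancel₀ hσ0, one_smul, add_sub_cancel]

end InitialData

theorem summable_wgt_of_summable_mul_sq {r : ℝ} (hr1 : r ≤ 1) {u : ℕ → ℂ}
    (h0 : Summable fun n => ‖u n‖ ^ 2) (h1 : Summable fun n : ℕ => (n : ℝ) ^ 2 * ‖u n‖ ^ 2) :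
    Summable fun n => wgt r n ^ 2 * ‖u n‖ ^ 2 := by
  refine Summable.of_nonneg_of_le (fun n => by positivity) (fun n => ?_)
    ((h0.mul_left 2).add (h1.mul_left 2))
  have h2 : wgt r n ^ 2 ≤ (1 + (n : ℝ)) ^ 2 := by
    have : wgt r n ≤ (1 + (n : ℝ)) ^ (1 : ℝ) :=
      Real.rpow_le_rpow_of_exponent_le (by linarith [Nat.cast_nonneg (α := ℝ) n]) hr1
    rw [Real.rpow_one] at this
    exact pow_le_pow_left₀ (wgt_nonneg r n) this 2
  calc wgt r n ^ 2 * ‖u n‖ ^ 2 ≤ (2 + 2 * (n : ℝ) ^ 2) * ‖u n‖ ^ 2 := by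
        gcongr
        nlinarith [sq_nonneg ((n : ℝ) - 1)]
    _ = _ := by ring

section Explicit

variable {g : CircleFun} {σ α : ℝ} {a β η : ℝ → ℂ}

/-- The curve of functions `a + σ b`, with `b` a Möbius transform of the inner function `g`. -/
def affineCurve (g : CircleFun) (σ : ℝ) (a β η : ℂ) : CircleFun :=
  a • 1 + (σ : ℂ) • mobiusFun g β η

theorem affineCurve_mem {a β η : ℂ} (hg : g ∈ discAlg) (hg1 : ∀ x, ‖g x‖ = 1)
    (hβ : ‖β‖ < 1) (hη : ‖η‖ = 1) : affineCurve g σ a β η ∈ discAlg :=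
  add_mem (Subalgebra.smul_mem _ (one_mem _) _)
    (Subalgebra.smul_mem _ (mobiusFun_mem hg hg1 hβ hη) _)

theorem coeffL_zero_affineCurve {a β η : ℂ} (hg : g ∈ discAlg) (hg1 : ∀ x, ‖g x‖ = 1)
    (hg0 : coeffL 0 g = 0) (hβ : ‖β‖ < 1) (hη : ‖η‖ = 1) :
    coeffL 0 (affineCurve g σ a β η) = a + σ * β := by
  rw [affineCurve, map_add, map_smul, map_smul, coeffL_one,
    coeffL_zero_mobiusFun hg hg1 hg0 hβ hη]
  simp

theorem hasDerivAt_affineCurve (hg : g ∈ discAlg) (hg1 : ∀ x, ‖g x‖ = 1)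
    (ha : ∀ t, HasDerivAt a (fieldA σ α (a t) (β t)) t)
    (hβ : ∀ t, HasDerivAt β (fieldB σ (a t) (β t)) t)
    (hη : ∀ t, HasDerivAt η (fieldE σ (a t) (β t) (η t)) t)
    (hβ1 : ∀ t, ‖β t‖ < 1) (hη1 : ∀ t, ‖η t‖ = 1) (t : ℝ) :
    HasDerivAt (fun t => affineCurve g σ (a t) (β t) (η t))
      ((-I) • (affineCurve g σ (a t) (β t) (η t) * (star (affineCurve g σ (a t) (β t) (η t)) *
        affineCurve g σ (a t) (β t) (η t)) + (α * (a t + σ * β t)) • (1 : CircleFun) -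
        (a t ^ 2 * σ) • (star (mobiusFun g (β t) (η t)) - conj (β t) • (1 : CircleFun)))) t := by
  refine (((ha t).smul_const (1 : CircleFun)).add
    ((hasDerivAt_mobiusFun hg hg1 hβ hη hβ1 hη1 t).const_smul (σ : ℂ))).congr_deriv ?_
  ext x
  have h1 := norm_mobiusFun_apply hg hg1 (hβ1 t) (hη1 t) x
  have h2 : mobiusFun g (β t) (η t) x * conj (mobiusFun g (β t) (η t) x) = 1 := by
    rw [Complex.mul_conj, Complex.normSq_eq_norm_sq, h1]; simp
  simp only [affineCurve, fieldA, ContinuousMap.mul_apply, ContinuousMap.add_apply,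
    ContinuousMap.sub_apply, ContinuousMap.smul_apply, ContinuousMap.one_apply,
    ContinuousMap.star_apply, ContinuousMap.pow_apply, smul_eq_mul, RCLike.star_def, map_add,
    map_mul, Complex.conj_ofReal, mul_one]
  generalize mobiusFun g (β t) (η t) x = b at h2
  linear_combination (I * (a t * σ ^ 2 * 2 + σ ^ 3 * b + a t * 0)) * h2

theorem solvesSzego_affineCurve (hg : g ∈ discAlg) (hg1 : ∀ x, ‖g x‖ = 1) (hg0 : coeffL 0 g = 0)
    (ha : ∀ t, HasDerivAt a (fieldA σ α (a t) (β t)) t)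
    (hβ : ∀ t, HasDerivAt β (fieldB σ (a t) (β t)) t)
    (hη : ∀ t, HasDerivAt η (fieldE σ (a t) (β t) (η t)) t)
    (hβ1 : ∀ t, ‖β t‖ < 1) (hη1 : ∀ t, ‖η t‖ = 1)
    (hs : ∀ t, Summable fun n : ℕ => ‖coeffL n (affineCurve g σ (a t) (β t) (η t))‖) :
    SolvesSzego α fun t n => coeffL n (affineCurve g σ (a t) (β t) (η t)) := by
  intro n t
  have h := ((coeffL n).restrictScalars ℝ).hasFDerivAt.comp_hasDerivAt t
    (hasDerivAt_affineCurve hg hg1 ha hβ hη hβ1 hη1 t)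
  refine h.congr_deriv ?_
  have hm : affineCurve g σ (a t) (β t) (η t) ∈ discAlg := affineCurve_mem hg hg1 (hβ1 t) (hη1 t)
  have h0 : coeffL 0 (affineCurve g σ (a t) (β t) (η t)) = a t + σ * β t :=
    coeffL_zero_affineCurve hg hg1 hg0 (hβ1 t) (hη1 t)
  have hc := coeffL_cubic (hs t) n
  rw [← eq_fourierSum hm (hs t)] at hc
  have hz : coeffL n (star (mobiusFun g (β t) (η t)) - conj (β t) • (1 : CircleFun)) = 0 := by
    rw [map_sub, map_smul, coeffL_star, coeffL_one]
    rcases Nat.eq_zero_or_pos n with rfl | hn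
    · simp [coeffL_zero_mobiusFun hg hg1 hg0 (hβ1 t) (hη1 t)]
    · rw [coeffL_of_neg (mobiusFun_mem hg hg1 (hβ1 t) (hη1 t)) (by omega)]
      simp [hn.ne']
  rw [ContinuousLinearMap.coe_restrictScalars', map_smul, map_sub, map_add, map_smul, map_smul,
    hz, hc, coeffL_one]
  simp [oneSeq, h0]

end Explicit

theorem exists_explicit_solution {u : ℕ → ℂ} {σ : ℝ} (α : ℝ) {a₀ : ℂ} (hσ : 0 < σ)
    (ha₀ : σ < ‖a₀‖) (hu : ∀ m : ℕ, Summable fun n : ℕ => (n : ℝ) ^ m * ‖u n‖)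
    (h0 : u 0 = a₀ - σ ^ 2 / conj a₀) (hk : ∀ k, khankel u u k = conj a₀ * u (k + 1))
    (hn : ∑' n, ‖u n‖ ^ 2 = ‖a₀‖ ^ 2 - σ ^ 2) :
    ∃ (v : ℝ → ℕ → ℂ) (a β : ℝ → ℂ) (A : ℝ), v 0 = u ∧ SolvesSzego α v ∧
      (∀ t, HasDerivAt a (fieldA σ α (a t) (β t)) t) ∧
      (∀ t, HasDerivAt β (fieldB σ (a t) (β t)) t) ∧
      a 0 = a₀ ∧ a 0 * conj (β 0) = -σ ∧ (∀ t, ‖β t‖ < 1) ∧ (∀ t, ‖a t‖ ≤ A) ∧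
      (∀ t, ‖v t 0‖ ≤ A + σ) ∧
      (∀ t, HasSum (fun n => ‖v t (n + 1)‖ ^ 2) (σ ^ 2 * (1 - ‖β t‖ ^ 2))) ∧
      ∀ m : ℕ, m ≠ 0 → ∃ C, 0 ≤ C ∧ ∀ t,
        (Summable fun n : ℕ => (n : ℝ) ^ (2 * m) * ‖v t n‖ ^ 2) ∧
        (∑' n : ℕ, (n : ℝ) ^ (2 * m) * ‖v t n‖ ^ 2) * (1 - ‖β t‖ ^ 2) ^ (2 * m) ≤
          C * (1 - ‖β t‖ ^ 2) := by
  obtain ⟨g, hg, hg1, hg0, hgs, hug⟩ := exists_inner_function hσ ha₀ hu h0 hk hn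
  have ha0 : a₀ ≠ 0 := norm_pos_iff.1 (hσ.trans ha₀)
  have hβ₀ : ‖(-σ / conj a₀ : ℂ)‖ < 1 := by
    rw [norm_div, norm_neg, RCLike.norm_conj, Complex.norm_real, Real.norm_of_nonneg hσ.le,
      div_lt_one (hσ.trans ha₀)]
    exact ha₀
  obtain ⟨a, β, η, a0, β0, η0, ha, hβ, hη, hβ1, hη1, A, hA⟩ :=
    exists_reduced_solution (α := α) hσ a₀ (-σ / conj a₀) 1 hβ₀ norm_one
  have hz := fun t => coeffL_zero_affineCurve (a := a t) (σ := σ) hg hg1 hg0 (hβ1 t) (hη1 t)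
  have hsucc : ∀ t (n : ℕ), coeffL (n + 1 : ℕ) (affineCurve g σ (a t) (β t) (η t)) =
      σ * coeffL (n + 1 : ℕ) (mobiusFun g (β t) (η t)) := fun t n => by
    rw [affineCurve, map_add, map_smul, map_smul, coeffL_one, if_neg (by omega)]
    simp
  have hsum : ∀ t, HasSum (fun n : ℕ => ‖coeffL (n + 1 : ℕ) (affineCurve g σ (a t) (β t) (η t))‖ ^ 2)
      (σ ^ 2 * (1 - ‖β t‖ ^ 2)) := fun t => by
    have h1 := ((hasSum_nat_add_iff' 1).2
      (hasSum_normSq_mobiusFun hg hg1 (hβ1 t) (hη1 t))).mul_left (σ ^ 2)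
    simp only [Finset.sum_range_one, Nat.cast_zero,
      coeffL_zero_mobiusFun hg hg1 hg0 (hβ1 t) (hη1 t)] at h1
    simpa only [hsucc, norm_mul, Complex.norm_real, mul_pow, Real.norm_eq_abs, sq_abs] using h1
  have hmom : ∀ m : ℕ, m ≠ 0 → ∃ C, 0 ≤ C ∧ ∀ t,
      (Summable fun n : ℕ => (n : ℝ) ^ (2 * m) *
        ‖coeffL n (affineCurve g σ (a t) (β t) (η t))‖ ^ 2) ∧
      (∑' n : ℕ, (n : ℝ) ^ (2 * m) * ‖coeffL n (affineCurve g σ (a t) (β t) (η t))‖ ^ 2) *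
        (1 - ‖β t‖ ^ 2) ^ (2 * m) ≤ C * (1 - ‖β t‖ ^ 2) := fun m hm => by
    obtain ⟨C, hC, h⟩ := exists_moment_bound_mobiusFun hg hg1 hg0 hgs hm
    refine ⟨σ ^ 2 * C, by positivity, fun t => ?_⟩
    obtain ⟨h1, h2⟩ := h (β t) (η t) (hβ1 t) (hη1 t)
    have h3 : ∀ n : ℕ, (n : ℝ) ^ (2 * m) *
        ‖coeffL n (affineCurve g σ (a t) (β t) (η t))‖ ^ 2 =
        σ ^ 2 * ((n : ℝ) ^ (2 * m) * ‖coeffL n (mobiusFun g (β t) (η t))‖ ^ 2) := fun n => by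
      rcases n with _ | n
      · simp [hm]
      · rw [hsucc, norm_mul, Complex.norm_real, mul_pow, Real.norm_eq_abs, sq_abs]
        ring
    simp only [h3]
    refine ⟨h1.mul_left _, ?_⟩
    rw [tsum_mul_left, mul_assoc, mul_assoc]
    gcongr
  have hl1 : ∀ t, Summable fun n : ℕ => ‖coeffL n (affineCurve g σ (a t) (β t) (η t))‖ :=
    fun t => by
      obtain ⟨C, -, h⟩ := hmom 1 one_ne_zero
      refine (summable_norm_and_sq_le (r := 1) (by norm_num) le_rfl
        (summable_wgt_of_summable_mul_sq le_rfl ?_ (by simpa using (h t).1))).1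
      exact (summable_nat_add_iff 1).1 (hsum t).summable
  refine ⟨fun t n => coeffL n (affineCurve g σ (a t) (β t) (η t)), a, β, A, ?_,
    solvesSzego_affineCurve hg hg1 hg0 ha hβ hη hβ1 hη1 hl1, ha, hβ, a0, ?_, hβ1, hA, fun t => ?_,
    hsum, hmom⟩
  · have su : Summable fun n => ‖u n‖ := by simpa using hu 0
    ext n
    simp only
    rw [a0, β0, η0, affineCurve, ← hug, coeffL_fourierSum su]
  · rw [a0, β0, map_div₀, map_neg, Complex.conj_ofReal, Complex.conj_conj]
    field_simp
  · simp only [Nat.cast_zero]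
    rw [hz]
    refine (norm_add_le _ _).trans (add_le_add (hA t) ?_)
    rw [norm_mul, Complex.norm_real, Real.norm_of_nonneg hσ.le]
    nlinarith [hβ1 t]

section Growth

variable {s : ℝ} {u : ℕ → ℂ} {ε σ : ℝ}

theorem rpow_weight_le {s : ℝ} (hs : 1 / 2 < s) {m : ℕ} (hm : s ≤ m) {ε : ℝ} (hε : 0 < ε) (n : ℕ) :
    ((1 : ℝ) + ((n + 1 : ℕ) : ℝ) ^ 2) ^ s ≤
      2 ^ s * ε ^ (-(2 * s)) * (1 + ε ^ (2 * m) * ((n + 1 : ℕ) : ℝ) ^ (2 * m)) := by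
  have hx : (1 : ℝ) ≤ ((n + 1 : ℕ) : ℝ) := by push_cast; linarith [Nat.cast_nonneg (α := ℝ) n]
  generalize ((n + 1 : ℕ) : ℝ) = x at hx
  have hx0 : 0 < x := by linarith
  have h1 : (1 + x ^ 2) ^ s ≤ 2 ^ s * x ^ (2 * s) := by
    rw [Real.rpow_mul hx0.le, ← Real.mul_rpow (by norm_num) (by positivity), Real.rpow_two]
    exact Real.rpow_le_rpow (by positivity) (by nlinarith) (by linarith)
  have h2 : (ε * x) ^ (2 * s) ≤ 1 + (ε * x) ^ (2 * m) := by
    have hy : 0 < ε * x := by positivity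
    generalize ε * x = y at hy
    rcases le_total y 1 with h | h
    · have := Real.rpow_le_one hy.le h (by linarith : 0 ≤ 2 * s)
      have := pow_nonneg hy.le (2 * m)
      linarith
    · have := Real.rpow_le_rpow_of_exponent_le h (by linarith : 2 * s ≤ 2 * m)
      rw [show (2 * m : ℝ) = ((2 * m : ℕ) : ℝ) by push_cast; ring, Real.rpow_natCast] at this
      linarith
  rw [Real.mul_rpow hε.le hx0.le, mul_pow] at h2
  calc (1 + x ^ 2) ^ s ≤ 2 ^ s * x ^ (2 * s) := h1
    _ = 2 ^ s * ε ^ (-(2 * s)) * (ε ^ (2 * s) * x ^ (2 * s)) := by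
        rw [Real.rpow_neg hε.le]
        field_simp
    _ ≤ _ := by gcongr

theorem hsNormSq_eq (h : MemHs s u) : hsNormSq s u =
    ‖u 0‖ ^ 2 + ∑' n : ℕ, ((1 : ℝ) + ((n + 1 : ℕ) : ℝ) ^ 2) ^ s * ‖u (n + 1)‖ ^ 2 := by
  rw [hsNormSq, Summable.tsum_eq_zero_add h]
  simp

/-- Upper bound for the Sobolev norm by a moment of high order. -/
theorem hsNormSq_le (hs : 1 / 2 < s) {m : ℕ} (hm : s ≤ m) (hm0 : m ≠ 0) (hε : 0 < ε) {C : ℝ}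
    (h : HasSum (fun n => ‖u (n + 1)‖ ^ 2) (σ ^ 2 * ε))
    (h1 : Summable fun n : ℕ => (n : ℝ) ^ (2 * m) * ‖u n‖ ^ 2)
    (h2 : (∑' n : ℕ, (n : ℝ) ^ (2 * m) * ‖u n‖ ^ 2) * ε ^ (2 * m) ≤ C * ε) :
    hsNormSq s u ≤ ‖u 0‖ ^ 2 + 2 ^ s * (σ ^ 2 + C) * ε ^ (1 - 2 * s) := by
  have h3 : HasSum (fun n : ℕ => ((n + 1 : ℕ) : ℝ) ^ (2 * m) * ‖u (n + 1)‖ ^ 2)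
      (∑' n : ℕ, (n : ℝ) ^ (2 * m) * ‖u n‖ ^ 2) := by
    have := (hasSum_nat_add_iff' 1).2 h1.hasSum
    simpa [hm0] using this
  have h4 := (h.add (h3.mul_left (ε ^ (2 * m)))).mul_left (2 ^ s * ε ^ (-(2 * s)))
  have h5 : ∀ n : ℕ, ((1 : ℝ) + ((n + 1 : ℕ) : ℝ) ^ 2) ^ s * ‖u (n + 1)‖ ^ 2 ≤
      2 ^ s * ε ^ (-(2 * s)) * (‖u (n + 1)‖ ^ 2 +
        ε ^ (2 * m) * (((n + 1 : ℕ) : ℝ) ^ (2 * m) * ‖u (n + 1)‖ ^ 2)) := fun n =>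
    (mul_le_mul_of_nonneg_right (rpow_weight_le hs hm hε n) (sq_nonneg _)).trans_eq (by ring)
  have h6 : Summable fun n : ℕ => ((1 : ℝ) + ((n + 1 : ℕ) : ℝ) ^ 2) ^ s * ‖u (n + 1)‖ ^ 2 :=
    Summable.of_nonneg_of_le (fun n => by positivity) h5 h4.summable
  have h7 : MemHs s u := (summable_nat_add_iff 1).1 h6
  rw [hsNormSq_eq h7]
  gcongr
  refine (hasSum_le h5 h6.hasSum h4).trans ?_
  calc _ ≤ 2 ^ s * ε ^ (-(2 * s)) * (σ ^ 2 * ε + C * ε) :=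
        mul_le_mul_of_nonneg_left (by linarith) (by positivity)
    _ = _ := by
        rw [show 1 - 2 * s = -(2 * s) + 1 by ring, Real.rpow_add_one hε.ne']
        ring

theorem nat_le_add_rpow (hs : 1 / 2 < s) {L : ℝ} (hL : 0 < L) (n : ℕ) :
    (n : ℝ) ≤ L + L ^ (1 - 2 * s) * (1 + (n : ℝ) ^ 2) ^ s := by
  rcases le_or_gt (n : ℝ) L with h | h
  · have : 0 ≤ L ^ (1 - 2 * s) * (1 + (n : ℝ) ^ 2) ^ s := by positivity
    linarith
  · have hn : 0 < (n : ℝ) := hL.trans h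
    have h1 : (n : ℝ) ^ (2 * s) ≤ (1 + (n : ℝ) ^ 2) ^ s := by
      rw [Real.rpow_mul hn.le, Real.rpow_two]
      exact Real.rpow_le_rpow (by positivity) (by linarith) (by linarith)
    have h2 : (n : ℝ) ^ (1 - 2 * s) ≤ L ^ (1 - 2 * s) :=
      Real.rpow_le_rpow_of_nonpos hL h.le (by linarith)
    have h3 : (n : ℝ) = (n : ℝ) ^ (1 - 2 * s) * (n : ℝ) ^ (2 * s) := by
      rw [← Real.rpow_add hn]; simp
    calc (n : ℝ) = (n : ℝ) ^ (1 - 2 * s) * (n : ℝ) ^ (2 * s) := h3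
      _ ≤ L ^ (1 - 2 * s) * (1 + (n : ℝ) ^ 2) ^ s := by gcongr
      _ ≤ _ := by linarith

/-- Lower bound for the Sobolev norm by interpolation with the momentum. -/
theorem le_hsNormSq (hs : 1 / 2 < s) (hu : MemHs s u) (hε : 0 < ε) (hσ : 0 < σ)
    (h : HasSum (fun n => ‖u (n + 1)‖ ^ 2) (σ ^ 2 * ε)) {p : ℝ} (hp : 0 < p)
    (hsum : HasSum (fun n : ℕ => (n : ℝ) * ‖u n‖ ^ 2) p) :
    p / 2 * (p / (2 * σ ^ 2)) ^ (2 * s - 1) * ε ^ (1 - 2 * s) ≤ hsNormSq s u := by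
  set L := p / (2 * σ ^ 2) * ε⁻¹ with hLdef
  have hL : 0 < L := by positivity
  have h1 : HasSum (fun n : ℕ => ((n + 1 : ℕ) : ℝ) * ‖u (n + 1)‖ ^ 2) p := by
    simpa using (hasSum_nat_add_iff' 1).2 hsum
  have h2 : Summable fun n : ℕ => ((1 : ℝ) + ((n + 1 : ℕ) : ℝ) ^ 2) ^ s * ‖u (n + 1)‖ ^ 2 :=
    (summable_nat_add_iff 1).2 hu
  have h3 := hasSum_le (fun n => (mul_le_mul_of_nonneg_right (nat_le_add_rpow hs hL (n + 1))
    (sq_nonneg ‖u (n + 1)‖)).trans_eq (by ring)) h1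
    ((h.mul_left L).add (h2.hasSum.mul_left (L ^ (1 - 2 * s))))
  have h4 : L * (σ ^ 2 * ε) = p / 2 := by rw [hLdef]; field_simp
  have h5 : p / 2 ≤ L ^ (1 - 2 * s) * hsNormSq s u := by
    rw [hsNormSq_eq hu, mul_add]
    have : 0 ≤ L ^ (1 - 2 * s) * ‖u 0‖ ^ 2 := by positivity
    linarith
  have h6 : L ^ (2 * s - 1) = (p / (2 * σ ^ 2)) ^ (2 * s - 1) * ε ^ (1 - 2 * s) := by
    rw [hLdef, Real.mul_rpow (by positivity) (by positivity), Real.inv_rpow hε.le,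
      ← Real.rpow_neg hε.le, neg_sub]
  rw [mul_assoc, ← h6]
  calc p / 2 * L ^ (2 * s - 1) ≤ L ^ (1 - 2 * s) * hsNormSq s u * L ^ (2 * s - 1) := by gcongr
    _ = hsNormSq s u * (L ^ (1 - 2 * s) * L ^ (2 * s - 1)) := by ring
    _ = hsNormSq s u := by rw [← Real.rpow_add hL]; simp

end Growth

theorem not_le_sqrt_of_le {N : ℝ → ℝ} {k c M T : ℝ} (hk : 0 < k) (hc : 0 < c)
    (h : ∀ t, T ≤ |t| → c * Real.exp (k * |t|) ≤ Real.sqrt (N t)) (hM : ∀ t, N t ≤ M) : False := by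
  have h1 : Tendsto (fun t : ℝ => c * Real.exp (k * t)) atTop atTop :=
    (Real.tendsto_exp_atTop.comp (tendsto_id.const_mul_atTop hk)).const_mul_atTop hc
  obtain ⟨t, ht, ht0, htT⟩ := ((h1.eventually_gt_atTop (Real.sqrt M)).and
    ((eventually_ge_atTop 0).and (eventually_ge_atTop T))).exists
  have h2 := h t (by rwa [abs_of_nonneg ht0])
  rw [abs_of_nonneg ht0] at h2
  linarith [Real.sqrt_le_sqrt (hM t)]

theorem exists_sqrt_bounds {N ε : ℝ → ℝ} {s κ c C c₁ B C₁ : ℝ} (hs : 0 < 2 * s - 1) (hκ : 0 < κ)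
    (hc : 0 < c) (hC : 0 < C) (hc₁ : 0 < c₁) (hB : 0 ≤ B) (hC₁ : 0 ≤ C₁)
    (hε : ∀ t, 0 < ε t ∧ c * Real.exp (-(2 * κ * |t|)) ≤ ε t ∧
      ε t ≤ C * Real.exp (-(2 * κ * |t|)))
    (hlow : ∀ t, c₁ * ε t ^ (1 - 2 * s) ≤ N t) (hup : ∀ t, N t ≤ B + C₁ * ε t ^ (1 - 2 * s)) :
    ∃ c' C' : ℝ, 0 < c' ∧ ∀ t, c' * Real.exp (κ * (2 * s - 1) * |t|) ≤ Real.sqrt (N t) ∧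
      Real.sqrt (N t) ≤ C' * Real.exp (κ * (2 * s - 1) * |t|) := by
  have hpow : ∀ {d : ℝ} (t : ℝ), 0 < d → (d * Real.exp (-(2 * κ * |t|))) ^ (1 - 2 * s) =
      d ^ (1 - 2 * s) * Real.exp (κ * (2 * s - 1) * |t|) ^ 2 := fun {d} t hd => by
    rw [Real.mul_rpow hd.le (Real.exp_pos _).le, ← Real.exp_mul, ← Real.exp_nat_mul]
    congr 2
    push_cast
    ring
  refine ⟨Real.sqrt (c₁ * C ^ (1 - 2 * s)), Real.sqrt (B + C₁ * c ^ (1 - 2 * s)),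
    Real.sqrt_pos.2 (by positivity), fun t => ⟨?_, ?_⟩⟩
  · refine Real.le_sqrt_of_sq_le ?_
    rw [mul_pow, Real.sq_sqrt (by positivity), mul_assoc, ← hpow t hC]
    exact (mul_le_mul_of_nonneg_left (Real.rpow_le_rpow_of_nonpos (hε t).1 (hε t).2.2
      (by linarith)) hc₁.le).trans (hlow t)
  · refine Real.sqrt_le_iff.2 ⟨by positivity, ?_⟩
    rw [mul_pow, Real.sq_sqrt (by positivity), add_mul, mul_assoc C₁, ← hpow t hc]
    refine (hup t).trans ?_
    have he : 1 ≤ Real.exp (κ * (2 * s - 1) * |t|) ^ 2 :=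
      one_le_pow₀ (Real.one_le_exp (by positivity))
    have h1 := Real.rpow_le_rpow_of_nonpos (z := 1 - 2 * s) (by positivity) (hε t).2.1 (by linarith)
    exact add_le_add (le_mul_of_one_le_right hB he) (mul_le_mul_of_nonneg_left h1 hC₁)

/-- Suppose `α > 0`, `K_{u₀}` has finite rank and `Σ_K(u₀) = {σ}` with
`dim F_{u₀}(σ) = rank K_{u₀}`. Then the solution has exponentially growing `H^s` norm
`‖u(t)‖_{H^s} ≍ e^{C_α(2s−1)|t|}` if and only if
`L_1(u₀) = (K_{u₀}²u₀ | u₀) − α (K_{u₀}²1 | 1) = 0`. -/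
theorem exponential_growth_iff_L1_zero (α s : ℝ) (hα : 0 < α) (hs : 1/2 < s)
    (u₀ : ℕ → ℂ) (hu₀ : MemHs s u₀)
    (hfin : kuRank u₀ < Cardinal.aleph0)
    (σ : ℝ) (hσK : SigmaK u₀ = {σ})
    (hdim : Module.rank ℂ (Submodule.span ℂ (Fspace u₀ σ)) = kuRank u₀)
    (u : ℝ → ℕ → ℂ) (hu0 : u 0 = u₀) (hreg : SmoothHsCurve s u)
    (hsol : SolvesSzego α u) :
    (∃ Cα : ℝ, 0 < Cα ∧ ∃ c C T : ℝ, 0 < c ∧ c ≤ C ∧ 0 ≤ T ∧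
        ∀ t : ℝ, T ≤ |t| →
          c * Real.exp (Cα * (2 * s - 1) * |t|) ≤ Real.sqrt (hsNormSq s (u t)) ∧
          Real.sqrt (hsNormSq s (u t)) ≤ C * Real.exp (Cα * (2 * s - 1) * |t|)) ↔
      hinner (ku2 u₀ u₀) u₀ - (α : ℂ) * hinner (ku2 u₀ oneSeq) oneSeq = 0 := by
  set r := min s 1 with hrdef
  have hr : 1 / 2 < r := lt_min hs (by norm_num)
  have hr1 : r ≤ 1 := min_le_right _ _
  have su : ∀ t, Summable fun n => wgt r n ^ 2 * ‖u t n‖ ^ 2 := fun t =>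
    (hreg.1 t).summable_wgt (by linarith) (min_le_left _ _)
  have su₀ : Summable fun n => ‖u₀ n‖ := by
    rw [← hu0]; exact (summable_norm_and_sq_le hr hr1 (su 0)).1
  obtain ⟨hσ, a₀, ha₀, h0, hk, hn, hmom₀, hne, hL⟩ := exists_profile su₀ hfin hσK hdim α
  obtain ⟨v, a, β, A, hv0, hv, ha, hβ, a0, h1, hβ1, hA, hvz, hsum, hmom⟩ :=
    exists_explicit_solution α hσ ha₀ hmom₀ h0 hk hn
  have hmom1 : ∀ t, Summable fun n : ℕ => (n : ℝ) ^ 2 * ‖v t n‖ ^ 2 := fun t => by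
    obtain ⟨C, -, h⟩ := hmom 1 one_ne_zero
    simpa using (h t).1
  have sv : ∀ t, Summable fun n => wgt r n ^ 2 * ‖v t n‖ ^ 2 := fun t =>
    summable_wgt_of_summable_mul_sq hr1 ((summable_nat_add_iff 1).1 (hsum t).summable) (hmom1 t)
  obtain rfl : u = v := funext fun t =>
    eq_of_solution hα hr hr1 hsol hv su sv (hu0.trans hv0.symm) t
  have hε : ∀ t, 0 < 1 - ‖β t‖ ^ 2 := fun t => by nlinarith [norm_nonneg (β t), hβ1 t]
  have hA0 : 0 ≤ A := (norm_nonneg _).trans (hA 0)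
  rw [hL, ← a0]
  obtain ⟨m, hm⟩ := exists_nat_ge s
  have hm0 : m ≠ 0 := by
    rintro rfl
    norm_num at hm
    linarith
  obtain ⟨C₁, hC₁, hmomC⟩ := hmom m hm0
  have hup : ∀ t, hsNormSq s (u t) ≤
      (A + σ) ^ 2 + 2 ^ s * (σ ^ 2 + C₁) * (1 - ‖β t‖ ^ 2) ^ (1 - 2 * s) := fun t =>
    (hsNormSq_le hs hm hm0 (hε t) (hsum t) (hmomC t).1 (hmomC t).2).trans
      (add_le_add (pow_le_pow_left₀ (norm_nonneg _) (hvz t) 2) le_rfl)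
  constructor
  · rintro ⟨Cα, hCα, c, C, T, hc, -, -, hbd⟩
    by_contra hres
    obtain ⟨ε₀, hε₀, hlow⟩ := exists_lower_bound_of_nonresonant hα ha hβ hres hβ1 hA
    refine not_le_sqrt_of_le (mul_pos hCα (by linarith : 0 < 2 * s - 1)) hc (fun t ht => (hbd t ht).1)
      (M := (A + σ) ^ 2 + 2 ^ s * (σ ^ 2 + C₁) * ε₀ ^ (1 - 2 * s)) fun t => (hup t).trans ?_
    gcongr _ + _ * ?_
    exact Real.rpow_le_rpow_of_nonpos hε₀ (hlow t) (by linarith)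
  · intro hres
    obtain ⟨n₀, hn₀⟩ := hne
    have hmt : ∀ t, Summable fun n : ℕ => (n : ℝ) * ‖u t n‖ ^ 2 := fun t =>
      Summable.of_nonneg_of_le (fun n => by positivity) (fun n => by
        gcongr
        rw [← sq_abs, pow_two]
        exact_mod_cast Nat.le_mul_self n) (hmom1 t)
    set p := ∑' n : ℕ, (n : ℝ) * ‖u 0 n‖ ^ 2 with hp
    have hp0 : 0 < p := (hmt 0).tsum_pos (fun n => by positivity) (n₀ + 1) (by
      rw [hu0]
      have := norm_pos_iff.2 hn₀
      positivity)
    have hpt : ∀ t, HasSum (fun n : ℕ => (n : ℝ) * ‖u t n‖ ^ 2) p := fun t => by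
      rw [hp, ← momentum_eq hr hr1 hsol su t]
      exact (hmt t).hasSum
    have hσα : σ ^ 2 < α := by rw [← hres, a0]; gcongr
    obtain ⟨κ, c, C, hκ, hc, hC, hbd⟩ := exists_exp_bounds_of_resonant hσ hσα ha hβ hres h1
    obtain ⟨c', C', hc', h⟩ := exists_sqrt_bounds (by linarith : 0 < 2 * s - 1) hκ hc hC
      (by positivity) (sq_nonneg (A + σ)) (by positivity)
      (fun t => ⟨hε t, hbd t⟩)
      (fun t => le_hsNormSq hs (hreg.1 t) (hε t) hσ (hsum t) hp0 (hpt t)) hup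
    exact ⟨κ, hκ, c', C', 0, hc', by simpa using (h 0).1.trans (h 0).2, le_rfl, fun t _ => h t⟩

end
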